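/- Assume the multiplicity parameters are real with 0 < τ_a < 1 for all a ∈ R, and set t_α := τ_{α∨}². For μ ∈ P_c^{∨,+} := {μ ∈ P∨ : 0 ≤ ⟨μ,α⟩ ≤ c ∀α ∈ R₀⁺} let ξ_μ be the unique global minimum of 𝒱_μ, put C(ζ) := ∏_{α∈R₀⁺}(1 − t_α e^{−i⟨ζ,α⟩})/(1 − e^{−i⟨ζ,α⟩}), and define the periodic Macdonald spherical function Φ_μ : P_c⁺ → ℂ by Φ_μ(λ) := ∑_{v∈W₀} C(vξ_μ) e^{i⟨vξ_μ,λ⟩}. Then: (a) the family {Φ_μ : μ ∈ P_c^{∨,+}} is a basis of the (finite-dimensional) space of all functions P_c⁺ → ℂ; in particular #P_c^{∨,+} = #P_c⁺; and (b) for every ω ∈ P⁺ minuscule or quasi-minuscule, every μ ∈ P_c^{∨,+} and every λ ∈ P_c⁺: U_{λ,ω} Φ_μ(λ) + ∑_{ν∈W₀ω with λ−ν∈P_c⁺} V_{λ,ν} Φ_μ(λ−ν) = (∑_{ν∈W₀ω} e^{−i⟨ν,ξ_μ⟩}) Φ_μ(λ); that is, the Φ_μ form a complete basis of joint eigenfunctions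 of the discrete Laplacians L_ω with eigenvalues m_ω(e^{−iξ_μ}). -/

import Mathlib

open scoped RealInnerProductSpace BigOperators Classical

noncomputable section

/-- Alternating composition `A ∘ B ∘ A ∘ ⋯` with `m` factors (starting with `A`). -/
def altComp {α : Type*} (A B : α → α) : ℕ → (α → α)
  | 0 => id
  | m + 1 => A ∘ altComp B A m

/-- The sign of a real number, as an integer (with `sgnZ 0 = 0`). -/
def sgnZ (x : ℝ) : ℤ := if 0 < x then 1 else if x < 0 then -1 else 0

/-- The function `v(x) = (1-t²)∫₀ˣ dy/(1-2t cos y+t²)`. -/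
def mvfun (t x : ℝ) : ℝ :=
  (1 - t ^ 2) * ∫ y in (0:ℝ)..x, 1 / (1 - 2 * t * Real.cos y + t ^ 2)

section AffineOps

variable {V : Type*} [NormedAddCommGroup V] [InnerProductSpace ℝ V]

/-- The coroot `α∨ = 2α/⟨α,α⟩`. -/
def coroot (α : V) : V := (2 / ⟪α, α⟫) • α

/-- The affine root `a = α∨ + r c` (encoded as the pair `(α, r)`), as an affine
function on `V`. -/
def aval (c : ℝ) (a : V × ℤ) (x : V) : ℝ := ⟪x, coroot a.1⟫ + a.2 * c

/-- The affine reflection `s_a(x) = x - a(x) α` attached to `a = α∨ + r c`. -/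
def sAff (c : ℝ) (a : V × ℤ) (x : V) : V := x - aval c a x • a.1

/-- `w` maps the affine root `a` to the affine root `b`, i.e. `(wa)(x) = a(w⁻¹x) = b(x)`. -/
def mapsRoot (c : ℝ) (w : Equiv.Perm V) (a b : V × ℤ) : Prop :=
  ∀ x : V, aval c a (w⁻¹ x) = aval c b x

/-- The linear part `w′` of an affine transformation `w`. -/
def linPart (w : Equiv.Perm V) (x : V) : V := w x - w 0

variable {R : Type*} [Field R]

/-- The difference-reflection operator `T̂_a`. -/
def hatT (c : ℝ) (τ : V × ℤ → R) (a : V × ℤ) (f : V → R) (x : V) : R :=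
  if 0 < aval c a x then τ a * f (sAff c a x)
  else if aval c a x = 0 then τ a * f x
  else (τ a)⁻¹ * f (sAff c a x) + (τ a - (τ a)⁻¹) * f x

/-- The discrete integral operator `J_a`. -/
def Jop (c : ℝ) (a : V × ℤ) (f : V → R) (x : V) : R :=
  if 0 < aval c a x then
    - ∑ k ∈ Finset.Icc (1 : ℤ) ⌊aval c a x⌋, f (x - k • a.1)
  else if aval c a x = 0 then 0
  else ∑ k ∈ Finset.Ico (0 : ℤ) (-⌊aval c a x⌋), f (x + k • a.1)

/-- The integral-reflection operator `I_a = τ_a s_a + (τ_a - τ_a⁻¹) J_a`. -/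
def Iop (c : ℝ) (τ : V × ℤ → R) (a : V × ℤ) (f : V → R) (x : V) : R :=
  τ a * f (sAff c a x) + (τ a - (τ a)⁻¹) * Jop c a f x

end AffineOps

/-- An irreducible reduced crystallographic root system spanning `V`, together with a
choice of positive roots, simple roots, and the highest short root. -/
structure RootSystemData (V : Type*) [NormedAddCommGroup V] [InnerProductSpace ℝ V] :
    Type _ where
  n : ℕ
  n_pos : 1 ≤ n
  rank_eq : Module.finrank ℝ V = n
  R0 : Finset V
  ne_zero : ∀ α ∈ R0, α ≠ (0 : V)
  span_top : Submodule.span ℝ (R0 : Set V) = ⊤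
  reduced : ∀ α ∈ R0, ∀ t : ℝ, t • α ∈ R0 → t = 1 ∨ t = -1
  crystallographic : ∀ α ∈ R0, ∀ β ∈ R0, ∃ k : ℤ, ⟪β, coroot α⟫ = (k : ℝ)
  reflect_mem : ∀ α ∈ R0, ∀ β ∈ R0, β - ⟪β, coroot α⟫ • α ∈ R0
  irreducible : ∀ S : Finset V, S ⊆ R0 →
      (∀ a ∈ S, ∀ b ∈ R0, b ∉ S → ⟪a, b⟫ = 0) → S = ∅ ∨ S = R0
  pos : Finset V
  pos_subset : pos ⊆ R0
  pos_or_neg : ∀ α ∈ R0, α ∈ pos ∨ -α ∈ pos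
  pos_not_both : ∀ α ∈ pos, -α ∉ pos
  pos_add : ∀ α ∈ pos, ∀ β ∈ pos, α + β ∈ R0 → α + β ∈ pos
  simpleRoot : Fin n → V
  simpleRoot_mem : ∀ j, simpleRoot j ∈ pos
  pos_natCombo : ∀ α ∈ pos, ∃ k : Fin n → ℕ, α = ∑ j, (k j : ℝ) • simpleRoot j
  hshort : V
  hshort_mem : hshort ∈ pos
  hshort_short : ∀ α ∈ R0, ‖hshort‖ ≤ ‖α‖
  hshort_highest : ∀ α ∈ R0, ‖α‖ = ‖hshort‖ →
      ∃ k : Fin n → ℕ, hshort - α = ∑ j, (k j : ℝ) • simpleRoot j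

namespace RootSystemData

variable {V : Type*} [NormedAddCommGroup V] [InnerProductSpace ℝ V]
variable (D : RootSystemData V)

/-- The weight lattice `P`. -/
def weightLattice : Set V :=
  {x : V | ∀ α ∈ D.R0, ∃ k : ℤ, ⟪x, coroot α⟫ = (k : ℝ)}

/-- The root lattice `Q`. -/
def rootLattice : Set V := (Submodule.span ℤ (D.R0 : Set V) : Set V)

/-- The coweight lattice `P∨`. -/
def coweightLattice : Set V :=
  {x : V | ∀ α ∈ D.R0, ∃ k : ℤ, ⟪x, α⟫ = (k : ℝ)}

/-- The dominant cone. -/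
def dominant : Set V := {x : V | ∀ α ∈ D.pos, 0 ≤ ⟪x, coroot α⟫}

/-- `ω` is a minuscule (dominant) weight. -/
def IsMinuscule (ω : V) : Prop :=
  ω ∈ D.weightLattice ∧ ω ∈ D.dominant ∧ ω ≠ 0 ∧
    ∀ α ∈ D.pos, ⟪ω, coroot α⟫ ≤ 1

/-- `ω` is the quasi-minuscule weight, i.e. the highest short root. -/
def IsQuasiMinuscule (ω : V) : Prop := ω = D.hshort

/-- The saturated set `P_ϑ` containing the (quasi-)minuscule weights. -/
def Ptheta : Set V :=
  {ν : V | ν ∈ D.weightLattice ∧ ∀ α ∈ D.R0, α ≠ ν → |⟪ν, coroot α⟫| ≤ 1}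

/-- Half sum of the positive roots. -/
def rhoHalf : V := (2⁻¹ : ℝ) • ∑ α ∈ D.pos, α

/-- Half sum of the positive coroots. -/
def rhoVee : V := (2⁻¹ : ℝ) • ∑ α ∈ D.pos, coroot α

/-- `(α, r)` encodes an affine root. -/
def IsAffRoot (a : V × ℤ) : Prop := a.1 ∈ D.R0

/-- `(α, r)` encodes a positive affine root. -/
def IsAffPos (a : V × ℤ) : Prop :=
  a.1 ∈ D.R0 ∧ (1 ≤ a.2 ∨ (a.2 = 0 ∧ a.1 ∈ D.pos))

/-- `(α, r)` encodes a negative affine root. -/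
def IsAffNeg (a : V × ℤ) : Prop := D.IsAffPos (-a.1, -a.2)

/-- The simple affine roots `a₀ = -ϑ∨ + c`, `a_j = α_j∨`. -/
def aSimple (j : Fin (D.n + 1)) : V × ℤ :=
  Fin.cons (α := fun _ => V × ℤ) (-D.hshort, (1 : ℤ))
    (fun i => (D.simpleRoot i, (0 : ℤ))) j

/-- The reflections generating the finite Weyl group `W₀`. -/
def W0Gens : Set (Equiv.Perm V) :=
  {e | ∃ α ∈ D.R0, ∀ x, e x = x - ⟪x, coroot α⟫ • α}

/-- The finite Weyl group `W₀`. -/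
def W0 : Subgroup (Equiv.Perm V) := Subgroup.closure D.W0Gens

variable (c : ℝ)

/-- The affine reflections generating the affine Weyl group `W_R`. -/
def AffGens : Set (Equiv.Perm V) :=
  {e | ∃ a : V × ℤ, D.IsAffRoot a ∧ ∀ x, e x = sAff c a x}

/-- The affine Weyl group `W_R`. -/
def WR : Subgroup (Equiv.Perm V) := Subgroup.closure (D.AffGens c)

/-- The translations `t_{cλ}`, `λ ∈ P`. -/
def TransGens : Set (Equiv.Perm V) :=
  {e | ∃ lam ∈ D.weightLattice, ∀ x : V, e x = x + c • lam}

/-- The extended affine Weyl group `W = W₀ ⋉ t(cP)`. -/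
def Wext : Subgroup (Equiv.Perm V) :=
  Subgroup.closure (D.AffGens c ∪ D.TransGens c)

/-- The set `R(w) = R⁺ ∩ w⁻¹(R⁻)`. -/
def RW (w : Equiv.Perm V) : Set (V × ℤ) :=
  {a | D.IsAffPos a ∧ ∃ b : V × ℤ, D.IsAffNeg b ∧ mapsRoot c w a b}

/-- The length `ℓ(w) = #R(w)`. -/
def len (w : Equiv.Perm V) : ℕ := (D.RW c w).ncard

/-- The closed fundamental alcove `A_c`. -/
def alcove : Set V := {x | ∀ a : V × ℤ, D.IsAffPos a → 0 ≤ aval c a x}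

/-- `wmin x` is the unique shortest element of the affine Weyl group mapping `x` into
the fundamental alcove. -/
def IsWmin (wmin : V → Equiv.Perm V) : Prop :=
  ∀ x : V, wmin x ∈ D.WR c ∧ (wmin x) x ∈ D.alcove c ∧
    ∀ w ∈ D.WR c, w x ∈ D.alcove c → D.len c (wmin x) < D.len c w ∨ w = wmin x

/-- One step in the Bruhat order: `w < w s_a` whenever `ℓ(w) < ℓ(w s_a)`. -/
def bruhatStep (w w' : Equiv.Perm V) : Prop :=
  ∃ a : V × ℤ, D.IsAffPos a ∧ ∃ e : Equiv.Perm V,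
    (∀ x, e x = sAff c a x) ∧ w' = w * e ∧ D.len c w < D.len c w'

/-- The Bruhat order on the affine Weyl group. -/
def bruhatLE (w w' : Equiv.Perm V) : Prop :=
  Relation.ReflTransGen (D.bruhatStep c) w w'

/-- The partial order on `V`: `x ≤ y` iff `x₊ = y₊` and `w_x ≤ w_y` (Bruhat). -/
def vle (wmin : V → Equiv.Perm V) (x y : V) : Prop :=
  (wmin x) x = (wmin y) y ∧ D.bruhatLE c (wmin x) (wmin y)

/-- The interval `[x, y]` for the order `vle`. -/
def vInterval (wmin : V → Equiv.Perm V) (x y : V) : Set V :=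
  {z : V | D.vle c wmin x z ∧ D.vle c wmin z y}

/-- The partial order `⪯` on the weight lattice:
`μ ⪯ λ` iff `λ - μ ∈ Q` and `Conv [μ₊, μ] ⊆ Conv [λ₊, λ]`. -/
def pleq (wmin : V → Equiv.Perm V) (μ lam : V) : Prop :=
  lam - μ ∈ D.rootLattice ∧
    convexHull ℝ (D.vInterval c wmin ((wmin μ) μ) μ)
      ⊆ convexHull ℝ (D.vInterval c wmin ((wmin lam) lam) lam)

section Ops

variable {R : Type*} [Field R]

/-- `τ` is a multiplicity function: nonvanishing on affine roots, and invariant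
under the (extended affine) Weyl group action on the affine roots. -/
def IsMultiplicity (τ : V × ℤ → R) : Prop :=
  (∀ a : V × ℤ, D.IsAffRoot a → τ a ≠ 0) ∧
    ∀ w ∈ D.Wext c, ∀ a b : V × ℤ, D.IsAffRoot a → D.IsAffRoot b →
      mapsRoot c w a b → τ a = τ b

/-- `τ_w = ∏_{a ∈ R(w)} τ_a`. -/
def tauw (τ : V × ℤ → R) (w : Equiv.Perm V) : R := ∏ᶠ a ∈ D.RW c w, τ a

/-- `τ₀`, the multiplicity of the affine simple root `a₀`. -/
def tauZero (τ : V × ℤ → R) : R := τ (-D.hshort, (1 : ℤ))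

/-- The operator `I_{j₁} ∘ ⋯ ∘ I_{jℓ}` attached to a word in the simple reflections. -/
def wordOp (τ : V × ℤ → R) (l : List (Fin (D.n + 1))) : (V → R) → V → R :=
  (l.map fun j => Iop c τ (D.aSimple j)).foldr (· ∘ ·) id

/-- `l` is a reduced word for `w`, i.e. `w = s_{j₁} ∘ ⋯ ∘ s_{jℓ}` with `ℓ = ℓ(w)`. -/
def IsReducedWord (w : Equiv.Perm V) (l : List (Fin (D.n + 1))) : Prop :=
  l.length = D.len c w ∧
    ∀ x : V, w x = ((l.map fun j => sAff c (D.aSimple j)).foldr (· ∘ ·) id) x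

/-- `e∨_τ(η) = ∏_{α ∈ R₀⁺} τ_{α∨}^{⟨η,α∨⟩}`. -/
def etau (τ : V × ℤ → R) (η : V) : R :=
  ∏ α ∈ D.pos, τ (α, (0 : ℤ)) ^ ⌊⟪η, coroot α⟫⌋

/-- `h∨_τ = τ₀² e∨_τ(ϑ)`. -/
def hvee (τ : V × ℤ → R) : R := D.tauZero τ ^ 2 * D.etau τ D.hshort

/-- `θ(μ) = #{b ∈ R(w_μ) : b(μ) = -2}`. -/
def theta (wmin : V → Equiv.Perm V) (μ : V) : ℕ :=
  {b : V × ℤ | b ∈ D.RW c (wmin μ) ∧ aval c b μ = -2}.ncard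

/-- The coefficient `c_{λ,η} = θ(λ-η) e∨_τ(η) (h∨_τ)^{-sign⟨λ,η∨⟩}`. -/
def ccoef (τ : V × ℤ → R) (wmin : V → Equiv.Perm V) (lam η : V) : R :=
  (D.theta c wmin (lam - η) : R) * D.etau τ η *
    D.hvee τ ^ (-sgnZ ⟪lam, coroot η⟫)

/-- The coefficient `a_{λ,ν} = τ_{w_{w_λ(λ-ν)}} τ_{w_{w_λ(λ-ν)} w_λ} τ_{w_λ}⁻¹`. -/
def acoef (τ : V × ℤ → R) (wmin : V → Equiv.Perm V) (lam ν : V) : R :=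
  D.tauw c τ (wmin ((wmin lam) (lam - ν))) *
    D.tauw c τ (wmin ((wmin lam) (lam - ν)) * wmin lam) *
    (D.tauw c τ (wmin lam))⁻¹

/-- The coefficient `b_{λ,ν}`. -/
def bcoef (τ : V × ℤ → R) (wmin : V → Equiv.Perm V) (lam ν : V) : R :=
  if (wmin (lam - ν)) (lam - ν) = (wmin lam) lam then
    D.tauw c τ (wmin ((wmin lam) (lam - ν))) ^ 2 *
      (if D.IsAffNeg (ν, ⌊(1 - ⟪lam, coroot ν⟫) / c⌋) then 1 else 0)
  else D.ccoef c τ wmin ((wmin lam) lam) (linPart (wmin lam) ν)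

/-- The intertwining operator `(𝒥f)(λ) = τ_{w_λ}⁻¹ (I_{w_λ} f)(λ₊)`, where `Iw` assigns
to each `w_λ` the composite of integral-reflection operators along a reduced word. -/
def Jcal (τ : V × ℤ → R) (wmin : V → Equiv.Perm V)
    (Iw : Equiv.Perm V → (V → R) → V → R) (f : V → R) (x : V) : R :=
  (D.tauw c τ (wmin x))⁻¹ * Iw (wmin x) f ((wmin x) x)

end Ops

/-- The Yang–Yang type Morse function `𝒱_μ`. -/
def morse (t : V → ℝ) (μ ξ : V) : ℝ :=
  (c / 2) * ⟪ξ, ξ⟫ - 2 * Real.pi * ⟪D.rhoVee + μ, ξ⟫ +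
    ∑ α ∈ D.pos, (2 / ⟪α, α⟫) * ∫ x in (0:ℝ)..(⟪ξ, α⟫), mvfun (t α) x

/-- The critical equation `cξ + ∑_{α>0} v_α(⟨ξ,α⟩) α∨ = 2π(ρ∨+μ)`. -/
def criticalEq (t : V → ℝ) (μ ξ : V) : Prop :=
  c • ξ + ∑ α ∈ D.pos, mvfun (t α) ⟪ξ, α⟫ • coroot α
    = (2 * Real.pi) • (D.rhoVee + μ)

/-- The Hessian bilinear form `H_{η,ζ}(ξ)`. -/
def hessForm (t : V → ℝ) (ξ η ζ : V) : ℝ :=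
  c * ⟪η, ζ⟫ + ∑ α ∈ D.R0,
    (1 - t α ^ 2) * ⟪η, α⟫ * ⟪ζ, α⟫ /
      (⟪α, α⟫ * (1 - 2 * t α * Real.cos ⟪ξ, α⟫ + t α ^ 2))

/-- `κ_± = (2/n) ∑_{α>0} (1-t_α²)/(1 ± |t_α|)²`; here `s = ±1`. -/
def kappaPM (t : V → ℝ) (s : ℝ) : ℝ :=
  (2 / (D.n : ℝ)) * ∑ α ∈ D.pos, (1 - t α ^ 2) / (1 + s * |t α|) ^ 2

end RootSystemData

open RootSystemData in
/-- `P_c⁺ = P ∩ A_c`, the weights in the fundamental alcove. -/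
def Pc {V : Type*} [NormedAddCommGroup V] [InnerProductSpace ℝ V]
    (D : RootSystemData V) (c : ℝ) : Set V :=
  D.weightLattice ∩ D.alcove c

open RootSystemData in
/-- `P_c^{∨,+} = {μ ∈ P∨ : 0 ≤ ⟨μ,α⟩ ≤ c ∀ α ∈ R₀⁺}`. -/
def PcVee {V : Type*} [NormedAddCommGroup V] [InnerProductSpace ℝ V]
    (D : RootSystemData V) (c : ℝ) : Set V :=
  {μ : V | μ ∈ D.coweightLattice ∧ ∀ α ∈ D.pos, 0 ≤ ⟪μ, α⟫ ∧ ⟪μ, α⟫ ≤ c}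

open RootSystemData in
/-- `C(ζ) = ∏_{α ∈ R₀⁺} (1 - t_α e^{-i⟨ζ,α⟩})/(1 - e^{-i⟨ζ,α⟩})` with `t_α = τ_{α∨}²`. -/
def CfunSq {V : Type*} [NormedAddCommGroup V] [InnerProductSpace ℝ V]
    (D : RootSystemData V) (τ : V × ℤ → ℝ) (ζ : V) : ℂ :=
  ∏ α ∈ D.pos,
    (1 - ((τ (α, (0 : ℤ)) ^ 2 : ℝ) : ℂ) * Complex.exp (-(Complex.I * (⟪ζ, α⟫ : ℝ)))) /
      (1 - Complex.exp (-(Complex.I * (⟪ζ, α⟫ : ℝ))))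

open RootSystemData in
/-- The periodic Macdonald spherical function `Φ_μ(λ) = ∑_{v∈W₀} C(vξ_μ) e^{i⟨vξ_μ,λ⟩}`. -/
def PhiFun {V : Type*} [NormedAddCommGroup V] [InnerProductSpace ℝ V]
    (D : RootSystemData V) (τ : V × ℤ → ℝ) (W0fin : Finset (Equiv.Perm V))
    (ξ lam : V) : ℂ :=
  ∑ w ∈ W0fin, CfunSq D τ (w ξ) * Complex.exp (Complex.I * (⟪w ξ, lam⟫ : ℝ))

section RootBasics

variable {V : Type*} [NormedAddCommGroup V] [InnerProductSpace ℝ V]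

/-- Linear reflection. -/
def rf (α x : V) : V := x - ⟪x, coroot α⟫ • α

lemma inner_coroot (α x : V) : ⟪x, coroot α⟫ = 2 / ⟪α, α⟫ * ⟪x, α⟫ := by
  simp [coroot, inner_smul_right]

lemma coroot_inner (α x : V) : ⟪coroot α, x⟫ = 2 / ⟪α, α⟫ * ⟪α, x⟫ := by
  simp [coroot, inner_smul_left]

lemma inner_self_pos' {α : V} (h : α ≠ 0) : 0 < ⟪α, α⟫ := by
  rw [real_inner_self_eq_norm_sq]; positivity

lemma nonpos_zero {x : V} (h : ⟪x, x⟫ ≤ 0) : x = 0 := by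
  by_contra hx
  have := inner_self_pos' hx
  linarith

lemma inner_coroot_self {α : V} (h : α ≠ 0) : ⟪α, coroot α⟫ = 2 := by
  have := (inner_self_pos' h).ne'
  rw [inner_coroot]; field_simp

lemma coroot_neg (α : V) : coroot (-α) = -coroot α := by simp [coroot]

lemma coroot_ne_zero {α : V} (h : α ≠ 0) : coroot α ≠ 0 := by
  have := (inner_self_pos' h).ne'
  intro h2
  have := inner_coroot_self h
  simp [h2] at this

lemma coroot_coroot {α : V} (h : α ≠ 0) : coroot (coroot α) = α := by
  have := (inner_self_pos' h).ne'
  simp only [coroot, inner_smul_left, inner_smul_right, smul_smul]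
  have : (2 / (2 / ⟪α, α⟫ * ((starRingEnd ℝ) (2 / ⟪α, α⟫) * ⟪α, α⟫)) * (2 / ⟪α, α⟫)) = 1 := by
    simp only [conj_trivial]; field_simp
  rw [this, one_smul]

lemma coroot_inj {α β : V} (h : α ≠ 0) (h' : β ≠ 0) (e : coroot α = coroot β) : α = β := by
  rw [← coroot_coroot h, e, coroot_coroot h']

lemma rf_add (α x y : V) : rf α (x + y) = rf α x + rf α y := by
  simp only [rf, inner_add_left, add_smul]; abel

lemma rf_smul (α : V) (r : ℝ) (x : V) : rf α (r • x) = r • rf α x := by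
  simp only [rf, inner_smul_left, smul_sub, smul_smul]; simp

lemma rf_neg (α x : V) : rf α (-x) = - rf α x := by
  simp [rf, inner_neg_left]; abel

lemma rf_sub (α x y : V) : rf α (x - y) = rf α x - rf α y := by
  rw [sub_eq_add_neg, rf_add, rf_neg, ← sub_eq_add_neg]

lemma rf_neg_left (α x : V) : rf (-α) x = rf α x := by
  simp [rf, coroot_neg]

lemma rf_self {α : V} (h : α ≠ 0) : rf α α = -α := by
  rw [rf, inner_coroot_self h, two_smul]; abel

lemma rf_rf {α : V} (h : α ≠ 0) (x : V) : rf α (rf α x) = x := by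
  conv_lhs => rw [rf]
  have : ⟪rf α x, coroot α⟫ = -⟪x, coroot α⟫ := by
    rw [rf, inner_sub_left, inner_smul_left, inner_coroot_self h]; simp; ring
  rw [this, rf]; simp

lemma inner_rf_left (α x y : V) : ⟪rf α x, y⟫ = ⟪x, rf α y⟫ := by
  simp only [rf, inner_sub_left, inner_sub_right, inner_smul_left, inner_smul_right, inner_coroot]
  simp [real_inner_comm y α]; ring

lemma inner_rf_rf {α : V} (h : α ≠ 0) (x y : V) : ⟪rf α x, rf α y⟫ = ⟪x, y⟫ := by
  rw [inner_rf_left, rf_rf h]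

lemma rf_eq' (α x : V) : rf α x = x - ⟪x, α⟫ • coroot α := by
  rw [rf, inner_coroot, coroot, smul_smul, mul_comm]

lemma coroot_rf {α : V} (h : α ≠ 0) (β : V) : coroot (rf α β) = rf α (coroot β) := by
  conv_lhs => rw [coroot]
  rw [inner_rf_rf h, ← rf_smul, coroot]

lemma rf_zero (α : V) : rf α 0 = 0 := by simp [rf]

lemma rf_sum {ι : Type*} (α : V) (s : Finset ι) (f : ι → V) :
    rf α (∑ i ∈ s, f i) = ∑ i ∈ s, rf α (f i) := by
  induction s using Finset.induction_on with
  | empty => simp [rf_zero]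
  | insert a s ha ih => rw [Finset.sum_insert ha, Finset.sum_insert ha, rf_add, ih]

/-- Reflection as a permutation. -/
def rfPerm (α : V) (h : α ≠ 0) : Equiv.Perm V :=
  ⟨rf α, rf α, rf_rf h, rf_rf h⟩

end RootBasics

namespace RootSystemData

variable {V : Type*} [NormedAddCommGroup V] [InnerProductSpace ℝ V]
variable (D : RootSystemData V)

lemma rf_mem {α β : V} (ha : α ∈ D.R0) (hb : β ∈ D.R0) : rf α β ∈ D.R0 :=
  D.reflect_mem α ha β hb

lemma neg_mem {α : V} (ha : α ∈ D.R0) : -α ∈ D.R0 := by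
  have := D.rf_mem ha ha
  rwa [rf_self (D.ne_zero α ha)] at this

lemma pos_mem {α : V} (h : α ∈ D.pos) : α ∈ D.R0 := D.pos_subset h

lemma simple_mem (j : Fin D.n) : D.simpleRoot j ∈ D.R0 := D.pos_mem (D.simpleRoot_mem j)

lemma hshort_memR : D.hshort ∈ D.R0 := D.pos_mem D.hshort_mem

lemma simple_ne (j : Fin D.n) : D.simpleRoot j ≠ 0 := D.ne_zero _ (D.simple_mem j)

lemma hshort_ne : D.hshort ≠ 0 := D.ne_zero _ D.hshort_memR

lemma finDim (D : RootSystemData V) : FiniteDimensional ℝ V :=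
  Module.finite_of_finrank_pos (by rw [D.rank_eq]; exact D.n_pos)

lemma span_simple : (⊤ : Submodule ℝ V) ≤ Submodule.span ℝ (Set.range D.simpleRoot) := by
  rw [← D.span_top, Submodule.span_le]
  have key : ∀ α ∈ D.pos, α ∈ Submodule.span ℝ (Set.range D.simpleRoot) := by
    intro α ha
    obtain ⟨k, hk⟩ := D.pos_natCombo α ha
    rw [hk]
    exact Submodule.sum_mem _ fun j _ => Submodule.smul_mem _ _ (Submodule.subset_span ⟨j, rfl⟩)
  intro α ha
  rcases D.pos_or_neg α ha with h | h
  · exact key α h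
  · simpa using Submodule.neg_mem _ (key _ h)

/-- The basis of simple roots. -/
def bas : Module.Basis (Fin D.n) ℝ V :=
  basisOfTopLeSpanOfCardEqFinrank D.simpleRoot D.span_simple (by rw [D.rank_eq]; simp)

lemma bas_apply (j : Fin D.n) : D.bas j = D.simpleRoot j := by simp [bas]

lemma exists_dual (f : Fin D.n → ℝ) : ∃ x : V, ∀ j, ⟪x, D.simpleRoot j⟫ = f j := by
  have := D.finDim
  refine ⟨(InnerProductSpace.toDual ℝ V).symm (LinearMap.toContinuousLinearMap (D.bas.constr ℝ f)), ?_⟩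
  intro j
  rw [InnerProductSpace.toDual_symm_apply, ← bas_apply]
  simp

/-- A vector with `⟨x, α_j⟩ = f j`. -/
def dualv (f : Fin D.n → ℝ) : V := (D.exists_dual f).choose

lemma dualv_spec (f : Fin D.n → ℝ) (j) : ⟪D.dualv f, D.simpleRoot j⟫ = f j :=
  (D.exists_dual f).choose_spec j

lemma coord_simple (i j : Fin D.n) : D.bas.repr (D.simpleRoot i) j = if i = j then 1 else 0 := by
  rw [← bas_apply, Module.Basis.repr_self, Finsupp.single_apply]

lemma repr_nat {α : V} (h : α ∈ D.pos) : ∃ k : Fin D.n → ℕ, (∀ j, D.bas.repr α j = k j) := by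
  obtain ⟨k, hk⟩ := D.pos_natCombo α h
  refine ⟨k, fun j => ?_⟩
  have : α = ∑ j, (k j : ℝ) • D.bas j := by simpa [bas_apply] using hk
  rw [this, Module.Basis.repr_sum_self]

lemma repr_sum (x : V) : x = ∑ j, D.bas.repr x j • D.simpleRoot j := by
  conv_lhs => rw [← D.bas.sum_repr x]
  simp [bas_apply]

lemma inner_expand (x α : V) : ⟪x, α⟫ = ∑ j, D.bas.repr α j * ⟪x, D.simpleRoot j⟫ := by
  conv_lhs => rw [D.repr_sum α]
  simp [inner_sum, inner_smul_right]

lemma ext_simple {x y : V} (h : ∀ j, ⟪x, D.simpleRoot j⟫ = ⟪y, D.simpleRoot j⟫) : x = y := by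
  have h0 : ⟪x - y, x - y⟫ = 0 := by
    rw [D.inner_expand (x - y) (x - y)]
    apply Finset.sum_eq_zero
    intro j _
    rw [inner_sub_left, h j, sub_self, mul_zero]
  exact sub_eq_zero.1 (inner_self_eq_zero.1 h0)

lemma repr_nonneg {α : V} (h : α ∈ D.pos) (j) : 0 ≤ D.bas.repr α j := by
  obtain ⟨k, hk⟩ := D.repr_nat h
  rw [hk]; positivity

lemma exists_repr_pos {α : V} (h : α ∈ D.pos) : ∃ j, 0 < D.bas.repr α j := by
  by_contra! hn
  apply D.ne_zero α (D.pos_mem h)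
  rw [D.repr_sum α]
  apply Finset.sum_eq_zero
  intro j _
  rw [le_antisymm (hn j) (D.repr_nonneg h j), zero_smul]

lemma dom_pos {x : V} (h : ∀ j, 0 ≤ ⟪x, D.simpleRoot j⟫) {α : V} (ha : α ∈ D.pos) : 0 ≤ ⟪x, α⟫ := by
  rw [D.inner_expand x α]
  exact Finset.sum_nonneg fun j _ => mul_nonneg (D.repr_nonneg ha j) (h j)

lemma sdom_pos {x : V} (h : ∀ j, 0 < ⟪x, D.simpleRoot j⟫) {α : V} (ha : α ∈ D.pos) : 0 < ⟪x, α⟫ := by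
  rw [D.inner_expand x α]
  obtain ⟨j, hj⟩ := D.exists_repr_pos ha
  exact Finset.sum_pos' (fun j _ => mul_nonneg (D.repr_nonneg ha j) (h j).le)
    ⟨j, Finset.mem_univ _, mul_pos hj (h j)⟩

/-- The vector with all `⟨x, α_j⟩ = 1`. -/
def p0 : V := D.dualv (fun _ => 1)

lemma p0_simple (j) : ⟪D.p0, D.simpleRoot j⟫ = 1 := D.dualv_spec _ j

lemma p0_pos {α : V} (ha : α ∈ D.pos) : 0 < ⟪D.p0, α⟫ :=
  D.sdom_pos (fun j => by rw [p0_simple]; norm_num) ha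

lemma p0_nat {α : V} (ha : α ∈ D.pos) : ∃ k : ℕ, ⟪D.p0, α⟫ = k := by
  obtain ⟨k, hk⟩ := D.repr_nat ha
  refine ⟨∑ j, k j, ?_⟩
  rw [D.inner_expand]; simp [hk, p0_simple]

lemma pos_iff {x : V} (h : ∀ j, 0 < ⟪x, D.simpleRoot j⟫) {α : V} (ha : α ∈ D.R0) :
    α ∈ D.pos ↔ 0 < ⟪x, α⟫ := by
  refine ⟨fun h' => D.sdom_pos h h', fun h' => ?_⟩
  rcases D.pos_or_neg α ha with h1 | h1
  · exact h1
  · have := D.sdom_pos h h1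
    rw [inner_neg_right] at this; linarith

lemma rf_simple_pos {j : Fin D.n} {β : V} (hb : β ∈ D.pos) (hne : β ≠ D.simpleRoot j) :
    rf (D.simpleRoot j) β ∈ D.pos := by
  have hR := D.rf_mem (D.simple_mem j) (D.pos_mem hb)
  rcases D.pos_or_neg _ hR with h | h
  · exact h
  exfalso
  apply hne
  have hz : ∀ i, i ≠ j → D.bas.repr β i = 0 := by
    intro i hi
    have h1 := D.repr_nonneg h i
    have h2 := D.repr_nonneg hb i
    simp only [rf, map_neg, map_sub, map_smul, Finsupp.coe_neg, Finsupp.coe_sub, Pi.neg_apply,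
      Pi.sub_apply, Finsupp.coe_smul, Pi.smul_apply, coord_simple, if_neg hi.symm] at h1
    simp at h1
    linarith
  have hb1 : β = D.bas.repr β j • D.simpleRoot j := by
    conv_lhs => rw [D.repr_sum β]
    rw [Finset.sum_eq_single j]
    · intro i _ hi; rw [hz i hi, zero_smul]
    · simp
  have := D.reduced _ (D.simple_mem j) (D.bas.repr β j) (hb1 ▸ D.pos_mem hb)
  rcases this with h3 | h3
  · rw [hb1, h3, one_smul]
  · have := D.repr_nonneg hb j
    linarith

lemma cart {α β : V} (ha : α ∈ D.R0) (hb : β ∈ D.R0) : ∃ k : ℤ, ⟪β, coroot α⟫ = (k : ℝ) :=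
  D.crystallographic α ha β hb

lemma ht_induct {P : V → Prop} (h1 : ∀ j, P (D.simpleRoot j))
    (h2 : ∀ β ∈ D.pos, ∀ j, P β → P (rf (D.simpleRoot j) β)) :
    ∀ α ∈ D.pos, P α := by
  have key : ∀ N : ℕ, ∀ α ∈ D.pos, ⟪D.p0, α⟫ ≤ N → P α := by
    intro N
    induction N with
    | zero =>
      intro α ha h
      have := D.p0_pos ha
      simp at h; linarith
    | succ N ih =>
      intro α ha h
      have hα := inner_self_pos' (D.ne_zero α (D.pos_mem ha))
      obtain ⟨i, hi⟩ : ∃ i, 0 < ⟪α, D.simpleRoot i⟫ := by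
        by_contra! hn
        rw [D.inner_expand α α] at hα
        have : ∑ j, D.bas.repr α j * ⟪α, D.simpleRoot j⟫ ≤ 0 :=
          Finset.sum_nonpos fun j _ => mul_nonpos_of_nonneg_of_nonpos (D.repr_nonneg ha j) (hn j)
        linarith
      by_cases hs : α = D.simpleRoot i
      · rw [hs]; exact h1 i
      have hp := D.rf_simple_pos ha hs
      have h0 : (1:ℝ) ≤ ⟪α, coroot (D.simpleRoot i)⟫ := by
        obtain ⟨k, hk⟩ := D.cart (D.simple_mem i) (D.pos_mem ha)
        have hpos : 0 < ⟪α, coroot (D.simpleRoot i)⟫ := by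
          rw [inner_coroot]
          have := inner_self_pos' (D.simple_ne i)
          positivity
        rw [hk] at hpos ⊢
        exact_mod_cast hpos
      have := ih _ hp (by
        rw [rf, inner_sub_right, inner_smul_right, p0_simple]
        push_cast at h
        linarith)
      have h3 := h2 _ hp i this
      rwa [rf_rf (D.simple_ne i)] at h3
  intro α ha
  obtain ⟨k, hk⟩ := D.p0_nat ha
  exact key k α ha hk.le

lemma obtuse {i j : Fin D.n} (h : i ≠ j) : ⟪D.simpleRoot i, D.simpleRoot j⟫ ≤ 0 := by
  by_contra! hn
  have hne : D.simpleRoot i ≠ D.simpleRoot j := by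
    intro e; apply h; rw [← bas_apply, ← bas_apply] at e; exact D.bas.injective e
  have hp := D.rf_simple_pos (D.simpleRoot_mem i) hne
  have := D.repr_nonneg hp j
  simp only [rf, map_sub, map_smul, Finsupp.coe_sub,
      Pi.sub_apply, Finsupp.coe_smul, Pi.smul_apply, coord_simple, if_neg h] at this
  rw [inner_coroot] at this
  have h2 := inner_self_pos' (D.simple_ne j)
  have : 0 < 2 / ⟪D.simpleRoot j, D.simpleRoot j⟫ * ⟪D.simpleRoot i, D.simpleRoot j⟫ := by positivity
  simp at *
  linarith

lemma short_cartan {ν β : V} (hs : ‖ν‖ ≤ ‖β‖) (hν : ν ∈ D.R0) (hb : β ∈ D.R0) :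
    ∃ k : ℤ, ⟪ν, coroot β⟫ = k ∧ ((-1 ≤ k ∧ k ≤ 1) ∨ (k = 2 ∧ β = ν) ∨ (k = -2 ∧ β = -ν)) := by
  obtain ⟨k, hk⟩ := D.cart hb hν
  refine ⟨k, hk, ?_⟩
  have hbp := inner_self_pos' (D.ne_zero β hb)
  have e : 2 * ⟪ν, β⟫ = k * ⟪β, β⟫ := by
    rw [← hk, inner_coroot]; field_simp
  have hs2 : ⟪ν, ν⟫ ≤ ⟪β, β⟫ := by
    rw [real_inner_self_eq_norm_sq, real_inner_self_eq_norm_sq]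
    exact pow_le_pow_left₀ (norm_nonneg _) hs 2
  have h2 := D.ne_zero β hb
  rcases lt_or_ge 1 k with h | h
  · have hk2 : (2:ℝ) ≤ k := by exact_mod_cast h
    have : ⟪ν - β, ν - β⟫ ≤ 0 := by
      simp only [inner_sub_left, inner_sub_right]
      rw [real_inner_comm ν β]
      nlinarith
    have e2 : ν - β = 0 := nonpos_zero this
    have e3 : ν = β := sub_eq_zero.1 e2
    subst e3
    rw [inner_coroot_self h2] at hk
    right; left
    exact ⟨by exact_mod_cast hk.symm, rfl⟩
  rcases lt_or_ge k (-1) with h' | h'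
  · have hk2 : (k:ℝ) ≤ -2 := by exact_mod_cast (by omega : k ≤ -2)
    have : ⟪ν + β, ν + β⟫ ≤ 0 := by
      simp only [inner_add_left, inner_add_right]
      rw [real_inner_comm ν β]
      nlinarith
    have e2 : ν + β = 0 := nonpos_zero this
    have e3 : ν = -β := eq_neg_of_add_eq_zero_left e2
    right; right
    rw [e3, inner_neg_left, inner_coroot_self h2] at hk
    exact ⟨by exact_mod_cast hk.symm, by rw [e3, neg_neg]⟩
  · left; exact ⟨h', h⟩

lemma norm_rf {α : V} (h : α ≠ 0) (x : V) : ‖rf α x‖ = ‖x‖ := by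
  rw [← sq_eq_sq₀ (norm_nonneg _) (norm_nonneg _), ← real_inner_self_eq_norm_sq,
    ← real_inner_self_eq_norm_sq, inner_rf_rf h]

lemma hshort_dom (j) : 0 ≤ ⟪D.hshort, D.simpleRoot j⟫ := by
  obtain ⟨k, hk⟩ := D.hshort_highest (rf (D.simpleRoot j) D.hshort)
    (D.rf_mem (D.simple_mem j) D.hshort_memR) (norm_rf (D.simple_ne j) _)
  have h1 : ⟪D.hshort, coroot (D.simpleRoot j)⟫ • D.simpleRoot j = ∑ j, (k j : ℝ) • D.bas j := by
    simp only [bas_apply]; rw [← hk, rf]; abel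
  have h2 := congrArg (fun v => D.bas.repr v j) h1
  simp only [Module.Basis.repr_sum_self, map_smul, Finsupp.coe_smul, Pi.smul_apply,
    coord_simple] at h2
  simp at h2
  have h3 : (0:ℝ) ≤ ⟪D.hshort, coroot (D.simpleRoot j)⟫ := by rw [h2]; positivity
  rw [inner_coroot] at h3
  have h4 := inner_self_pos' (D.simple_ne j)
  by_contra! hn
  have : 2 / ⟪D.simpleRoot j, D.simpleRoot j⟫ * ⟪D.hshort, D.simpleRoot j⟫ < 0 :=
    mul_neg_of_pos_of_neg (by positivity) hn
  linarith

lemma hshort_inner_nonneg {γ : V} (h : γ ∈ D.pos) : 0 ≤ ⟪D.hshort, γ⟫ := D.dom_pos D.hshort_dom h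

lemma pos_of_hshort {γ : V} (h : γ ∈ D.R0) (hp : 0 < ⟪D.hshort, γ⟫) : γ ∈ D.pos := by
  rcases D.pos_or_neg γ h with h1 | h1
  · exact h1
  · have := D.hshort_inner_nonneg h1
    rw [inner_neg_right] at this; linarith

/-- A dominant root has full support. -/
lemma full_support {β : V} (hb : β ∈ D.pos) (hd : ∀ j, 0 ≤ ⟪β, D.simpleRoot j⟫) (i) :
    0 < D.bas.repr β i := by
  set J : Set (Fin D.n) := {j | 0 < D.bas.repr β j} with hJ
  have horth : ∀ j ∈ J, ∀ i, i ∉ J → ⟪D.simpleRoot j, D.simpleRoot i⟫ = 0 := by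
    intro j hj i hi
    have hij : j ≠ i := by rintro rfl; exact hi hj
    have hi0 : D.bas.repr β i = 0 := le_antisymm (not_lt.1 hi) (D.repr_nonneg hb i)
    have h1 := hd i
    rw [real_inner_comm, D.inner_expand] at h1
    have hle : ∀ l ∈ Finset.univ, D.bas.repr β l * ⟪D.simpleRoot i, D.simpleRoot l⟫ ≤ 0 := by
      intro l _
      by_cases hl : l = i
      · subst hl; rw [hi0]; simp
      · exact mul_nonpos_of_nonneg_of_nonpos (D.repr_nonneg hb l) (D.obtuse (Ne.symm hl))
    have h2 := (Finset.sum_eq_zero_iff_of_nonpos hle).1 (le_antisymm (Finset.sum_nonpos hle) h1) j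
      (Finset.mem_univ _)
    rw [real_inner_comm]
    exact (mul_eq_zero.1 h2).resolve_left (ne_of_gt hj)
  set SJ : Submodule ℝ V := Submodule.span ℝ (D.simpleRoot '' J) with hSJ
  set SK : Submodule ℝ V := Submodule.span ℝ (D.simpleRoot '' Jᶜ) with hSK
  have hperp : ∀ x ∈ SJ, ∀ y ∈ SK, ⟪x, y⟫ = 0 := by
    intro x hx y hy
    induction hx using Submodule.span_induction with
    | zero => simp
    | add a b _ _ ha hb => rw [inner_add_left, ha, hb, add_zero]
    | smul r a _ ha => rw [inner_smul_left, ha, mul_zero]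
    | mem x hx =>
      obtain ⟨j, hj, rfl⟩ := hx
      induction hy using Submodule.span_induction with
      | zero => simp
      | add a b _ _ ha hb => rw [inner_add_right, ha, hb, add_zero]
      | smul r a _ ha => rw [inner_smul_right, ha, mul_zero]
      | mem y hy =>
        obtain ⟨i, hi, rfl⟩ := hy
        exact horth j hj i hi
  have hdec : ∀ α ∈ D.pos, α ∈ SJ ∨ α ∈ SK := by
    apply D.ht_induct (P := fun α => α ∈ SJ ∨ α ∈ SK)
    · intro j
      by_cases hj : j ∈ J
      · left; exact Submodule.subset_span ⟨j, hj, rfl⟩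
      · right; exact Submodule.subset_span ⟨j, hj, rfl⟩
    · intro γ hγ j hor
      by_cases hj : j ∈ J
      · have hm : D.simpleRoot j ∈ SJ := Submodule.subset_span ⟨j, hj, rfl⟩
        rcases hor with h | h
        · left; exact Submodule.sub_mem _ h (Submodule.smul_mem _ _ hm)
        · right
          have : rf (D.simpleRoot j) γ = γ := by
            rw [rf, inner_coroot, real_inner_comm (D.simpleRoot j) γ, hperp _ hm _ h]; simp
          rwa [this]
      · have hm : D.simpleRoot j ∈ SK := Submodule.subset_span ⟨j, hj, rfl⟩
        rcases hor with h | h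
        · left
          have : rf (D.simpleRoot j) γ = γ := by
            rw [rf, inner_coroot, hperp _ h _ hm]; simp
          rwa [this]
        · right; exact Submodule.sub_mem _ h (Submodule.smul_mem _ _ hm)
  have hdecR : ∀ α ∈ D.R0, α ∈ SJ ∨ α ∈ SK := by
    intro α ha
    rcases D.pos_or_neg α ha with h | h
    · exact hdec α h
    · rcases hdec _ h with h' | h'
      · left; simpa using Submodule.neg_mem _ h'
      · right; simpa using Submodule.neg_mem _ h'
  have hirr := D.irreducible (D.R0.filter (· ∈ SJ)) (Finset.filter_subset _ _) (by
    intro a ha b hb hnb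
    rw [Finset.mem_filter] at ha hnb
    exact hperp _ ha.2 _ ((hdecR b hb).resolve_left fun h => hnb ⟨hb, h⟩))
  rcases hirr with h | h
  · exfalso
    obtain ⟨j, hj⟩ := D.exists_repr_pos hb
    have : D.simpleRoot j ∈ D.R0.filter (· ∈ SJ) := by
      rw [Finset.mem_filter]
      exact ⟨D.simple_mem j, Submodule.subset_span ⟨j, hj, rfl⟩⟩
    rw [h] at this; simp at this
  · by_contra hi
    have h1 : D.simpleRoot i ∈ SJ := by
      have : D.simpleRoot i ∈ D.R0.filter (· ∈ SJ) := by rw [h]; exact D.simple_mem i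
      exact (Finset.mem_filter.1 this).2
    have h2 : D.simpleRoot i ∈ SK := Submodule.subset_span ⟨i, hi, rfl⟩
    have := hperp _ h1 _ h2
    exact (inner_self_pos' (D.simple_ne i)).ne' this

/-- `ϑ∨` is the highest coroot. -/
lemma highest_coroot {x : V} (hx : ∀ j, 0 ≤ ⟪x, D.simpleRoot j⟫) {β : V} (hb : β ∈ D.R0) :
    ⟪x, coroot β⟫ ≤ ⟪x, coroot D.hshort⟫ := by
  -- roots with positive pairing against ϑ
  have key : ∀ γ ∈ D.R0, 0 < ⟪D.hshort, γ⟫ → ⟪x, coroot γ⟫ ≤ ⟪x, coroot D.hshort⟫ := by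
    intro γ hγ hp
    by_cases he : γ = D.hshort
    · rw [he]
    obtain ⟨k, hk, hor⟩ := D.short_cartan (D.hshort_short γ hγ) D.hshort_memR hγ
    have hγp := inner_self_pos' (D.ne_zero γ hγ)
    have hkpos : (0:ℝ) < k := by rw [← hk, inner_coroot]; positivity
    have hk0 : 0 < k := by exact_mod_cast hkpos
    have hk1 : k = 1 := by
      rcases hor with h | h | h
      · omega
      · exact absurd h.2 he
      · omega
    have hδ := D.rf_mem D.hshort_memR hγ
    have hco : coroot (rf D.hshort γ) = coroot γ - coroot D.hshort := by
      rw [coroot_rf D.hshort_ne, rf_eq', real_inner_comm, hk, hk1]; simp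
    have hneg : -(rf D.hshort γ) ∈ D.pos := by
      apply D.pos_of_hshort (D.neg_mem hδ)
      rw [inner_neg_right, ← inner_rf_left, rf_self D.hshort_ne, inner_neg_left]
      simpa using hp
    have h1 := D.dom_pos hx hneg
    have h2 : 0 ≤ ⟪x, coroot (-(rf D.hshort γ))⟫ := by
      rw [inner_coroot]
      have := inner_self_pos' (D.ne_zero _ (D.pos_mem hneg))
      positivity
    rw [coroot_neg, hco, inner_neg_right, inner_sub_right] at h2
    linarith
  -- choose the maximal root in the orbit-order
  obtain ⟨m, hm, hmax⟩ := Finset.exists_max_image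
    (D.R0.filter fun γ => ⟪x, coroot β⟫ ≤ ⟪x, coroot γ⟫) (fun γ => ⟪D.p0, coroot γ⟫)
    ⟨β, by simp [hb]⟩
  rw [Finset.mem_filter] at hm
  have hdom : ∀ j, 0 ≤ ⟪m, D.simpleRoot j⟫ := by
    intro j
    by_contra! hn
    have hR := D.rf_mem (D.simple_mem j) hm.1
    have hmp := inner_self_pos' (D.ne_zero m hm.1)
    have hco : coroot (rf (D.simpleRoot j) m)
        = coroot m - ⟪coroot m, D.simpleRoot j⟫ • coroot (D.simpleRoot j) := by
      rw [coroot_rf (D.simple_ne j), rf_eq']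
    have hlt : ⟪coroot m, D.simpleRoot j⟫ < 0 := by
      rw [coroot_inner]
      exact mul_neg_of_pos_of_neg (by positivity) hn
    have hsp := inner_self_pos' (D.simple_ne j)
    have h1 : 0 ≤ ⟪x, coroot (D.simpleRoot j)⟫ := by
      rw [inner_coroot]; have := hx j; positivity
    have h2 : 0 < ⟪D.p0, coroot (D.simpleRoot j)⟫ := by
      rw [inner_coroot, p0_simple]; positivity
    have := hmax (rf (D.simpleRoot j) m) (by
      rw [Finset.mem_filter]
      refine ⟨hR, ?_⟩
      rw [hco, inner_sub_right, inner_smul_right]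
      nlinarith [hm.2])
    rw [hco, inner_sub_right, inner_smul_right] at this
    nlinarith
  have hmpos : m ∈ D.pos := by
    rcases D.pos_or_neg m hm.1 with h | h
    · exact h
    · have := D.dom_pos hdom h
      rw [inner_neg_right] at this
      have := inner_self_pos' (D.ne_zero m hm.1)
      linarith
  refine hm.2.trans (key m hm.1 ?_)
  rw [D.inner_expand]
  have hfs := D.full_support hmpos hdom
  obtain ⟨j, hj⟩ : ∃ j, 0 < ⟪D.hshort, D.simpleRoot j⟫ := by
    by_contra! hn
    apply D.hshort_ne
    apply D.ext_simple
    intro j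
    rw [inner_zero_left]
    exact le_antisymm (hn j) (D.hshort_dom j)
  exact Finset.sum_pos' (fun l _ => mul_nonneg (hfs l).le (D.hshort_dom l))
    ⟨j, Finset.mem_univ _, mul_pos (hfs j) hj⟩

end RootSystemData

namespace RootSystemData

variable {V : Type*} [NormedAddCommGroup V] [InnerProductSpace ℝ V]
variable (D : RootSystemData V)

lemma rfPerm_mem {α : V} (h : α ∈ D.R0) : rfPerm α (D.ne_zero α h) ∈ D.W0 :=
  Subgroup.subset_closure ⟨α, h, fun _ => rfl⟩

lemma W0_props {w : Equiv.Perm V} (hw : w ∈ D.W0) :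
    (∀ x y, w (x + y) = w x + w y) ∧ (∀ (r : ℝ) x, w (r • x) = r • w x) ∧
    (∀ x y, ⟪w x, w y⟫ = ⟪x, y⟫) ∧ (∀ α ∈ D.R0, w α ∈ D.R0) := by
  unfold W0 at hw
  induction hw using Subgroup.closure_induction with
  | mem e he =>
    obtain ⟨α, ha, h⟩ := he
    have h' : ∀ x, e x = rf α x := h
    simp only [h']
    exact ⟨rf_add α, rf_smul α, inner_rf_rf (D.ne_zero α ha), fun β hb => D.rf_mem ha hb⟩
  | one => simp
  | mul a b _ _ ha hb =>
    obtain ⟨a1, a2, a3, a4⟩ := ha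
    obtain ⟨b1, b2, b3, b4⟩ := hb
    refine ⟨?_, ?_, ?_, ?_⟩
    · intro x y; simp [b1, a1]
    · intro x y; simp [b2, a2]
    · intro x y; simp [a3, b3]
    · intro α h; exact a4 _ (b4 _ h)
  | inv a _ ha =>
    obtain ⟨a1, a2, a3, a4⟩ := ha
    refine ⟨?_, ?_, ?_, ?_⟩
    · intro x y; apply a.injective; simp [a1]
    · intro x y; apply a.injective; simp [a2]
    · intro x y; rw [← a3]; simp
    · intro α h
      have himg : D.R0.image a = D.R0 := by
        apply Finset.eq_of_subset_of_card_le
        · intro y hy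
          obtain ⟨x, hx, rfl⟩ := Finset.mem_image.1 hy
          exact a4 x hx
        · rw [Finset.card_image_of_injective _ a.injective]
      rw [← himg] at h
      obtain ⟨x, hx, rfl⟩ := Finset.mem_image.1 h
      simpa using hx

section W0
variable {D}
variable {w : Equiv.Perm V} (hw : w ∈ D.W0)

lemma W0_add (hw : w ∈ D.W0) (x y : V) : w (x + y) = w x + w y := (D.W0_props hw).1 x y
lemma W0_smul (hw : w ∈ D.W0) (r : ℝ) (x : V) : w (r • x) = r • w x := (D.W0_props hw).2.1 r x
lemma W0_inner (hw : w ∈ D.W0) (x y : V) : ⟪w x, w y⟫ = ⟪x, y⟫ := (D.W0_props hw).2.2.1 x y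
lemma W0_mem (hw : w ∈ D.W0) {α : V} (h : α ∈ D.R0) : w α ∈ D.R0 := (D.W0_props hw).2.2.2 α h
lemma W0_zero (hw : w ∈ D.W0) : w 0 = 0 := by simpa using W0_smul hw 0 0
lemma W0_neg (hw : w ∈ D.W0) (x : V) : w (-x) = - w x := by simpa using W0_smul hw (-1) x
lemma W0_sub (hw : w ∈ D.W0) (x y : V) : w (x - y) = w x - w y := by
  rw [sub_eq_add_neg, W0_add hw, W0_neg hw, ← sub_eq_add_neg]
lemma W0_inv (hw : w ∈ D.W0) : w⁻¹ ∈ D.W0 := D.W0.inv_mem hw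
lemma W0_inner' (hw : w ∈ D.W0) (x y : V) : ⟪w x, y⟫ = ⟪x, w⁻¹ y⟫ := by
  rw [← W0_inner (W0_inv hw) (w x) y]; simp
lemma W0_coroot (hw : w ∈ D.W0) (x : V) : coroot (w x) = w (coroot x) := by
  rw [coroot, W0_inner hw, coroot, W0_smul hw]
end W0

/-! ### lattices -/

lemma P_sub {x y : V} (hx : x ∈ D.weightLattice) (hy : y ∈ D.weightLattice) :
    x - y ∈ D.weightLattice := by
  intro α ha
  obtain ⟨k, hk⟩ := hx α ha
  obtain ⟨l, hl⟩ := hy α ha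
  exact ⟨k - l, by rw [inner_sub_left, hk, hl]; push_cast; ring⟩

lemma P_add {x y : V} (hx : x ∈ D.weightLattice) (hy : y ∈ D.weightLattice) :
    x + y ∈ D.weightLattice := by
  intro α ha
  obtain ⟨k, hk⟩ := hx α ha
  obtain ⟨l, hl⟩ := hy α ha
  exact ⟨k + l, by rw [inner_add_left, hk, hl]; push_cast; ring⟩

lemma P_zsmul {x : V} (m : ℤ) (hx : x ∈ D.weightLattice) :
    (m : ℝ) • x ∈ D.weightLattice := by
  intro α ha
  obtain ⟨k, hk⟩ := hx α ha
  exact ⟨m * k, by rw [inner_smul_left, hk]; simp⟩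

lemma P_root {α : V} (h : α ∈ D.R0) : α ∈ D.weightLattice := fun β hb => D.cart hb h

lemma P_W0 {w : Equiv.Perm V} (hw : w ∈ D.W0) {x : V} (hx : x ∈ D.weightLattice) :
    w x ∈ D.weightLattice := by
  intro α ha
  obtain ⟨k, hk⟩ := hx _ (W0_mem (W0_inv hw) ha)
  refine ⟨k, ?_⟩
  rw [W0_inner' hw, ← W0_coroot (W0_inv hw), hk]

lemma simpleCoroot_pos (j) : 0 < 2 / ⟪D.simpleRoot j, D.simpleRoot j⟫ := by
  have := inner_self_pos' (D.simple_ne j); positivity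

/-- The vector with `⟨x, α_j∨⟩ = f j`. -/
def dualw (f : Fin D.n → ℝ) : V :=
  D.dualv (fun j => f j / (2 / ⟪D.simpleRoot j, D.simpleRoot j⟫))

lemma dualw_spec (f : Fin D.n → ℝ) (j) : ⟪D.dualw f, coroot (D.simpleRoot j)⟫ = f j := by
  rw [inner_coroot, dualw, dualv_spec]
  exact mul_div_cancel₀ _ (D.simpleCoroot_pos j).ne'

lemma ext_simpleCoroot {x y : V}
    (h : ∀ j, ⟪x, coroot (D.simpleRoot j)⟫ = ⟪y, coroot (D.simpleRoot j)⟫) : x = y := by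
  apply D.ext_simple
  intro j
  have := h j
  rw [inner_coroot, inner_coroot] at this
  exact mul_left_cancel₀ (D.simpleCoroot_pos j).ne' this

lemma coroot_int {α : V} (ha : α ∈ D.R0) :
    coroot α ∈ AddSubgroup.closure (Set.range fun j => coroot (D.simpleRoot j)) := by
  have key : ∀ α ∈ D.pos, α ∈ D.R0 ∧
      coroot α ∈ AddSubgroup.closure (Set.range fun j => coroot (D.simpleRoot j)) := by
    apply D.ht_induct (P := fun α => α ∈ D.R0 ∧
      coroot α ∈ AddSubgroup.closure (Set.range fun j => coroot (D.simpleRoot j)))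
    · intro j; exact ⟨D.simple_mem j, AddSubgroup.subset_closure ⟨j, rfl⟩⟩
    · intro β _ j ⟨h0, h⟩
      refine ⟨D.rf_mem (D.simple_mem j) h0, ?_⟩
      rw [coroot_rf (D.simple_ne j), rf_eq']
      obtain ⟨k, hk⟩ := D.cart h0 (D.simple_mem j)
      rw [real_inner_comm, hk, Int.cast_smul_eq_zsmul]
      exact AddSubgroup.sub_mem _ h
        (AddSubgroup.zsmul_mem _ (AddSubgroup.subset_closure (Set.mem_range_self j)) k)
  rcases D.pos_or_neg α ha with h | h
  · exact (key α h).2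
  · have := (key _ h).2
    rw [coroot_neg] at this
    simpa using AddSubgroup.neg_mem _ this

lemma P_of_simple {x : V} (h : ∀ j, ∃ k : ℤ, ⟪x, coroot (D.simpleRoot j)⟫ = k) :
    x ∈ D.weightLattice := by
  intro α ha
  have := D.coroot_int ha
  generalize coroot α = z at this ⊢
  induction this using AddSubgroup.closure_induction with
  | mem y hy => obtain ⟨j, rfl⟩ := hy; exact h j
  | zero => exact ⟨0, by simp⟩
  | add a b _ _ ha hb =>
    obtain ⟨k, hk⟩ := ha; obtain ⟨l, hl⟩ := hb
    exact ⟨k + l, by rw [inner_add_right, hk, hl]; push_cast; ring⟩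
  | neg a _ ha =>
    obtain ⟨k, hk⟩ := ha
    exact ⟨-k, by rw [inner_neg_right, hk]; push_cast; ring⟩

/-- Fundamental weights. -/
def fw (i : Fin D.n) : V := D.dualw (fun j => if j = i then 1 else 0)

lemma fw_spec (i j) : ⟪D.fw i, coroot (D.simpleRoot j)⟫ = if j = i then 1 else 0 := D.dualw_spec _ j

lemma fw_mem (i) : D.fw i ∈ D.weightLattice := by
  apply D.P_of_simple
  intro j
  rw [fw_spec]
  split_ifs
  · exact ⟨1, by simp⟩
  · exact ⟨0, by simp⟩

/-- `Q∨`. -/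
def Qv : AddSubgroup V := AddSubgroup.closure (coroot '' (D.R0 : Set V))
/-- `Q`. -/
def Qr : AddSubgroup V := AddSubgroup.closure (D.R0 : Set V)

lemma Qv_of_dual {η : V} (h : ∀ x ∈ D.weightLattice, ∃ k : ℤ, ⟪η, x⟫ = k) : η ∈ D.Qv := by
  choose k hk using fun i => h (D.fw i) (D.fw_mem i)
  have : η = ∑ i, (k i) • coroot (D.simpleRoot i) := by
    -- test against the weights, which span
    have hx : ∀ x : V, ⟪η - ∑ i, (k i) • coroot (D.simpleRoot i), x⟫ = 0 := by
      intro x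
      have hxe : x = ∑ i, ⟪x, coroot (D.simpleRoot i)⟫ • D.fw i := by
        apply D.ext_simpleCoroot
        intro j
        simp [sum_inner, inner_smul_left, fw_spec]
      rw [hxe, inner_sum]
      apply Finset.sum_eq_zero
      intro i _
      rw [inner_smul_right, inner_sub_left, hk, sum_inner]
      simp only [← Int.cast_smul_eq_zsmul ℝ, inner_smul_left]
      simp [real_inner_comm (D.fw i), fw_spec]
    exact sub_eq_zero.1 (inner_self_eq_zero.1 (hx _))
  rw [this]
  exact AddSubgroup.sum_mem _ fun i _ => AddSubgroup.zsmul_mem _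
    (AddSubgroup.subset_closure (Set.mem_image_of_mem coroot (D.simple_mem i))) _

/-- Fundamental coweights. -/
def fcw (i : Fin D.n) : V := D.dualv (fun j => if j = i then 1 else 0)

lemma fcw_spec (i j) : ⟪D.fcw i, D.simpleRoot j⟫ = if j = i then 1 else 0 := D.dualv_spec _ j

lemma repr_int {α : V} (h : α ∈ D.R0) : ∃ k : Fin D.n → ℤ, (∀ j, D.bas.repr α j = k j) := by
  rcases D.pos_or_neg α h with h | h
  · obtain ⟨k, hk⟩ := D.repr_nat h
    exact ⟨fun j => k j, fun j => by simp [hk]⟩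
  · obtain ⟨k, hk⟩ := D.repr_nat h
    refine ⟨fun j => -k j, fun j => ?_⟩
    have := hk j
    simp at this ⊢
    linarith

lemma Pv_of_simple {x : V} (h : ∀ j, ∃ k : ℤ, ⟪x, D.simpleRoot j⟫ = k) :
    x ∈ D.coweightLattice := by
  intro α ha
  obtain ⟨k, hk⟩ := D.repr_int ha
  choose l hl using h
  refine ⟨∑ j, k j * l j, ?_⟩
  rw [D.inner_expand]; simp [hk, hl]

lemma fcw_mem (i) : D.fcw i ∈ D.coweightLattice := by
  apply D.Pv_of_simple
  intro j
  rw [fcw_spec]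
  split_ifs
  · exact ⟨1, by simp⟩
  · exact ⟨0, by simp⟩

lemma Qr_of_dual {η : V} (h : ∀ x ∈ D.coweightLattice, ∃ k : ℤ, ⟪η, x⟫ = k) : η ∈ D.Qr := by
  choose k hk using fun i => h (D.fcw i) (D.fcw_mem i)
  have : η = ∑ i, (k i) • D.simpleRoot i := by
    have hx : ∀ x : V, ⟪η - ∑ i, (k i) • D.simpleRoot i, x⟫ = 0 := by
      intro x
      have hxe : x = ∑ i, ⟪x, D.simpleRoot i⟫ • D.fcw i := by
        apply D.ext_simple
        intro j
        simp [sum_inner, inner_smul_left, fcw_spec]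
      rw [hxe, inner_sum]
      apply Finset.sum_eq_zero
      intro i _
      rw [inner_smul_right, inner_sub_left, hk, sum_inner]
      simp only [← Int.cast_smul_eq_zsmul ℝ, inner_smul_left]
      simp [real_inner_comm (D.fcw i), fcw_spec]
    exact sub_eq_zero.1 (inner_self_eq_zero.1 (hx _))
  rw [this]
  exact AddSubgroup.sum_mem _ fun i _ => AddSubgroup.zsmul_mem _
    (AddSubgroup.subset_closure (D.simple_mem i)) _

lemma coroot_add_aux {α β : V} (ha : α ∈ D.R0) (hb : β ∈ D.R0) (h : ⟪α, β⟫ < 0) (hn : ‖α‖ ≤ ‖β‖) :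
    coroot α + coroot β = 0 ∨ ∃ γ ∈ D.R0, coroot γ = coroot α + coroot β := by
  obtain ⟨k, hk, hor⟩ := D.short_cartan hn ha hb
  have hbp := inner_self_pos' (D.ne_zero β hb)
  have hk0 : (k:ℝ) < 0 := by
    rw [← hk, inner_coroot]; exact mul_neg_of_pos_of_neg (by positivity) h
  have hk1 : k < 0 := by exact_mod_cast hk0
  rcases hor with h1 | h1 | h1
  · right
    refine ⟨rf α β, D.rf_mem ha hb, ?_⟩
    have : k = -1 := by omega
    rw [coroot_rf (D.ne_zero α ha), rf_eq', real_inner_comm, hk, this]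
    simp [add_comm]
  · omega
  · left; rw [h1.2, coroot_neg]; simp

lemma coroot_add {α β : V} (ha : α ∈ D.R0) (hb : β ∈ D.R0) (h : ⟪α, β⟫ < 0) :
    coroot α + coroot β = 0 ∨ ∃ γ ∈ D.R0, coroot γ = coroot α + coroot β := by
  rcases le_total ‖α‖ ‖β‖ with hn | hn
  · exact D.coroot_add_aux ha hb h hn
  · rw [add_comm (coroot α)]
    exact D.coroot_add_aux hb ha (by rwa [real_inner_comm]) hn

/-- There is no nonzero minuscule element in the coroot lattice. -/
lemma Qv_small {η : V} (hη : η ∈ D.Qv) (h : ∀ α ∈ D.R0, ⟪η, α⟫ < 2) : η = 0 := by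
  have hex : ∃ m : ℕ, ∃ s : Multiset V, Multiset.card s = m ∧ (∀ β ∈ s, β ∈ D.R0) ∧
      (s.map coroot).sum = η := by
    unfold Qv at hη
    clear h
    induction hη using AddSubgroup.closure_induction with
    | mem y hy => obtain ⟨β, hb, rfl⟩ := hy; exact ⟨_, {β}, rfl, by simpa using hb, by simp⟩
    | zero => exact ⟨0, 0, by simp⟩
    | add a b _ _ ha hb =>
      obtain ⟨_, s, _, h1, h2⟩ := ha
      obtain ⟨_, s', _, h1', h2'⟩ := hb
      refine ⟨_, s + s', rfl, ?_, by simp [h2, h2']⟩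
      intro β hb
      rcases Multiset.mem_add.1 hb with hb | hb
      · exact h1 β hb
      · exact h1' β hb
    | neg a _ ha =>
      obtain ⟨_, s, _, h1, h2⟩ := ha
      refine ⟨_, s.map (fun x => -x), rfl, ?_, ?_⟩
      · intro β hb
        obtain ⟨γ, hγ, rfl⟩ := Multiset.mem_map.1 hb
        exact D.neg_mem (h1 γ hγ)
      · rw [Multiset.map_map, ← h2]
        simp only [Function.comp_def, coroot_neg]
        rw [Multiset.sum_map_neg]
  obtain ⟨s, hs, hR, hsum⟩ := Nat.find_spec hex
  have hmin := fun {m} => Nat.find_min hex (m := m)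
  rcases Multiset.empty_or_exists_mem s with h0 | ⟨β, hb⟩
  · rw [← hsum, h0]; simp
  exfalso
  obtain ⟨s', rfl⟩ := Multiset.exists_cons_of_mem hb
  have hβ := hR β hb
  have hnn : ∀ γ ∈ s', 0 ≤ ⟪coroot γ, β⟫ := by
    intro γ hγ
    by_contra! hneg
    have hγR := hR γ (Multiset.mem_cons_of_mem hγ)
    have hlt : ⟪β, γ⟫ < 0 := by
      rw [coroot_inner] at hneg
      have := inner_self_pos' (D.ne_zero γ hγR)
      by_contra! h'
      rw [real_inner_comm] at h'
      have : 0 ≤ 2 / ⟪γ, γ⟫ * ⟪γ, β⟫ := by positivity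
      linarith
    obtain ⟨s'', rfl⟩ := Multiset.exists_cons_of_mem hγ
    rcases D.coroot_add hβ hγR hlt with h1 | ⟨δ, hδ, h1⟩
    · refine hmin (m := Multiset.card s'') ?_ ⟨s'', rfl, ?_, ?_⟩
      · rw [← hs]; simp
      · intro x hx; exact hR x (by simp [hx])
      · rw [← hsum]; simp only [Multiset.map_cons, Multiset.sum_cons]
        rw [← add_assoc, h1, zero_add]
    · refine hmin (m := Multiset.card s'' + 1) ?_ ⟨δ ::ₘ s'', by simp, ?_, ?_⟩
      · rw [← hs]; simp
      · intro x hx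
        rcases Multiset.mem_cons.1 hx with rfl | hx
        · exact hδ
        · exact hR x (by simp [hx])
      · rw [← hsum]; simp only [Multiset.map_cons, Multiset.sum_cons]
        rw [← add_assoc, h1]
  have h2 := h β hβ
  rw [← hsum] at h2
  have h3 : ∀ t : Multiset V, (∀ γ ∈ t, 0 ≤ ⟪coroot γ, β⟫) → 0 ≤ ⟪(t.map coroot).sum, β⟫ := by
    intro t
    induction t using Multiset.induction_on with
    | empty => simp
    | cons a t ih =>
      intro ht
      rw [Multiset.map_cons, Multiset.sum_cons, inner_add_left]
      exact add_nonneg (ht a (by simp)) (ih fun γ hγ => ht γ (by simp [hγ]))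
  rw [Multiset.map_cons, Multiset.sum_cons, inner_add_left, real_inner_comm,
    inner_coroot_self (D.ne_zero β hβ)] at h2
  have hlast := h3 s' hnn
  linarith [hlast]

/-! ### finiteness of balls -/

lemma finite_ball {n : ℕ} (v : Fin n → V) (hv : ∀ x y : V, (∀ j, ⟪x, v j⟫ = ⟪y, v j⟫) → x = y)
    (p : V) (r : ℝ) : {x : V | (∀ j, ∃ k : ℤ, ⟪x, v j⟫ = k) ∧ ‖x - p‖ < r}.Finite := by
  set M : ℝ := (‖p‖ + r) * (∑ j, ‖v j‖) with hM
  have hbd : (Set.Icc (fun _ : Fin n => -⌈M⌉) (fun _ : Fin n => ⌈M⌉)).Finite := Set.finite_Icc _ _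
  apply Set.Finite.of_finite_image (f := fun x => fun j => ⌊⟪x, v j⟫⌋)
  · apply hbd.subset
    rintro _ ⟨x, ⟨hx, hr⟩, rfl⟩
    have hle : ∀ j, |⟪x, v j⟫| ≤ M := by
      intro j
      have h1 : ‖x‖ ≤ ‖p‖ + r := by
        have := norm_add_le p (x - p)
        rw [add_sub_cancel] at this
        linarith
      have h2 : ‖v j‖ ≤ ∑ j, ‖v j‖ := Finset.single_le_sum (f := fun j => ‖v j‖)
        (fun i _ => norm_nonneg _) (Finset.mem_univ j)
      calc |⟪x, v j⟫| ≤ ‖x‖ * ‖v j‖ := abs_real_inner_le_norm _ _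
        _ ≤ M := by
          rw [hM]
          exact mul_le_mul h1 h2 (norm_nonneg _) (le_trans (norm_nonneg _) h1)
    constructor
    · intro j
      have h1 := (abs_le.1 (hle j)).1
      show -⌈M⌉ ≤ ⌊⟪x, v j⟫⌋
      rw [Int.le_floor]
      push_cast
      linarith [Int.le_ceil M]
    · intro j
      have h1 := (abs_le.1 (hle j)).2
      show ⌊⟪x, v j⟫⌋ ≤ ⌈M⌉
      have : (⌊⟪x, v j⟫⌋ : ℝ) ≤ ⌈M⌉ := (Int.floor_le _).trans (h1.trans (Int.le_ceil M))
      exact_mod_cast this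
  · rintro x ⟨hx, _⟩ y ⟨hy, _⟩ he
    apply hv
    intro j
    obtain ⟨k, hk⟩ := hx j
    obtain ⟨l, hl⟩ := hy j
    have := congrFun he j
    simp only [hk, hl, Int.floor_intCast] at this
    rw [hk, hl, this]

lemma P_ball (p : V) (r : ℝ) : {x : V | x ∈ D.weightLattice ∧ ‖x - p‖ < r}.Finite := by
  apply (finite_ball (fun j => coroot (D.simpleRoot j)) (fun x y h => D.ext_simpleCoroot h) p r).subset
  rintro x ⟨hx, hr⟩
  exact ⟨fun j => hx _ (D.simple_mem j), hr⟩

lemma Pv_ball (p : V) (r : ℝ) : {x : V | x ∈ D.coweightLattice ∧ ‖x - p‖ < r}.Finite := by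
  apply (finite_ball D.simpleRoot (fun x y h => D.ext_simple h) p r).subset
  rintro x ⟨hx, hr⟩
  exact ⟨fun j => hx _ (D.simple_mem j), hr⟩

lemma dist_induct {S : Set V} (p : V) (hfin : ∀ r, {x : V | x ∈ S ∧ ‖x - p‖ < r}.Finite)
    {Q : V → Prop} (h : ∀ x ∈ S, (∀ y ∈ S, ‖y - p‖ < ‖x - p‖ → Q y) → Q x) : ∀ x ∈ S, Q x := by
  have key : ∀ N : ℕ, ∀ x ∈ S, {y : V | y ∈ S ∧ ‖y - p‖ < ‖x - p‖}.ncard < N → Q x := by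
    intro N
    induction N with
    | zero => intro x _ h; omega
    | succ N ih =>
      intro x hx hN
      apply h x hx
      intro y hy hlt
      apply ih y hy
      refine lt_of_lt_of_le (Set.ncard_lt_ncard ?_ (hfin _)) (Nat.lt_succ_iff.1 hN)
      refine ⟨fun z hz => ⟨hz.1, hz.2.trans hlt⟩, fun hsub => ?_⟩
      exact lt_irrefl _ (hsub ⟨hy, hlt⟩).2
  intro x hx
  exact key _ x hx (Nat.lt_succ_self _)

end RootSystemData

namespace RootSystemData

variable {V : Type*} [NormedAddCommGroup V] [InnerProductSpace ℝ V]
variable (D : RootSystemData V) (c : ℝ)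

/-! ### base point -/

/-- A base point in the interior of the alcove. -/
def bp : V := (c / ((∑ α ∈ D.R0, (|⟪D.p0, coroot α⟫| + |⟪D.p0, α⟫|)) + 1)) • D.p0

lemma bp_aux : 0 < (∑ α ∈ D.R0, (|⟪D.p0, coroot α⟫| + |⟪D.p0, α⟫|)) + 1 := by positivity

variable {c} (hc : 0 < c)

lemma bp_simple (hc : 0 < c) (j) : 0 < ⟪D.bp c, D.simpleRoot j⟫ := by
  rw [bp, inner_smul_left, p0_simple]
  have := D.bp_aux
  simp only [conj_trivial, mul_one]; positivity

lemma bp_bound (hc : 0 < c) {α : V} (ha : α ∈ D.R0) :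
    |⟪D.bp c, coroot α⟫| < c ∧ |⟪D.bp c, α⟫| < c := by
  have h0 := D.bp_aux
  have h1 : |⟪D.p0, coroot α⟫| + |⟪D.p0, α⟫| ≤
      ∑ α ∈ D.R0, (|⟪D.p0, coroot α⟫| + |⟪D.p0, α⟫|) :=
    Finset.single_le_sum (f := fun α => |⟪D.p0, coroot α⟫| + |⟪D.p0, α⟫|)
      (fun i _ => by positivity) ha
  rw [bp, inner_smul_left, inner_smul_left]
  set M := (∑ α ∈ D.R0, (|⟪D.p0, coroot α⟫| + |⟪D.p0, α⟫|)) + 1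
  have e1 := abs_nonneg ⟪D.p0, coroot α⟫
  have e2 := abs_nonneg ⟪D.p0, α⟫
  simp only [conj_trivial, abs_mul, abs_of_pos (div_pos hc h0)]
  constructor
  · rw [div_mul_eq_mul_div, div_lt_iff₀ h0]
    exact mul_lt_mul_of_pos_left (by linarith) hc
  · rw [div_mul_eq_mul_div, div_lt_iff₀ h0]
    exact mul_lt_mul_of_pos_left (by linarith) hc

lemma bp_pos (hc : 0 < c) {α : V} (ha : α ∈ D.R0) : α ∈ D.pos ↔ 0 < ⟪D.bp c, coroot α⟫ := by
  rw [D.pos_iff (D.bp_simple hc) ha, inner_coroot]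
  have := inner_self_pos' (D.ne_zero α ha)
  constructor
  · intro h; positivity
  · intro h; exact (mul_pos_iff_of_pos_left (by positivity)).1 h

/-! ### affine roots -/

lemma aval_neg (c : ℝ) (a : V × ℤ) (x : V) : aval c (-a.1, -a.2) x = - aval c a x := by
  simp [aval, coroot_neg]; ring

lemma affpos_iff (hc : 0 < c) (b : V × ℤ) :
    D.IsAffPos b ↔ b.1 ∈ D.R0 ∧ 0 < aval c b (D.bp c) := by
  unfold IsAffPos
  refine and_congr_right fun hb => ?_
  have h1 := abs_lt.1 (D.bp_bound hc hb).1
  have h2 := D.bp_pos hc hb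
  unfold aval
  constructor
  · rintro (h | ⟨h, h'⟩)
    · have : (1:ℝ) ≤ b.2 := by exact_mod_cast h
      nlinarith
    · rw [h]; simpa using h2.1 h'
  · intro h
    have h3 : (-1:ℝ) < b.2 := by
      by_contra! h3
      nlinarith
    have h4 : -1 < b.2 := by exact_mod_cast h3
    rcases eq_or_ne b.2 0 with h5 | h5
    · right; refine ⟨h5, h2.2 ?_⟩
      rw [h5] at h; simpa using h
    · left; omega

lemma affpos_or (b : V × ℤ) (hb : b.1 ∈ D.R0) : D.IsAffPos b ∨ D.IsAffPos (-b.1, -b.2) := by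
  unfold IsAffPos
  have := D.neg_mem hb
  rcases lt_trichotomy b.2 0 with h | h | h
  · right; exact ⟨this, Or.inl (by simp; omega)⟩
  · rcases D.pos_or_neg _ hb with h' | h'
    · left; exact ⟨hb, Or.inr ⟨h, h'⟩⟩
    · right; exact ⟨this, Or.inr ⟨by simp [h], h'⟩⟩
  · left; exact ⟨hb, Or.inl (by omega)⟩

lemma affneg_iff (hc : 0 < c) (b : V × ℤ) :
    D.IsAffNeg b ↔ b.1 ∈ D.R0 ∧ aval c b (D.bp c) < 0 := by
  unfold IsAffNeg
  rw [D.affpos_iff hc, aval_neg]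
  constructor
  · rintro ⟨h, h'⟩; exact ⟨by simpa using D.neg_mem h, by linarith⟩
  · rintro ⟨h, h'⟩; exact ⟨D.neg_mem h, by linarith⟩

lemma aval_bp_ne (hc : 0 < c) (b : V × ℤ) (hb : b.1 ∈ D.R0) : aval c b (D.bp c) ≠ 0 := by
  rcases D.affpos_or b hb with h | h
  · exact ((D.affpos_iff hc b).1 h).2.ne'
  · exact ((D.affneg_iff hc b).1 h).2.ne

lemma aval_inj (hc : 0 < c) {a b : V × ℤ} (ha : a.1 ∈ D.R0) (hb : b.1 ∈ D.R0)
    (h : ∀ x, aval c a x = aval c b x) : a = b := by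
  have h0 := h 0
  simp only [aval, inner_zero_left, zero_add] at h0
  have h2 : (a.2 : ℝ) = b.2 := mul_right_cancel₀ hc.ne' h0
  have h3 : a.2 = b.2 := by exact_mod_cast h2
  refine Prod.ext (coroot_inj (D.ne_zero _ ha) (D.ne_zero _ hb) ?_) h3
  apply ext_inner_left ℝ
  intro x
  have := h x
  simp only [aval, h2] at this
  linarith

/-- The action of reflections on affine roots. -/
def ract (a b : V × ℤ) : V × ℤ := (rf a.1 b.1, b.2 - ⌊⟪a.1, coroot b.1⟫⌋ * a.2)

lemma aval_ract (c : ℝ) {a b : V × ℤ} (ha : a.1 ∈ D.R0) (hb : b.1 ∈ D.R0) (x : V) :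
    aval c (ract a b) x = aval c b (sAff c a x) := by
  obtain ⟨k, hk⟩ := D.cart hb ha
  simp only [ract, aval, sAff, hk, Int.floor_intCast]
  rw [coroot_rf (D.ne_zero _ ha), ← inner_rf_left, rf, inner_sub_left, inner_sub_left,
    inner_smul_left, inner_smul_left, hk]
  push_cast
  simp only [conj_trivial]
  ring

lemma ract_mem {a b : V × ℤ} (ha : a.1 ∈ D.R0) (hb : b.1 ∈ D.R0) : (ract a b).1 ∈ D.R0 :=
  D.rf_mem ha hb

lemma aval_sAff_self (c : ℝ) {a : V × ℤ} (ha : a.1 ∈ D.R0) (x : V) :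
    aval c a (sAff c a x) = - aval c a x := by
  have := inner_coroot_self (D.ne_zero _ ha)
  simp only [aval, sAff, inner_sub_left, inner_smul_left, this]
  simp only [conj_trivial]; ring

lemma sAff_sAff (c : ℝ) {a : V × ℤ} (ha : a.1 ∈ D.R0) (x : V) : sAff c a (sAff c a x) = x := by
  conv_lhs => rw [sAff]
  rw [D.aval_sAff_self c ha, sAff]; simp

lemma ract_ract (hc : 0 < c) {a b : V × ℤ} (ha : a.1 ∈ D.R0) (hb : b.1 ∈ D.R0) :
    ract a (ract a b) = b := by
  apply D.aval_inj hc (D.ract_mem ha (D.ract_mem ha hb)) hb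
  intro x
  rw [D.aval_ract c ha (D.ract_mem ha hb), D.aval_ract c ha hb, D.sAff_sAff c ha]

lemma ract_self (hc : 0 < c) {a : V × ℤ} (ha : a.1 ∈ D.R0) : ract a a = (-a.1, -a.2) := by
  apply D.aval_inj hc (D.ract_mem ha ha) (D.neg_mem ha)
  intro x
  rw [D.aval_ract c ha ha, D.aval_sAff_self c ha, aval_neg]

/-- The affine reflection as a permutation. -/
def sPerm (c : ℝ) {a : V × ℤ} (ha : a.1 ∈ D.R0) : Equiv.Perm V :=
  ⟨sAff c a, sAff c a, D.sAff_sAff c ha, D.sAff_sAff c ha⟩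

lemma sPerm_apply (c : ℝ) {a : V × ℤ} (ha : a.1 ∈ D.R0) (x) : D.sPerm c ha x = sAff c a x := rfl
lemma sPerm_inv (c : ℝ) {a : V × ℤ} (ha : a.1 ∈ D.R0) : (D.sPerm c ha)⁻¹ = D.sPerm c ha := rfl

lemma sPerm_mem (c : ℝ) {a : V × ℤ} (ha : a.1 ∈ D.R0) : D.sPerm c ha ∈ D.WR c :=
  Subgroup.subset_closure ⟨a, ha, fun _ => rfl⟩

lemma Qr_P {η : V} (h : η ∈ D.Qr) : η ∈ D.weightLattice := by
  unfold Qr at h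
  induction h using AddSubgroup.closure_induction with
  | mem y hy => exact D.P_root hy
  | zero => intro α _; exact ⟨0, by simp⟩
  | add a b _ _ ha hb => exact D.P_add ha hb
  | neg a _ ha => have := D.P_zsmul (-1) ha; simpa using this

lemma Qr_W0 {w : Equiv.Perm V} (hw : w ∈ D.W0) {η : V} (h : η ∈ D.Qr) : w η ∈ D.Qr := by
  unfold Qr at h
  induction h using AddSubgroup.closure_induction with
  | mem y hy => exact AddSubgroup.subset_closure (W0_mem hw hy)
  | zero => rw [W0_zero hw]; exact D.Qr.zero_mem
  | add a b _ _ ha hb => rw [W0_add hw]; exact D.Qr.add_mem ha hb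
  | neg a _ ha => rw [W0_neg hw]; exact D.Qr.neg_mem ha

lemma WR_decomp (c : ℝ) {w : Equiv.Perm V} (hw : w ∈ D.WR c) :
    ∃ w' ∈ D.W0, ∃ η ∈ D.Qr, ∀ x, w x = w' x + c • η := by
  unfold WR at hw
  induction hw using Subgroup.closure_induction with
  | mem e he =>
    obtain ⟨a, ha, h⟩ := he
    have ha' : a.1 ∈ D.R0 := ha
    refine ⟨_, D.rfPerm_mem ha', (-a.2) • a.1,
      D.Qr.zsmul_mem (AddSubgroup.subset_closure ha') _, fun x => ?_⟩
    rw [h, sAff, aval]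
    show _ = rf a.1 x + _
    rw [rf, add_smul, ← Int.cast_smul_eq_zsmul ℝ, smul_smul]
    push_cast
    rw [mul_neg, neg_smul, mul_comm c]; abel
  | one => exact ⟨1, D.W0.one_mem, 0, D.Qr.zero_mem, by simp⟩
  | mul a b _ _ ha hb =>
    obtain ⟨a', ha', η, hη, h⟩ := ha
    obtain ⟨b', hb', η', hη', h'⟩ := hb
    refine ⟨a' * b', D.W0.mul_mem ha' hb', a' η' + η, D.Qr.add_mem (D.Qr_W0 ha' hη') hη, ?_⟩
    intro x
    rw [Equiv.Perm.mul_apply, h, h', W0_add ha', W0_smul ha', Equiv.Perm.mul_apply, smul_add,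
      add_assoc]
  | inv a _ ha =>
    obtain ⟨a', ha', η, hη, h⟩ := ha
    refine ⟨a'⁻¹, W0_inv ha', -(a'⁻¹ η), D.Qr.neg_mem (D.Qr_W0 (W0_inv ha') hη), ?_⟩
    intro x
    apply a.injective
    rw [h (_ + _), W0_add ha', W0_smul ha', W0_neg ha']
    simp

lemma W0_le_WR (c : ℝ) : D.W0 ≤ D.WR c := by
  unfold W0
  rw [Subgroup.closure_le]
  rintro e ⟨α, ha, h⟩
  apply Subgroup.subset_closure
  exact ⟨(α, 0), ha, fun x => by rw [h, sAff, aval]; simp⟩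

lemma trans_WR (c : ℝ) {η : V} (h : η ∈ D.Qr) : ∃ u ∈ D.WR c, ∀ x, u x = x + c • η := by
  unfold Qr at h
  induction h using AddSubgroup.closure_induction with
  | mem y hy =>
    have h1 : ((y, (-1:ℤ)) : V × ℤ).1 ∈ D.R0 := hy
    have h2 : ((y, (0:ℤ)) : V × ℤ).1 ∈ D.R0 := hy
    refine ⟨D.sPerm c h1 * D.sPerm c h2, (D.WR c).mul_mem (D.sPerm_mem c h1) (D.sPerm_mem c h2), ?_⟩
    intro x
    have := inner_coroot_self (D.ne_zero _ hy)
    simp only [Equiv.Perm.mul_apply, sPerm_apply, sAff, aval, inner_sub_left, inner_smul_left, this]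
    simp only [conj_trivial, Int.cast_zero, zero_mul, add_zero, Int.cast_neg, Int.cast_one]
    module
  | zero => exact ⟨1, (D.WR c).one_mem, by simp⟩
  | add a b _ _ ha hb =>
    obtain ⟨u, hu, h⟩ := ha
    obtain ⟨u', hu', h'⟩ := hb
    refine ⟨u * u', (D.WR c).mul_mem hu hu', fun x => ?_⟩
    rw [Equiv.Perm.mul_apply, h, h']; module
  | neg a _ ha =>
    obtain ⟨u, hu, h⟩ := ha
    refine ⟨u⁻¹, (D.WR c).inv_mem hu, fun x => ?_⟩
    apply u.injective
    rw [h (x + _)]; simp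

lemma WR_of (c : ℝ) {w : Equiv.Perm V} (hw : w ∈ D.W0) {η : V} (h : η ∈ D.Qr) :
    ∃ u ∈ D.WR c, ∀ x, u x = w x + c • η := by
  obtain ⟨u, hu, h⟩ := D.trans_WR c h
  exact ⟨u * w, (D.WR c).mul_mem hu (D.W0_le_WR c hw), fun x => by rw [Equiv.Perm.mul_apply, h]⟩

lemma WR_pull (c : ℝ) {w : Equiv.Perm V} (hw : w ∈ D.WR c) {a : V × ℤ} (ha : a.1 ∈ D.R0) :
    ∃ b : V × ℤ, b.1 ∈ D.R0 ∧ ∀ x, aval c a (w x) = aval c b x := by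
  obtain ⟨w', hw', η, hη, h⟩ := D.WR_decomp c hw
  obtain ⟨k, hk⟩ := D.Qr_P hη a.1 ha
  refine ⟨(w'⁻¹ a.1, a.2 + k), W0_mem (W0_inv hw') ha, fun x => ?_⟩
  simp only [aval]
  rw [h, inner_add_left, inner_smul_left, hk, W0_inner' hw', W0_coroot (W0_inv hw')]
  push_cast; simp only [conj_trivial]; ring

lemma WR_P {cz : ℤ} {w : Equiv.Perm V} (hw : w ∈ D.WR cz) {x : V} (hx : x ∈ D.weightLattice) :
    w x ∈ D.weightLattice := by
  obtain ⟨w', hw', η, hη, h⟩ := D.WR_decomp _ hw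
  rw [h]
  exact D.P_add (D.P_W0 hw' hx) (D.P_zsmul cz (D.Qr_P hη))

/-! ### inversion sets -/

/-- Positive affine roots negative at `x`. -/
def NS (c : ℝ) (x : V) : Set (V × ℤ) := {b | D.IsAffPos b ∧ aval c b x < 0}

lemma RW_eq (hc : 0 < c) {w : Equiv.Perm V} (hw : w ∈ D.WR c) :
    D.RW c w = D.NS c (w⁻¹ (D.bp c)) := by
  ext a
  simp only [RW, NS, Set.mem_ofPred_eq]
  refine and_congr_right fun ha => ?_
  constructor
  · rintro ⟨b, hb, h⟩
    rw [h]; exact ((D.affneg_iff hc b).1 hb).2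
  · intro h
    obtain ⟨b, hb, h'⟩ := D.WR_pull c ((D.WR c).inv_mem hw) ha.1
    exact ⟨b, (D.affneg_iff hc b).2 ⟨hb, by rw [← h']; exact h⟩, h'⟩

lemma NS_finite (hc : 0 < c) (x : V) : (D.NS c x).Finite := by
  set M : ℝ := ∑ α ∈ D.R0, |⟪x, coroot α⟫| with hM
  apply ((D.R0 ×ˢ Finset.Icc (0:ℤ) ⌈M / c⌉).finite_toSet).subset
  rintro ⟨β, r⟩ ⟨h1, h2⟩
  have hb : β ∈ D.R0 := h1.1
  have h0 : 0 ≤ r := by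
    rcases h1.2 with h | ⟨h, _⟩ <;> simp at h <;> omega
  have h3 : |⟪x, coroot β⟫| ≤ M := Finset.single_le_sum (f := fun α => |⟪x, coroot α⟫|)
    (fun i _ => abs_nonneg _) hb
  simp only [Finset.coe_product, Set.mem_prod, Finset.mem_coe, Finset.mem_Icc]
  refine ⟨hb, h0, ?_⟩
  simp only [aval] at h2
  have h4 : (r:ℝ) ≤ M / c := by
    rw [le_div_iff₀ hc]
    linarith [neg_abs_le ⟪x, coroot β⟫]
  have : (r:ℝ) ≤ ⌈M / c⌉ := h4.trans (Int.le_ceil _)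
  exact_mod_cast this

lemma NS_empty {x : V} : D.NS c x = ∅ ↔ x ∈ D.alcove c := by
  rw [Set.eq_empty_iff_forall_notMem]
  simp only [NS, alcove, Set.mem_ofPred_eq, not_and, not_lt]

lemma bp_alcove (hc : 0 < c) : D.bp c ∈ D.alcove c := fun a ha => ((D.affpos_iff hc a).1 ha).2.le

lemma aSimple_zero : D.aSimple 0 = (-D.hshort, 1) := rfl
lemma aSimple_succ (i : Fin D.n) : D.aSimple i.succ = (D.simpleRoot i, 0) := by
  simp [aSimple]

lemma aSimple_mem (j) : (D.aSimple j).1 ∈ D.R0 := by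
  refine Fin.cases ?_ (fun i => ?_) j
  · exact D.neg_mem D.hshort_memR
  · rw [aSimple_succ]; exact D.simple_mem i

lemma aSimple_pos (j) : D.IsAffPos (D.aSimple j) := by
  refine ⟨D.aSimple_mem j, ?_⟩
  refine Fin.cases ?_ (fun i => ?_) j
  · left; rw [aSimple_zero]
  · right; rw [aSimple_succ]; exact ⟨rfl, D.simpleRoot_mem i⟩

lemma exists_simple_neg (hc : 0 < c) {x : V} (hx : x ∉ D.alcove c) :
    ∃ j, aval c (D.aSimple j) x < 0 := by
  by_contra! h
  apply hx
  have hd : ∀ i, 0 ≤ ⟪x, D.simpleRoot i⟫ := by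
    intro i
    have := h i.succ
    rw [aSimple_succ, aval] at this
    simp only [Int.cast_zero, zero_mul, add_zero, inner_coroot] at this
    exact (mul_nonneg_iff_of_pos_left (D.simpleCoroot_pos i)).1 this
  have h0 : ⟪x, coroot D.hshort⟫ ≤ c := by
    have := h 0
    rw [aSimple_zero, aval, coroot_neg] at this
    simp only [inner_neg_right, Int.cast_one, one_mul] at this
    linarith
  rintro ⟨β, r⟩ ⟨hb, hr⟩
  rcases hr with hr | ⟨hr, hp⟩
  · have h1 := D.highest_coroot hd (D.neg_mem hb)
    rw [coroot_neg, inner_neg_right] at h1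
    simp only [aval]
    have : (1:ℝ) ≤ r := by exact_mod_cast hr
    nlinarith
  · simp only at hr hp
    simp only [aval, hr, Int.cast_zero, zero_mul, add_zero, inner_coroot]
    have := D.dom_pos hd hp
    have := inner_self_pos' (D.ne_zero _ hb)
    positivity

lemma simple_perm {j} {b : V × ℤ} (hb : D.IsAffPos b) (hne : b ≠ D.aSimple j) :
    D.IsAffPos (ract (D.aSimple j) b) := by
  refine ⟨D.ract_mem (D.aSimple_mem j) hb.1, ?_⟩
  obtain ⟨β, r⟩ := b
  obtain ⟨hR, hr⟩ := hb
  simp only at hR hr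
  revert hne
  refine Fin.cases ?_ (fun i => ?_) j
  · rw [aSimple_zero]
    intro hne
    simp only [ract, rf_neg_left, inner_neg_left, mul_one]
    obtain ⟨k, hk, hor⟩ := D.short_cartan (D.hshort_short β hR) D.hshort_memR hR
    have hk' : ⌊-⟪D.hshort, coroot β⟫⌋ = -k := by rw [hk, ← Int.cast_neg, Int.floor_intCast]
    rw [hk', sub_neg_eq_add]
    have hbp := inner_self_pos' (D.ne_zero β hR)
    rw [inner_coroot] at hk
    have hr0 : 0 ≤ r := by rcases hr with h | h <;> omega
    rcases hor with ⟨h1, h2⟩ | ⟨h1, h2⟩ | ⟨h1, h2⟩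
    · rcases eq_or_ne k 0 with rfl | hk0
      · have : ⟪D.hshort, β⟫ = 0 := by
          simp only [Int.cast_zero, mul_eq_zero, div_eq_zero_iff, OfNat.ofNat_ne_zero, hbp.ne',
            false_or, or_self] at hk; exact hk
        have : rf D.hshort β = β := by rw [rf_eq', real_inner_comm, this]; simp
        rw [this, add_zero]; exact hr
      · rcases lt_or_ge 0 k with hk1 | hk1
        · left; omega
        · have hkk : k = -1 := by omega
          subst hkk
          have hneg : ⟪D.hshort, β⟫ < 0 := by
            by_contra! h'
            have : 0 ≤ 2 / ⟪β, β⟫ * ⟪D.hshort, β⟫ := by positivity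
            rw [hk] at this; norm_num at this
          have hr1 : 1 ≤ r := by
            rcases hr with h | ⟨_, h⟩
            · exact h
            · linarith [D.hshort_inner_nonneg h]
          rcases eq_or_ne r 1 with rfl | h5
          · right
            refine ⟨by norm_num, D.pos_of_hshort (D.rf_mem D.hshort_memR hR) ?_⟩
            rw [← inner_rf_left, rf_self D.hshort_ne, inner_neg_left]; linarith
          · left; omega
    · left; omega
    · subst h2
      have hr1 : 1 ≤ r := by
        rcases hr with h | ⟨_, h⟩
        · exact h
        · exact absurd h (D.pos_not_both _ D.hshort_mem)
      have : r ≠ 1 := by rintro rfl; exact hne rfl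
      rcases eq_or_ne r 2 with rfl | h5
      · right
        refine ⟨by omega, ?_⟩
        rw [rf_neg, rf_self D.hshort_ne, neg_neg]; exact D.hshort_mem
      · left; omega
  · rw [aSimple_succ]
    intro hne
    simp only [ract, mul_zero, sub_zero]
    rcases hr with h | ⟨h, h'⟩
    · exact Or.inl h
    · refine Or.inr ⟨h, D.rf_simple_pos h' ?_⟩
      rintro rfl; exact hne (by rw [h])

lemma not_affpos_neg (hc : 0 < c) {b : V × ℤ} (hb : D.IsAffPos b) : ¬ D.IsAffPos (-b.1, -b.2) := by
  intro h
  have h1 := ((D.affpos_iff hc _).1 h).2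
  have h2 := ((D.affpos_iff hc _).1 hb).2
  rw [aval_neg] at h1; linarith

lemma NS_step (hc : 0 < c) {j} {x : V} (h : aval c (D.aSimple j) x < 0) :
    D.NS c x = insert (D.aSimple j) (ract (D.aSimple j) '' D.NS c (sAff c (D.aSimple j) x)) := by
  have hj := D.aSimple_mem j
  ext b
  simp only [Set.mem_insert_iff, Set.mem_image]
  constructor
  · rintro ⟨h1, h2⟩
    rcases eq_or_ne b (D.aSimple j) with e | e
    · exact Or.inl e
    · right
      refine ⟨ract (D.aSimple j) b, ⟨D.simple_perm h1 e, ?_⟩, D.ract_ract hc hj h1.1⟩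
      rw [D.aval_ract c hj h1.1, D.sAff_sAff c hj]; exact h2
  · rintro (rfl | ⟨b, ⟨h1, h2⟩, rfl⟩)
    · exact ⟨D.aSimple_pos j, h⟩
    · refine ⟨D.simple_perm h1 ?_, ?_⟩
      · rintro rfl
        rw [D.aval_sAff_self c hj] at h2; linarith
      · rw [D.aval_ract c hj h1.1]; exact h2

lemma NS_step_notMem (hc : 0 < c) (j) (x : V) :
    D.aSimple j ∉ (ract (D.aSimple j) '' D.NS c x) := by
  have hj := D.aSimple_mem j
  rintro ⟨b, ⟨h1, h2⟩, h3⟩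
  have : b = (-(D.aSimple j).1, -(D.aSimple j).2) := by
    rw [← D.ract_self hc hj]
    conv_rhs => rw [← h3]
    rw [h3, ← D.ract_ract hc hj h1.1, h3]
  rw [this] at h1
  exact D.not_affpos_neg hc (D.aSimple_pos j) h1

lemma ract_injOn (hc : 0 < c) (j) (x : V) : Set.InjOn (ract (D.aSimple j)) (D.NS c x) := by
  intro a ha b hb h
  have hj := D.aSimple_mem j
  rw [← D.ract_ract hc hj ha.1.1, h, D.ract_ract hc hj hb.1.1]

lemma NS_ncard (hc : 0 < c) {j} {x : V} (h : aval c (D.aSimple j) x < 0) :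
    (D.NS c x).ncard = (D.NS c (sAff c (D.aSimple j) x)).ncard + 1 := by
  rw [D.NS_step hc h, Set.ncard_insert_of_notMem (D.NS_step_notMem hc j _)
    ((D.NS_finite hc _).image _), Set.InjOn.ncard_image (D.ract_injOn hc j _)]

/-- Induction along reduced words. -/
lemma wind (hc : 0 < c) {Q : V → Prop} (h0 : ∀ x ∈ D.alcove c, Q x)
    (h1 : ∀ x j, aval c (D.aSimple j) x < 0 → Q (sAff c (D.aSimple j) x) → Q x) : ∀ x, Q x := by
  have key : ∀ N : ℕ, ∀ x, (D.NS c x).ncard = N → Q x := by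
    intro N
    induction N with
    | zero =>
      intro x hx
      rw [Set.ncard_eq_zero (D.NS_finite hc x)] at hx
      exact h0 x (D.NS_empty.1 hx)
    | succ N ih =>
      intro x hx
      by_cases hA : x ∈ D.alcove c
      · exact h0 x hA
      · obtain ⟨j, hj⟩ := D.exists_simple_neg hc hA
        refine h1 x j hj (ih _ ?_)
        have := D.NS_ncard hc hj
        omega
  exact fun x => key _ x rfl

/-! ### the elements `w_x` -/

section wmin
variable {wmin : V → Equiv.Perm V} (hw : D.IsWmin c wmin)

lemma RW_one (hc : 0 < c) : D.RW c 1 = ∅ := by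
  rw [D.RW_eq hc (D.WR c).one_mem]; exact D.NS_empty.2 (by simpa using D.bp_alcove hc)

lemma eq_one_of_RW (hc : 0 < c) (hw : D.IsWmin c wmin) {u : Equiv.Perm V} (hu : u ∈ D.WR c)
    (h : D.RW c u = ∅) : u = 1 := by
  have hlen : D.len c (1 : Equiv.Perm V) = 0 := by rw [len, D.RW_one hc]; simp
  have hinv : D.RW c u⁻¹ = ∅ := by
    rw [D.RW_eq hc ((D.WR c).inv_mem hu), inv_inv, Set.eq_empty_iff_forall_notMem]
    rintro b ⟨hb, hneg⟩
    obtain ⟨b', hb', he⟩ := D.WR_pull c hu hb.1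
    have h1 : D.IsAffPos (-b'.1, -b'.2) := (D.affneg_iff hc b').2 ⟨hb', by rw [← he]; exact hneg⟩
    have h2 : (-b'.1, -b'.2) ∈ D.RW c u := by
      rw [D.RW_eq hc hu]
      refine ⟨h1, ?_⟩
      rw [aval_neg, ← he]
      have := ((D.affpos_iff hc b).1 hb).2
      simpa using this
    rw [h] at h2; exact h2
  have hA : u⁻¹ (D.bp c) ∈ D.alcove c := by
    rw [← D.NS_empty, ← D.RW_eq hc hu]; exact h
  obtain ⟨h1, h2, h3⟩ := hw (D.bp c)
  have e1 : (1 : Equiv.Perm V) = wmin (D.bp c) := by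
    rcases h3 1 (D.WR c).one_mem (D.bp_alcove hc) with h4 | h4
    · rw [hlen] at h4; omega
    · exact h4
  have e2 : u⁻¹ = wmin (D.bp c) := by
    rcases h3 _ ((D.WR c).inv_mem hu) hA with h4 | h4
    · rw [len, len, hinv] at h4; simp at h4
    · exact h4
  rw [← e1] at e2
  simpa using e2

lemma alcove_unique (hc : 0 < c) (hw : D.IsWmin c wmin) {u : Equiv.Perm V} (hu : u ∈ D.WR c) {x : V}
    (hx : x ∈ D.alcove c) (hy : u x ∈ D.alcove c) : u x = x := by
  have key : ∀ N : ℕ, ∀ u ∈ D.WR c, (D.NS c (u⁻¹ (D.bp c))).ncard = N → u x ∈ D.alcove c →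
      u x = x := by
    intro N
    induction N with
    | zero =>
      intro u hu h0 _
      rw [Set.ncard_eq_zero (D.NS_finite hc _), ← D.RW_eq hc hu] at h0
      rw [D.eq_one_of_RW hc hw hu h0]; rfl
    | succ N ih =>
      intro u hu hN hy
      have hnA : u⁻¹ (D.bp c) ∉ D.alcove c := by
        rw [← D.NS_empty]; intro h; rw [h] at hN; simp at hN
      obtain ⟨j, hj⟩ := D.exists_simple_neg hc hnA
      have haj := D.aSimple_mem j
      obtain ⟨b, hb, he⟩ := D.WR_pull c ((D.WR c).inv_mem hu) haj
      have hbneg : D.IsAffPos (-b.1, -b.2) := (D.affneg_iff hc b).2 ⟨hb, by rw [← he]; exact hj⟩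
      have h1 := hy _ hbneg
      rw [aval_neg, ← he] at h1
      have h2 := hx _ (D.aSimple_pos j)
      rw [show u⁻¹ (u x) = x from u.symm_apply_apply x] at h1
      have h3 : aval c (D.aSimple j) x = 0 := by linarith
      have hsx : sAff c (D.aSimple j) x = x := by rw [sAff, h3]; simp
      have := ih (u * D.sPerm c haj) ((D.WR c).mul_mem hu (D.sPerm_mem c haj)) ?_ ?_
      · rwa [Equiv.Perm.mul_apply, sPerm_apply, hsx] at this
      · rw [mul_inv_rev, sPerm_inv, Equiv.Perm.mul_apply, sPerm_apply]
        have := D.NS_ncard hc hj; omega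
      · rwa [Equiv.Perm.mul_apply, sPerm_apply, hsx]
  exact key _ u hu rfl hy

lemma wmin_unique (hc : 0 < c) (hw : D.IsWmin c wmin) {u : Equiv.Perm V} (hu : u ∈ D.WR c) {x : V}
    (hx : u x ∈ D.alcove c) (h : D.RW c u = D.NS c x) : u = wmin x := by
  obtain ⟨h1, h2, h3⟩ := hw x
  have hsub : D.NS c x ⊆ D.RW c (wmin x) := by
    rintro b ⟨hb, hneg⟩
    rw [D.RW_eq hc h1]
    refine ⟨hb, ?_⟩
    by_contra! hge
    obtain ⟨b', hb', he⟩ := D.WR_pull c ((D.WR c).inv_mem h1) hb.1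
    rw [he] at hge
    have hp : D.IsAffPos b' := (D.affpos_iff hc b').2
      ⟨hb', lt_of_le_of_ne hge (D.aval_bp_ne hc b' hb').symm⟩
    have := h2 b' hp
    rw [← he, show (wmin x)⁻¹ (wmin x x) = x from (wmin x).symm_apply_apply x] at this
    linarith
  have hle : D.len c u ≤ D.len c (wmin x) := by
    rw [len, len, h]
    exact Set.ncard_le_ncard hsub (by rw [D.RW_eq hc h1]; exact D.NS_finite hc _)
  rcases h3 u hu hx with h4 | h4
  · omega
  · exact h4

lemma RW_step (hc : 0 < c) {u : Equiv.Perm V} (hu : u ∈ D.WR c) {x : V} {j}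
    (hj : aval c (D.aSimple j) x < 0)
    (h : D.RW c u = D.NS c (sAff c (D.aSimple j) x)) :
    D.RW c (u * D.sPerm c (D.aSimple_mem j)) = D.NS c x := by
  have haj := D.aSimple_mem j
  rw [D.RW_eq hc ((D.WR c).mul_mem hu (D.sPerm_mem c haj)), D.NS_step hc hj, ← h, D.RW_eq hc hu,
    mul_inv_rev, sPerm_inv, Equiv.Perm.mul_apply, sPerm_apply]
  rw [D.NS_step hc (j := j), D.sAff_sAff c haj]
  rw [D.aval_sAff_self c haj, neg_lt_zero]
  obtain ⟨b, hb, he⟩ := D.WR_pull c ((D.WR c).inv_mem hu) haj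
  have hnot : D.aSimple j ∉ D.RW c u := by
    rw [h]; rintro ⟨_, h2⟩
    rw [D.aval_sAff_self c haj] at h2; linarith
  rw [D.RW_eq hc hu] at hnot
  have hge : 0 ≤ aval c (D.aSimple j) (u⁻¹ (D.bp c)) := by
    by_contra! hlt; exact hnot ⟨D.aSimple_pos j, hlt⟩
  rw [he] at hge ⊢
  exact lt_of_le_of_ne hge (D.aval_bp_ne hc b hb).symm

lemma RW_wmin (hc : 0 < c) (hw : D.IsWmin c wmin) : ∀ x : V, D.RW c (wmin x) = D.NS c x := by
  have : ∀ x : V, ∃ u ∈ D.WR c, u x ∈ D.alcove c ∧ D.RW c u = D.NS c x := by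
    apply D.wind hc (Q := fun x => ∃ u ∈ D.WR c, u x ∈ D.alcove c ∧ D.RW c u = D.NS c x)
    · intro x hx
      exact ⟨1, (D.WR c).one_mem, hx, by rw [D.RW_one hc, D.NS_empty.2 hx]⟩
    · rintro x j hj ⟨u, hu, h1, h2⟩
      refine ⟨u * D.sPerm c (D.aSimple_mem j), (D.WR c).mul_mem hu (D.sPerm_mem c _), h1,
        D.RW_step hc hu hj h2⟩
  intro x
  obtain ⟨u, hu, h1, h2⟩ := this x
  rw [← D.wmin_unique hc hw hu h1 h2, h2]

lemma wmin_alcove (hc : 0 < c) (hw : D.IsWmin c wmin) {x : V} (hx : x ∈ D.alcove c) : wmin x = 1 :=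
  (D.wmin_unique hc hw (D.WR c).one_mem hx (by rw [D.RW_one hc, D.NS_empty.2 hx])).symm

lemma wmin_step (hc : 0 < c) (hw : D.IsWmin c wmin) {x : V} {j}
    (hj : aval c (D.aSimple j) x < 0) :
    wmin x = wmin (sAff c (D.aSimple j) x) * D.sPerm c (D.aSimple_mem j) := by
  symm
  exact D.wmin_unique hc hw ((D.WR c).mul_mem (hw _).1 (D.sPerm_mem c _)) (hw _).2.1
    (D.RW_step hc (hw _).1 hj (D.RW_wmin hc hw _))

end wmin

/-! ### multiplicities -/

section mult
variable {τ : V × ℤ → ℝ}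

/-- `hτinv` as a predicate. -/
def TauInv (D : RootSystemData V) (c : ℝ) (τ : V × ℤ → ℝ) : Prop :=
  ∀ w ∈ D.Wext c, ∀ a b : V × ℤ, D.IsAffRoot a → D.IsAffRoot b → mapsRoot c w a b → τ a = τ b

lemma WR_le (c : ℝ) : D.WR c ≤ D.Wext c := Subgroup.closure_mono Set.subset_union_left

lemma tau_ract (h : D.TauInv c τ) {a b : V × ℤ} (ha : a.1 ∈ D.R0) (hb : b.1 ∈ D.R0) :
    τ (ract a b) = τ b := by
  symm
  apply h _ (D.WR_le c (D.sPerm_mem c ha)) b (ract a b) hb (D.ract_mem ha hb)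
  intro x
  rw [sPerm_inv, sPerm_apply, D.aval_ract c ha hb]

lemma tau_W0 (h : D.TauInv c τ) {w : Equiv.Perm V} (hw : w ∈ D.W0) {β : V} (hb : β ∈ D.R0) (r : ℤ) :
    τ (w β, r) = τ (β, r) := by
  symm
  apply h _ (D.WR_le c (D.W0_le_WR c hw)) (β, r) (w β, r) hb (W0_mem hw hb)
  intro x
  simp only [aval]
  rw [W0_inner' (W0_inv hw), inv_inv, W0_coroot hw]

lemma exists_coweight_one {β : V} (hb : β ∈ D.R0) : ∃ lam ∈ D.weightLattice, ⟪lam, coroot β⟫ = 1 := by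
  have key : ∀ β ∈ D.pos, ∃ lam ∈ D.weightLattice, ⟪lam, coroot β⟫ = 1 := by
    apply D.ht_induct (P := fun β => ∃ lam ∈ D.weightLattice, ⟪lam, coroot β⟫ = 1)
    · intro j; exact ⟨D.fw j, D.fw_mem j, by rw [fw_spec]; simp⟩
    · rintro β _ j ⟨lam, h1, h2⟩
      refine ⟨rf (D.simpleRoot j) lam, D.P_W0 (D.rfPerm_mem (D.simple_mem j)) h1, ?_⟩
      rw [coroot_rf (D.simple_ne j), inner_rf_rf (D.simple_ne j), h2]
  rcases D.pos_or_neg β hb with h | h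
  · exact key β h
  · obtain ⟨lam, h1, h2⟩ := key _ h
    refine ⟨-lam, by simpa using D.P_zsmul (-1) h1, ?_⟩
    rw [coroot_neg, inner_neg_right] at h2
    rw [inner_neg_left, h2]

lemma tau_shift (h : D.TauInv c τ) {β : V} (hb : β ∈ D.R0) (r : ℤ) : τ (β, r) = τ (β, 0) := by
  obtain ⟨lam, h1, h2⟩ := D.exists_coweight_one hb
  have hP := D.P_zsmul r h1
  have hmem : Equiv.addRight (c • ((r:ℝ) • lam)) ∈ D.Wext c :=
    Subgroup.subset_closure (Or.inr ⟨_, hP, fun x => rfl⟩)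
  apply h _ hmem (β, r) (β, 0) hb hb
  intro x
  have : (Equiv.addRight (c • ((r:ℝ) • lam)))⁻¹ x = x - c • ((r:ℝ) • lam) := by
    show (Equiv.addRight (c • ((r:ℝ) • lam))).symm x = _
    simp [sub_eq_add_neg]
  rw [this]
  simp only [aval, inner_sub_left, inner_smul_left, h2]
  simp; ring

lemma tau_neg (h : D.TauInv c τ) {β : V} (hb : β ∈ D.R0) (r : ℤ) : τ (-β, r) = τ (β, 0) := by
  have := D.tau_W0 h (D.rfPerm_mem hb) hb r
  rw [← D.tau_shift h hb r, ← this]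
  show _ = τ (rf β β, r)
  rw [rf_self (D.ne_zero β hb)]

/-- `τ_{w_x}`. -/
def TT (c : ℝ) (τ : V × ℤ → ℝ) (x : V) : ℝ := ∏ᶠ a ∈ D.NS c x, τ a

lemma tauw_wmin (hc : 0 < c) {wmin : V → Equiv.Perm V} (hw : D.IsWmin c wmin) (x : V) :
    D.tauw c τ (wmin x) = D.TT c τ x := by
  rw [tauw, D.RW_wmin hc hw, TT]

lemma TT_alcove {x : V} (hx : x ∈ D.alcove c) : D.TT c τ x = 1 := by
  rw [TT, D.NS_empty.2 hx]; simp

lemma TT_step (hc : 0 < c) (h : D.TauInv c τ) {x : V} {j} (hj : aval c (D.aSimple j) x < 0) :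
    D.TT c τ x = τ (D.aSimple j) * D.TT c τ (sAff c (D.aSimple j) x) := by
  rw [TT, D.NS_step hc hj, finprod_mem_insert _ (D.NS_step_notMem hc j _)
    ((D.NS_finite hc _).image _), finprod_mem_image (D.ract_injOn hc j _), TT]
  congr 1
  apply finprod_mem_congr rfl
  intro b hb
  exact D.tau_ract h (D.aSimple_mem j) hb.1.1

end mult

end RootSystemData

section mv
variable {t : ℝ}

lemma mv_den_pos (h0 : 0 < t) (h1 : t < 1) (x : ℝ) : 0 < 1 - 2 * t * Real.cos x + t ^ 2 := by
  nlinarith [Real.cos_le_one x]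

lemma mv_d_pos (h0 : 0 < t) (h1 : t < 1) (x : ℝ) : 0 < 1 - t * Real.cos x := by
  nlinarith [Real.cos_le_one x]

lemma mv_aux (h0 : 0 < t) (h1 : t < 1) (x : ℝ) :
    HasDerivAt (fun x => x + 2 * Real.arctan (t * Real.sin x / (1 - t * Real.cos x)))
      ((1 - t ^ 2) * (1 / (1 - 2 * t * Real.cos x + t ^ 2))) x := by
  have hd := mv_d_pos h0 h1 x
  have hn := mv_den_pos h0 h1 x
  have hs := (Real.hasDerivAt_sin x).const_mul t
  have hcos := ((Real.hasDerivAt_cos x).const_mul t).const_sub 1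
  have hq := hs.div hcos hd.ne'
  have ha := ((hq.arctan).const_mul 2)
  have := (hasDerivAt_id x).add ha
  refine this.congr_deriv ?_
  symm
  show _ = 1 + 2 * (1 / (1 + (t * Real.sin x / (1 - t * Real.cos x)) ^ 2) * _)
  have hsq : Real.sin x ^ 2 = 1 - Real.cos x ^ 2 := by
    linarith [Real.sin_sq_add_cos_sq x]
  have h3 : 1 + (t * Real.sin x / (1 - t * Real.cos x)) ^ 2 =
      (1 - 2 * t * Real.cos x + t ^ 2) / (1 - t * Real.cos x) ^ 2 := by
    rw [div_pow, mul_pow, hsq]; field_simp; ring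
  rw [h3]
  obtain ⟨N, hN⟩ : ∃ N, N = 1 - 2 * t * Real.cos x + t ^ 2 := ⟨_, rfl⟩
  rw [← hN] at hn ⊢
  have hn' := hn.ne'
  have hd' := hd.ne'
  field_simp
  rw [hN]
  linear_combination (2 * t ^ 2) * hsq

lemma mvfun_eq (h0 : 0 < t) (h1 : t < 1) (x : ℝ) :
    mvfun t x = x + 2 * Real.arctan (t * Real.sin x / (1 - t * Real.cos x)) := by
  unfold mvfun
  rw [← intervalIntegral.integral_const_mul]
  rw [intervalIntegral.integral_eq_sub_of_hasDerivAt (fun y _ => mv_aux h0 h1 y)]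
  · simp
  · apply Continuous.intervalIntegrable
    apply Continuous.mul continuous_const
    apply Continuous.div continuous_const (by fun_prop)
    intro y; exact (mv_den_pos h0 h1 y).ne'

lemma mvfun_deriv (h0 : 0 < t) (h1 : t < 1) (x : ℝ) :
    HasDerivAt (mvfun t) ((1 - t ^ 2) * (1 / (1 - 2 * t * Real.cos x + t ^ 2))) x := by
  rw [funext (mvfun_eq h0 h1)]; exact mv_aux h0 h1 x

lemma mvfun_cont (h0 : 0 < t) (h1 : t < 1) : Continuous (mvfun t) :=
  continuous_iff_continuousAt.2 fun x => (mvfun_deriv h0 h1 x).continuousAt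

lemma mvfun_mono (h0 : 0 < t) (h1 : t < 1) : Monotone (mvfun t) := by
  apply monotone_of_hasDerivAt_nonneg (fun x => mvfun_deriv h0 h1 x)
  intro x
  have := mv_den_pos h0 h1 x
  have : 0 < 1 - t ^ 2 := by nlinarith
  positivity

lemma mvfun_neg (h0 : 0 < t) (h1 : t < 1) (x : ℝ) : mvfun t (-x) = - mvfun t x := by
  rw [mvfun_eq h0 h1, mvfun_eq h0 h1, Real.sin_neg, Real.cos_neg, mul_neg, neg_div, Real.arctan_neg]
  ring

lemma mvfun_shift (h0 : 0 < t) (h1 : t < 1) (x : ℝ) (k : ℤ) :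
    mvfun t (x + 2 * Real.pi * k) = mvfun t x + 2 * Real.pi * k := by
  rw [mvfun_eq h0 h1, mvfun_eq h0 h1, mul_comm (2 * Real.pi) (k : ℝ), Real.sin_add_int_mul_two_pi,
    Real.cos_add_int_mul_two_pi]
  ring

lemma exp_arctan (g : ℝ) :
    Complex.exp (Complex.I * ((2 * Real.arctan g : ℝ) : ℂ)) * (1 - Complex.I * g) = 1 + Complex.I * g := by
  have h1 : Complex.exp (Complex.I * ((2 * Real.arctan g : ℝ) : ℂ)) =
      ((Real.cos (Real.arctan g) : ℂ) + (Real.sin (Real.arctan g) : ℂ) * Complex.I) ^ 2 := by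
    rw [Complex.ofReal_cos, Complex.ofReal_sin, ← Complex.exp_mul_I, ← Complex.exp_nat_mul]
    congr 1; push_cast; ring
  rw [h1, Real.cos_arctan, Real.sin_arctan]
  have hp : 0 < 1 + g ^ 2 := by positivity
  have hs : (√(1 + g ^ 2) : ℂ) ^ 2 = 1 + (g:ℂ) ^ 2 := by
    rw [← Complex.ofReal_pow, Real.sq_sqrt hp.le]; push_cast; ring
  have hs0 : (√(1 + g ^ 2) : ℂ) ≠ 0 := by
    rw [Complex.ofReal_ne_zero]; exact (Real.sqrt_pos.2 hp).ne'
  have e : ((1 / √(1 + g ^ 2) : ℝ) : ℂ) + ((g / √(1 + g ^ 2) : ℝ) : ℂ) * Complex.I =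
      (1 + Complex.I * g) / (√(1 + g ^ 2) : ℂ) := by
    push_cast; ring
  rw [e, div_pow, hs, div_mul_eq_mul_div, div_eq_iff]
  · have : Complex.I ^ 2 = -1 := Complex.I_sq
    linear_combination (-(1 + Complex.I * g) * g ^ 2) * this
  · rw [← hs]; exact pow_ne_zero 2 hs0

lemma mvfun_exp (h0 : 0 < t) (h1 : t < 1) (x : ℝ) :
    Complex.exp (Complex.I * (mvfun t x : ℂ)) * (1 - t * Complex.exp (Complex.I * x)) =
      Complex.exp (Complex.I * x) * (1 - t * Complex.exp (-(Complex.I * x))) := by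
  have hd : ((1 - t * Real.cos x : ℝ) : ℂ) ≠ 0 := Complex.ofReal_ne_zero.2 (mv_d_pos h0 h1 x).ne'
  have h := exp_arctan (t * Real.sin x / (1 - t * Real.cos x))
  rw [mvfun_eq h0 h1, Complex.ofReal_add, mul_add, Complex.exp_add, mul_assoc]
  congr 1
  set E := Complex.exp (Complex.I * ((2 * Real.arctan (t * Real.sin x / (1 - t * Real.cos x)) : ℝ) : ℂ))
  have e1 : Complex.exp (Complex.I * x) = Real.cos x + Real.sin x * Complex.I := by
    rw [mul_comm, Complex.exp_mul_I]; simp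
  have e2 : Complex.exp (-(Complex.I * x)) = Real.cos x - Real.sin x * Complex.I := by
    rw [show -(Complex.I * x) = ((-x : ℝ) : ℂ) * Complex.I by push_cast; ring, Complex.exp_mul_I]
    rw [← Complex.ofReal_cos, ← Complex.ofReal_sin, Real.cos_neg, Real.sin_neg]; push_cast; ring
  rw [e1, e2]
  push_cast at h hd ⊢
  have h3 : E * (1 - Complex.I * (t * Complex.sin x / (1 - t * Complex.cos x))) * (1 - t * Complex.cos x)
    = (1 + Complex.I * (t * Complex.sin x / (1 - t * Complex.cos x))) * (1 - t * Complex.cos x) := by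
    rw [h]
  have h4 : (t * Complex.sin x / (1 - t * Complex.cos x)) * (1 - t * Complex.cos x) = t * Complex.sin x :=
    div_mul_cancel₀ _ hd
  linear_combination h3 + (E * Complex.I + Complex.I) * h4

end mv

namespace RootSystemData

variable {V : Type*} [NormedAddCommGroup V] [InnerProductSpace ℝ V]
variable (D : RootSystemData V)

/-! ### rho -/

lemma sum_pos_simple {M : Type*} [AddCommMonoid M] (f : V → M) (j) :
    ∑ α ∈ D.pos, f (rf (D.simpleRoot j) α) + f (D.simpleRoot j)
      = ∑ α ∈ D.pos, f α + f (-D.simpleRoot j) := by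
  rw [← Finset.add_sum_erase _ _ (D.simpleRoot_mem j), ← Finset.add_sum_erase _ f (D.simpleRoot_mem j),
    rf_self (D.simple_ne j)]
  have : ∑ α ∈ D.pos.erase (D.simpleRoot j), f (rf (D.simpleRoot j) α) =
      ∑ α ∈ D.pos.erase (D.simpleRoot j), f α := by
    have hm : ∀ α ∈ D.pos.erase (D.simpleRoot j), rf (D.simpleRoot j) α ∈ D.pos.erase (D.simpleRoot j) := by
      intro α ha
      rw [Finset.mem_erase] at ha ⊢
      refine ⟨?_, D.rf_simple_pos ha.2 ha.1⟩
      intro e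
      have h2 : α = -D.simpleRoot j := by
        rw [← rf_rf (D.simple_ne j) α, e, rf_self (D.simple_ne j)]
      exact D.pos_not_both _ (D.simpleRoot_mem j) (h2 ▸ ha.2)
    exact Finset.sum_nbij' (rf (D.simpleRoot j)) (rf (D.simpleRoot j)) hm hm
      (fun α _ => rf_rf (D.simple_ne j) α) (fun α _ => rf_rf (D.simple_ne j) α) (fun _ _ => rfl)
  rw [this]
  abel

lemma rhoVee_simple (j) : ⟪D.rhoVee, D.simpleRoot j⟫ = 1 := by
  set S := ∑ α ∈ D.pos, coroot α with hS
  have h := D.sum_pos_simple coroot j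
  have h2 : ∑ α ∈ D.pos, coroot (rf (D.simpleRoot j) α) = rf (D.simpleRoot j) S := by
    rw [hS, rf_sum]; exact Finset.sum_congr rfl fun α _ => coroot_rf (D.simple_ne j) α
  rw [h2, rf_eq', coroot_neg, ← hS] at h
  have h3 : (2 - ⟪S, D.simpleRoot j⟫) • coroot (D.simpleRoot j) = 0 := by
    rw [sub_smul, two_smul, sub_eq_zero]
    have : S - ⟪S, D.simpleRoot j⟫ • coroot (D.simpleRoot j) + coroot (D.simpleRoot j)
      + coroot (D.simpleRoot j) = S := by rw [h]; abel
    have h5 : S - ⟪S, D.simpleRoot j⟫ • coroot (D.simpleRoot j) + (coroot (D.simpleRoot j)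
      + coroot (D.simpleRoot j)) = S := by rw [← add_assoc]; exact this
    have h6 := sub_add_eq_add_sub S (⟪S, D.simpleRoot j⟫ • coroot (D.simpleRoot j)) (coroot (D.simpleRoot j)
      + coroot (D.simpleRoot j))
    rw [h5] at h6
    have h7 := eq_sub_iff_add_eq.1 h6
    exact (add_left_cancel h7).symm
  have h4 : ⟪S, D.simpleRoot j⟫ = 2 := by
    rcases smul_eq_zero.1 h3 with h | h
    · linarith
    · exact absurd h (coroot_ne_zero (D.simple_ne j))
  rw [rhoVee, inner_smul_left, ← hS, h4]; norm_num

lemma rhoVee_mem : D.rhoVee ∈ D.coweightLattice :=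
  D.Pv_of_simple fun j => ⟨1, by rw [rhoVee_simple]; simp⟩

lemma rhoVee_pos {β : V} (hb : β ∈ D.pos) : 0 < ⟪D.rhoVee, β⟫ :=
  D.sdom_pos (fun j => by rw [rhoVee_simple]; norm_num) hb

/-! ### the gradient map -/

variable (c : ℝ) (t : V → ℝ)

/-- Admissible parameters. -/
structure TOk : Prop where
  lo : ∀ α ∈ D.R0, 0 < t α
  hi : ∀ α ∈ D.R0, t α < 1
  inv : ∀ w ∈ D.W0, ∀ α ∈ D.R0, t (w α) = t α

/-- The gradient of the quadratic-plus-pair-potential part of the Morse function. -/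
def Gmap (ξ : V) : V := c • ξ + ∑ α ∈ D.pos, mvfun (t α) ⟪ξ, α⟫ • coroot α

lemma sum_R0_even {M : Type*} [AddCommMonoid M] (f : V → M) (hf : ∀ α ∈ D.pos, f (-α) = f α) :
    ∑ α ∈ D.R0, f α = ∑ α ∈ D.pos, f α + ∑ α ∈ D.pos, f α := by
  have h1 : D.R0 = D.pos ∪ D.pos.image (fun x => -x) := by
    ext α
    simp only [Finset.mem_union, Finset.mem_image]
    constructor
    · intro h
      rcases D.pos_or_neg α h with h | h
      · exact Or.inl h
      · exact Or.inr ⟨_, h, by simp⟩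
    · rintro (h | ⟨β, h, rfl⟩)
      · exact D.pos_mem h
      · exact D.neg_mem (D.pos_mem h)
  have h2 : Disjoint D.pos (D.pos.image (fun x => -x)) := by
    rw [Finset.disjoint_left]
    intro α h h'
    obtain ⟨β, hb, rfl⟩ := Finset.mem_image.1 h'
    exact D.pos_not_both _ hb h
  rw [h1, Finset.sum_union h2, Finset.sum_image (fun a _ b _ h => neg_injective h)]
  congr 1
  exact Finset.sum_congr rfl hf

lemma sum_R0_W0 {M : Type*} [AddCommMonoid M] (f : V → M) {w : Equiv.Perm V} (hw : w ∈ D.W0) :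
    ∑ α ∈ D.R0, f (w α) = ∑ α ∈ D.R0, f α :=
  Finset.sum_nbij' (fun x => w x) (fun x => (w⁻¹ : Equiv.Perm V) x) (fun α h => W0_mem hw h) (fun α h => W0_mem (W0_inv hw) h)
    (fun α _ => by simp) (fun α _ => by simp) (fun _ _ => rfl)

variable {t} {D}

lemma TOk.neg (ht : D.TOk t) {α : V} (ha : α ∈ D.R0) : t (-α) = t α := by
  have := ht.inv _ (D.rfPerm_mem ha) α ha
  rw [← this]
  show _ = t (rf α α)
  rw [rf_self (D.ne_zero α ha)]

lemma two_Gmap (ht : D.TOk t) (ξ : V) :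
    (2:ℝ) • D.Gmap c t ξ = (2 * c) • ξ + ∑ α ∈ D.R0, mvfun (t α) ⟪ξ, α⟫ • coroot α := by
  rw [D.sum_R0_even, Gmap]
  · rw [smul_add, two_smul _ (∑ α ∈ D.pos, _), smul_smul]
  · intro α ha
    have hR := D.pos_mem ha
    rw [ht.neg hR, inner_neg_right, mvfun_neg (ht.lo _ hR) (ht.hi _ hR), coroot_neg, smul_neg,
      neg_smul, neg_neg]

lemma W0_sum {w : Equiv.Perm V} (hw : w ∈ D.W0) {ι : Type*} (s : Finset ι) (f : ι → V) :
    w (∑ i ∈ s, f i) = ∑ i ∈ s, w (f i) := by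
  induction s using Finset.induction_on with
  | empty => simp [W0_zero hw]
  | insert a s ha ih => rw [Finset.sum_insert ha, Finset.sum_insert ha, W0_add hw, ih]

lemma Gmap_W0 (ht : D.TOk t) {w : Equiv.Perm V} (hw : w ∈ D.W0) (ξ : V) :
    D.Gmap c t (w ξ) = w (D.Gmap c t ξ) := by
  have h : (2:ℝ) • D.Gmap c t (w ξ) = (2:ℝ) • w (D.Gmap c t ξ) := by
    rw [← W0_smul hw, two_Gmap c ht, two_Gmap c ht, W0_add hw, W0_smul hw, W0_sum hw,
      ← D.sum_R0_W0 _ hw]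
    congr 1
    apply Finset.sum_congr rfl
    intro α ha
    rw [ht.inv w hw α ha, W0_inner hw, W0_smul hw, W0_coroot hw]
  exact smul_right_injective V (two_ne_zero (α := ℝ)) h

lemma Gmap_mono (ht : D.TOk t) (ξ ξ' : V) :
    c * ⟪ξ - ξ', ξ - ξ'⟫ ≤ ⟪D.Gmap c t ξ - D.Gmap c t ξ', ξ - ξ'⟫ := by
  have e : D.Gmap c t ξ - D.Gmap c t ξ' = c • (ξ - ξ') +
      ∑ α ∈ D.pos, (mvfun (t α) ⟪ξ, α⟫ - mvfun (t α) ⟪ξ', α⟫) • coroot α := by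
    simp only [Gmap, sub_smul, Finset.sum_sub_distrib, smul_sub]; abel
  rw [e, inner_add_left, inner_smul_left, sum_inner]
  simp only [conj_trivial, le_add_iff_nonneg_right]
  apply Finset.sum_nonneg
  intro α ha
  have hR := D.pos_mem ha
  have hm := mvfun_mono (ht.lo _ hR) (ht.hi _ hR)
  have hp := inner_self_pos' (D.ne_zero α hR)
  rw [inner_smul_left, coroot_inner, inner_sub_right, real_inner_comm ξ α, real_inner_comm ξ' α]
  simp only [conj_trivial]
  have : 0 ≤ (mvfun (t α) ⟪ξ, α⟫ - mvfun (t α) ⟪ξ', α⟫) * (⟪ξ, α⟫ - ⟪ξ', α⟫) := by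
    rcases le_total ⟪ξ, α⟫ ⟪ξ', α⟫ with h | h
    · have := hm h; nlinarith
    · have := hm h; nlinarith
  have h2 : 0 ≤ 2 / ⟪α, α⟫ := by positivity
  nlinarith [mul_nonneg h2 this]

variable {c}

lemma critical (ht : D.TOk t) {μ ξ : V}
    (h : ∀ ζ, D.morse c t μ ξ ≤ D.morse c t μ ζ) :
    D.Gmap c t ξ = (2 * Real.pi) • (D.rhoVee + μ) := by
  rw [← sub_eq_zero]
  set X := D.Gmap c t ξ - (2 * Real.pi) • (D.rhoVee + μ) with hX
  have hd : HasDerivAt (fun s : ℝ => D.morse c t μ (ξ + s • X)) ⟪X, X⟫ 0 := by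
    have h1 : HasDerivAt (fun s : ℝ => ξ + s • X) X 0 := by
      simpa using ((hasDerivAt_id (0:ℝ)).smul_const X).const_add ξ
    have h2 : ∀ y : V, HasDerivAt (fun s : ℝ => ⟪ξ + s • X, y⟫) ⟪X, y⟫ 0 := by
      intro y
      have := h1.inner ℝ (hasDerivAt_const (0:ℝ) y)
      simpa using this
    have h3 : HasDerivAt (fun s : ℝ => ⟪ξ + s • X, ξ + s • X⟫) (2 * ⟪ξ, X⟫) 0 := by
      have := h1.inner ℝ h1
      refine this.congr_deriv ?_
      rw [zero_smul, add_zero, real_inner_comm ξ X]; ring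
    have h2' : HasDerivAt (fun s : ℝ => ⟪D.rhoVee + μ, ξ + s • X⟫) ⟪D.rhoVee + μ, X⟫ 0 := by
      have := (hasDerivAt_const (0:ℝ) (D.rhoVee + μ)).inner ℝ h1
      simpa using this
    have h4 : ∀ α ∈ D.pos, HasDerivAt (fun s : ℝ => (2 / ⟪α, α⟫) *
        ∫ x in (0:ℝ)..(⟪ξ + s • X, α⟫), mvfun (t α) x)
        ((2 / ⟪α, α⟫) * (mvfun (t α) ⟪ξ, α⟫ * ⟪X, α⟫)) 0 := by
      intro α ha
      have hR := D.pos_mem ha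
      have hcont := mvfun_cont (ht.lo _ hR) (ht.hi _ hR)
      have hi := hcont.integral_hasStrictDerivAt 0 ⟪ξ + (0:ℝ) • X, α⟫
      have := (hi.hasDerivAt.comp (0:ℝ) (h2 α)).const_mul (2 / ⟪α, α⟫)
      simpa using this
    have := ((h3.const_mul (c / 2)).sub (h2'.const_mul (2 * Real.pi))).add (HasDerivAt.fun_sum h4)
    unfold morse
    refine this.congr_deriv ?_
    symm
    have hXX : ⟪X, X⟫ = ⟪D.Gmap c t ξ - (2 * Real.pi) • (D.rhoVee + μ), X⟫ := rfl
    rw [hXX, inner_sub_left, Gmap, inner_add_left, inner_smul_left, inner_smul_left, sum_inner]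
    simp only [conj_trivial, inner_smul_left, coroot_inner]
    rw [sub_add_eq_add_sub]
    congr 1
    congr 1
    · ring
    · apply Finset.sum_congr rfl; intro α _; rw [real_inner_comm X α]; ring
  have hmin : IsLocalMin (fun s : ℝ => D.morse c t μ (ξ + s • X)) 0 := by
    apply Filter.Eventually.of_forall
    intro s
    simpa using h (ξ + s • X)
  have := hmin.hasDerivAt_eq_zero hd
  exact inner_self_eq_zero.1 this

lemma xi_lower (hc : 0 < c) (ht : D.TOk t) {μ ξ : V} (hμ : μ ∈ PcVee D c)
    (h : D.Gmap c t ξ = (2 * Real.pi) • (D.rhoVee + μ)) {β : V} (hb : β ∈ D.pos) : 0 < ⟪ξ, β⟫ := by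
  have hR := D.pos_mem hb
  have hG : 0 < ⟪D.Gmap c t ξ, β⟫ := by
    rw [h, inner_smul_left, inner_add_left]
    have := D.rhoVee_pos hb
    have := (hμ.2 β hb).1
    have := Real.pi_pos
    simp only [conj_trivial]; positivity
  have hne : ⟪ξ, β⟫ ≠ 0 := by
    intro h0
    have hs : rf β ξ = ξ := by rw [rf_eq', h0]; simp
    have := Gmap_W0 c ht (D.rfPerm_mem hR) ξ
    change D.Gmap c t (rf β ξ) = rf β _ at this
    rw [hs, rf_eq'] at this
    have h3 : ⟪D.Gmap c t ξ, β⟫ • coroot β = 0 := by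
      have := sub_eq_self.1 this.symm; exact this
    rcases smul_eq_zero.1 h3 with h | h
    · linarith
    · exact coroot_ne_zero (D.ne_zero _ hR) h
  have hm := Gmap_mono c ht ξ (rf β ξ)
  have := Gmap_W0 c ht (D.rfPerm_mem hR) ξ
  change D.Gmap c t (rf β ξ) = rf β _ at this
  rw [this] at hm
  have e1 : D.Gmap c t ξ - rf β (D.Gmap c t ξ) = ⟪D.Gmap c t ξ, β⟫ • coroot β := by rw [rf_eq']; abel
  have e2 : ξ - rf β ξ = ⟪ξ, β⟫ • coroot β := by rw [rf_eq']; abel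
  rw [e1, e2] at hm
  simp only [inner_smul_left, inner_smul_right, conj_trivial] at hm
  have hK := inner_self_pos' (coroot_ne_zero (D.ne_zero _ hR))
  by_contra! hle
  have hlt : ⟪ξ, β⟫ < 0 := lt_of_le_of_ne hle hne
  have h5 : 0 < c * (⟪ξ, β⟫ * (⟪ξ, β⟫ * ⟪coroot β, coroot β⟫)) := by
    have := mul_pos_of_neg_of_neg hlt hlt
    nlinarith [mul_pos hc (mul_pos this hK)]
  have h6 : ⟪ξ, β⟫ * (⟪D.Gmap c t ξ, β⟫ * ⟪coroot β, coroot β⟫) < 0 :=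
    mul_neg_of_neg_of_pos hlt (mul_pos hG hK)
  nlinarith

lemma rho_bound {β : V} (hb : β ∈ D.pos) :
    2 * ⟪D.rhoVee, β⟫ < ∑ α ∈ D.pos, ⟪α, coroot β⟫ * ⟪β, coroot α⟫ := by
  have e : 2 * ⟪D.rhoVee, β⟫ = ∑ α ∈ D.pos, ⟪β, coroot α⟫ := by
    rw [rhoVee, inner_smul_left, sum_inner]
    simp only [real_inner_comm β]
    simp
  rw [e]
  have hR := D.pos_mem hb
  apply Finset.sum_lt_sum
  · intro α ha
    have hRa := D.pos_mem ha
    obtain ⟨k, hk⟩ := D.cart hR hRa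
    obtain ⟨l, hl⟩ := D.cart hRa hR
    have p1 := inner_self_pos' (D.ne_zero _ hR)
    have p2 := inner_self_pos' (D.ne_zero _ hRa)
    rw [hk, hl]
    rw [inner_coroot] at hk hl
    rw [real_inner_comm α β] at hl
    rcases lt_trichotomy ⟪α, β⟫ 0 with h | h | h
    · have h1 : (k:ℝ) < 0 := by rw [← hk]; exact mul_neg_of_pos_of_neg (by positivity) h
      have h2 : (l:ℝ) < 0 := by rw [← hl]; exact mul_neg_of_pos_of_neg (by positivity) h
      nlinarith
    · have h1 : (k:ℝ) = 0 := by rw [← hk, h, mul_zero]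
      have h2 : (l:ℝ) = 0 := by rw [← hl, h, mul_zero]
      rw [h1, h2]; simp
    · have h1 : (0:ℝ) < k := by rw [← hk]; positivity
      have h2 : (0:ℝ) < l := by rw [← hl]; positivity
      have h3 : (1:ℝ) ≤ k := by
        have : 0 < k := by exact_mod_cast h1
        exact_mod_cast this
      nlinarith
  · exact ⟨β, hb, by rw [inner_coroot_self (D.ne_zero _ hR)]; norm_num⟩

lemma Gmap_shift (ht : D.TOk t) (ξ η : V) (hη : η ∈ D.coweightLattice) :
    D.Gmap c t (ξ + (2 * Real.pi) • η) =
      D.Gmap c t ξ + (2 * Real.pi) • (c • η + ∑ α ∈ D.pos, ⟪η, α⟫ • coroot α) := by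
  unfold Gmap
  have : ∀ α ∈ D.pos, mvfun (t α) ⟪ξ + (2 * Real.pi) • η, α⟫ • coroot α =
      mvfun (t α) ⟪ξ, α⟫ • coroot α + (2 * Real.pi) • (⟪η, α⟫ • coroot α) := by
    intro α ha
    have hR := D.pos_mem ha
    obtain ⟨k, hk⟩ := hη α hR
    rw [inner_add_left, inner_smul_left, hk]
    simp only [conj_trivial]
    rw [mvfun_shift (ht.lo _ hR) (ht.hi _ hR), add_smul, smul_smul]
  rw [Finset.sum_congr rfl this, Finset.sum_add_distrib, ← Finset.smul_sum]
  module

lemma coroot_Pv {β : V} (hb : β ∈ D.R0) : coroot β ∈ D.coweightLattice := by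
  intro α ha
  obtain ⟨k, hk⟩ := D.cart hb ha
  exact ⟨k, by rw [real_inner_comm, hk]⟩

lemma xi_upper (hc : 0 < c) (ht : D.TOk t) {μ ξ : V} (hμ : μ ∈ PcVee D c)
    (h : D.Gmap c t ξ = (2 * Real.pi) • (D.rhoVee + μ)) {β : V} (hb : β ∈ D.pos) :
    ⟪ξ, β⟫ < 2 * Real.pi := by
  have hR := D.pos_mem hb
  set ξ' := rf β ξ + (2 * Real.pi) • coroot β with hξ'
  have hK := inner_self_pos' (coroot_ne_zero (D.ne_zero _ hR))
  set K := ⟪coroot β, coroot β⟫ with hKdef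
  have e1 : D.Gmap c t ξ' = rf β (D.Gmap c t ξ) +
      (2 * Real.pi) • (c • coroot β + ∑ α ∈ D.pos, ⟪coroot β, α⟫ • coroot α) := by
    rw [hξ', Gmap_shift ht _ _ (coroot_Pv hR)]
    have := Gmap_W0 c ht (D.rfPerm_mem hR) ξ
    change D.Gmap c t (rf β ξ) = rf β _ at this
    rw [this]
  have e2 : ξ - ξ' = (⟪ξ, β⟫ - 2 * Real.pi) • coroot β := by rw [hξ', rf_eq']; module
  have hcc : ∀ α : V, ⟪coroot α, coroot β⟫ = ⟪β, coroot α⟫ * (K / 2) := by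
    intro α
    have p := inner_self_pos' (D.ne_zero _ hR)
    rw [hKdef, inner_coroot β (coroot β), coroot_inner β β, inner_coroot β (coroot α), real_inner_comm β]
    field_simp
    exact real_inner_comm _ _
  have e3 : ⟪D.Gmap c t ξ - D.Gmap c t ξ', coroot β⟫ < 0 := by
    have e4 : ⟪D.Gmap c t ξ - D.Gmap c t ξ', coroot β⟫ = (Real.pi * K) *
        (2 * ⟪D.rhoVee, β⟫ - (∑ α ∈ D.pos, ⟪α, coroot β⟫ * ⟪β, coroot α⟫) + 2 * (⟪μ, β⟫ - c)) := by
      rw [e1, rf_eq', h]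
      simp only [inner_sub_left, inner_add_left, inner_smul_left, sum_inner, conj_trivial, hcc]
      rw [inner_coroot_self (D.ne_zero _ hR)]
      have : ∑ i ∈ D.pos, ⟪coroot β, i⟫ * (⟪β, coroot i⟫ * (K / 2)) =
          (∑ α ∈ D.pos, ⟪α, coroot β⟫ * ⟪β, coroot α⟫) * (K / 2) := by
        rw [Finset.sum_mul]
        apply Finset.sum_congr rfl
        intro α _
        rw [real_inner_comm α]; ring
      rw [this]; ring
    rw [e4]
    have h1 := rho_bound hb
    have h2 := (hμ.2 β hb).2
    exact mul_neg_of_pos_of_neg (mul_pos Real.pi_pos hK) (by linarith)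
  have hm := Gmap_mono c ht ξ ξ'
  rw [e2, inner_smul_right, inner_smul_left, inner_smul_right] at hm
  simp only [conj_trivial] at hm
  by_contra! hge
  rcases hge.eq_or_lt with h0 | h0
  · have : ξ = ξ' := by rw [← sub_eq_zero, e2, ← h0]; simp
    rw [← this] at e3; simp at e3
  · have h1 : (⟪ξ, β⟫ - 2 * Real.pi) * ⟪D.Gmap c t ξ - D.Gmap c t ξ', coroot β⟫ < 0 :=
      mul_neg_of_pos_of_neg (by linarith) e3
    have h2 : 0 ≤ c * ((⟪ξ, β⟫ - 2 * Real.pi) * ((⟪ξ, β⟫ - 2 * Real.pi) * ⟪coroot β, coroot β⟫)) := by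
      have : 0 ≤ ⟪ξ, β⟫ - 2 * Real.pi := by linarith
      have := hK.le
      positivity
    linarith

end RootSystemData

section cf

/-- One factor of the c-function. -/
def cf (t z : ℝ) : ℂ :=
  (1 - (t : ℂ) * Complex.exp (-(Complex.I * (z : ℝ)))) / (1 - Complex.exp (-(Complex.I * (z : ℝ))))

lemma cf_eq (t z : ℝ) : cf t z =
    (Complex.exp (Complex.I * z) - t) / (Complex.exp (Complex.I * z) - 1) := by
  unfold cf
  have h := Complex.exp_ne_zero (Complex.I * z)
  rw [Complex.exp_neg]
  rw [← mul_div_mul_left _ _ h]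
  congr 1
  · field_simp
  · field_simp

lemma cf_neg (t z : ℝ) : cf t (-z) =
    -((1 - t * Complex.exp (Complex.I * z)) / (Complex.exp (Complex.I * z) - 1)) := by
  unfold cf
  push_cast
  rw [mul_neg, neg_neg, ← div_neg, neg_sub]

lemma cf_flip (t z : ℝ) : cf t (-z) * (Complex.exp (Complex.I * z) - t) =
    -(cf t z * (1 - t * Complex.exp (Complex.I * z))) := by
  rw [cf_eq t z, cf_neg]; ring

lemma exp_ne_t {t : ℝ} (h0 : 0 < t) (h1 : t < 1) (z : ℝ) : Complex.exp (Complex.I * z) - t ≠ 0 := by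
  intro h
  have h2 := sub_eq_zero.1 h
  have h3 : ‖Complex.exp (Complex.I * z)‖ = 1 := by rw [mul_comm]; exact Complex.norm_exp_ofReal_mul_I z
  rw [h2, Complex.norm_real, Real.norm_of_nonneg h0.le] at h3
  linarith

lemma cf_ne {t z : ℝ} (h0 : 0 < t) (h1 : t < 1) (h : Complex.exp (Complex.I * z) ≠ 1) : cf t z ≠ 0 := by
  rw [cf_eq]
  exact div_ne_zero (exp_ne_t h0 h1 z) (sub_ne_zero.2 h)

lemma cf_mv {t : ℝ} (h0 : 0 < t) (h1 : t < 1) (z : ℝ) :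
    cf t z = -(Complex.exp (Complex.I * (mvfun t z : ℂ))) * cf t (-z) := by
  have h := mvfun_exp h0 h1 z
  have h2 : Complex.exp (Complex.I * z) * (1 - t * Complex.exp (-(Complex.I * z))) =
      Complex.exp (Complex.I * z) - t := by
    rw [mul_sub, mul_left_comm, ← Complex.exp_add]; simp
  rw [h2] at h
  rw [cf_eq, cf_neg, ← h]; ring

/-- The telescoping identity behind the reflection relation. -/
lemma tele (u A B t : ℂ) (n : ℕ) (hu : u - t ≠ 0) (h : B * (u - t) = -(A * (1 - t * u))) :
    A + B * u ^ (n + 1) = t * (A * u ^ (n + 1) + B) +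
      (t - 1) * ∑ k ∈ Finset.range n, (A * u ^ (k + 1) + B * u ^ (n - k)) := by
  have hS : ∑ k ∈ Finset.range n, u ^ (n - k) = ∑ k ∈ Finset.range n, u ^ (k + 1) := by
    rw [← Finset.sum_range_reflect]
    apply Finset.sum_congr rfl
    intro k hk
    rw [Finset.mem_range] at hk
    congr 1; omega
  rw [Finset.sum_add_distrib, ← Finset.mul_sum, ← Finset.mul_sum, hS]
  set S := ∑ k ∈ Finset.range n, u ^ (k + 1) with hSd
  have hg : S * (u - 1) = u ^ (n + 1) - u := by
    have := geom_sum_mul u n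
    have e : S = u * ∑ k ∈ Finset.range n, u ^ k := by
      rw [hSd, Finset.mul_sum]; exact Finset.sum_congr rfl fun k _ => by ring
    rw [e, mul_assoc, this]; ring
  apply mul_right_cancel₀ hu
  linear_combination (u ^ (n + 1) - t - (t - 1) * S) * h - A * (t - 1) * (1 + t) * hg

end cf

namespace RootSystemData

variable {V : Type*} [NormedAddCommGroup V] [InnerProductSpace ℝ V]

/-- The standing assumptions on the spectral point. -/
structure Stp (D : RootSystemData V) (c : ℝ) (τ : V × ℤ → ℝ) (μ ξ : V) : Prop where
  hc : 0 < c
  hpos : ∀ a : V × ℤ, D.IsAffRoot a → 0 < τ a ∧ τ a < 1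
  hinv : D.TauInv c τ
  hμ : μ ∈ PcVee D c
  crit : D.Gmap c (fun α => τ (α, (0:ℤ)) ^ 2) ξ = (2 * Real.pi) • (D.rhoVee + μ)

lemma TOk_of {D : RootSystemData V} {c : ℝ} {τ : V × ℤ → ℝ}
    (hpos : ∀ a : V × ℤ, D.IsAffRoot a → 0 < τ a ∧ τ a < 1) (hinv : D.TauInv c τ) :
    D.TOk (fun α => τ (α, (0:ℤ)) ^ 2) where
  lo := fun α ha => by have := (hpos (α, 0) ha).1; positivity
  hi := fun α ha => by have := hpos (α, 0) ha; nlinarith [this.1, this.2]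
  inv := fun w hw α ha => by rw [D.tau_W0 hinv hw ha]

namespace Stp

variable {D : RootSystemData V} {c : ℝ} {τ : V × ℤ → ℝ} {μ ξ : V} (S : D.Stp c τ μ ξ)

lemma ok (S : D.Stp c τ μ ξ) : D.TOk (fun α => τ (α, (0:ℤ)) ^ 2) := TOk_of S.hpos S.hinv

lemma reg (S : D.Stp c τ μ ξ) {w : Equiv.Perm V} (hw : w ∈ D.W0) {α : V} (ha : α ∈ D.R0) :
    Complex.exp (Complex.I * ((⟪w ξ, α⟫ : ℝ) : ℂ)) ≠ 1 := by
  rw [W0_inner' hw]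
  set β := w⁻¹ α with hβ
  have hb : β ∈ D.R0 := W0_mem (W0_inv hw) ha
  have key : ⟪ξ, β⟫ ≠ 0 ∧ |⟪ξ, β⟫| < 2 * Real.pi := by
    rcases D.pos_or_neg β hb with h | h
    · have h1 := xi_lower S.hc S.ok S.hμ S.crit h
      have h2 := xi_upper S.hc S.ok S.hμ S.crit h
      exact ⟨h1.ne', by rw [abs_of_pos h1]; exact h2⟩
    · have h1 := xi_lower S.hc S.ok S.hμ S.crit h
      have h2 := xi_upper S.hc S.ok S.hμ S.crit h
      rw [inner_neg_right] at h1 h2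
      exact ⟨by linarith, by rw [abs_of_neg (by linarith)]; exact h2⟩
  intro h
  obtain ⟨k, hk⟩ := Complex.exp_eq_one_iff.1 h
  have h2 : ⟪ξ, β⟫ = k * (2 * Real.pi) := by
    have : Complex.I * ((⟪ξ, β⟫ : ℝ) : ℂ) = Complex.I * ((k * (2 * Real.pi) : ℝ) : ℂ) := by
      rw [hk]; push_cast; ring
    exact_mod_cast mul_left_cancel₀ Complex.I_ne_zero this
  have hp : 0 < 2 * Real.pi := by positivity
  rw [h2, abs_mul, abs_of_pos hp] at key
  have h3 : |(k:ℝ)| < 1 := by nlinarith [key.2]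
  have h4 : |k| < 1 := by exact_mod_cast h3
  have h5 : k = 0 := Int.abs_lt_one_iff.1 h4
  apply key.1; rw [h5]; simp

lemma C_ne (S : D.Stp c τ μ ξ) {w : Equiv.Perm V} (hw : w ∈ D.W0) : CfunSq D τ (w ξ) ≠ 0 := by
  apply Finset.prod_ne_zero_iff.2
  intro α ha
  have hR := D.pos_mem ha
  exact cf_ne (S.ok.lo _ hR) (S.ok.hi _ hR) (S.reg hw hR)

lemma C_simple (S : D.Stp c τ μ ξ) {w : Equiv.Perm V} (hw : w ∈ D.W0) (j : Fin D.n) :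
    CfunSq D τ (rf (D.simpleRoot j) (w ξ)) *
      (Complex.exp (Complex.I * ((⟪w ξ, D.simpleRoot j⟫ : ℝ) : ℂ)) - ((τ (D.simpleRoot j, 0) ^ 2 : ℝ) : ℂ))
    = -(CfunSq D τ (w ξ) * (1 - ((τ (D.simpleRoot j, 0) ^ 2 : ℝ) : ℂ) *
        Complex.exp (Complex.I * ((⟪w ξ, D.simpleRoot j⟫ : ℝ) : ℂ)))) := by
  set ζ := w ξ
  set g : V → ℂ := fun α => cf (τ (α, 0) ^ 2) ⟪ζ, α⟫ with hg
  have hR := D.simple_mem j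
  have h := D.sum_pos_simple (M := Additive ℂ) (fun α => Additive.ofMul (g α)) j
  have h' : (∏ α ∈ D.pos, g (rf (D.simpleRoot j) α)) * g (D.simpleRoot j) =
    (∏ α ∈ D.pos, g α) * g (-D.simpleRoot j) := h
  have e1 : CfunSq D τ (rf (D.simpleRoot j) ζ) = ∏ α ∈ D.pos, g (rf (D.simpleRoot j) α) := by
    apply Finset.prod_congr rfl
    intro α ha
    have : τ (rf (D.simpleRoot j) α, 0) = τ (α, 0) := D.tau_W0 S.hinv (D.rfPerm_mem hR) (D.pos_mem ha) 0
    rw [hg]; dsimp only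
    rw [this, ← inner_rf_left]; rfl
  have e2 : CfunSq D τ ζ = ∏ α ∈ D.pos, g α := rfl
  rw [← e1, ← e2] at h'
  have e3 : g (-D.simpleRoot j) = cf (τ (D.simpleRoot j, 0) ^ 2) (-⟪ζ, D.simpleRoot j⟫) := by
    rw [hg]; dsimp only; rw [inner_neg_right, D.tau_neg S.hinv hR]
  have h2 := cf_flip (τ (D.simpleRoot j, 0) ^ 2) ⟪ζ, D.simpleRoot j⟫
  rw [← e3] at h2
  have hne : g (D.simpleRoot j) ≠ 0 := cf_ne (S.ok.lo _ hR) (S.ok.hi _ hR) (S.reg hw hR)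
  have h3 : cf (τ (D.simpleRoot j, 0) ^ 2) ⟪ζ, D.simpleRoot j⟫ = g (D.simpleRoot j) := rfl
  rw [h3] at h2
  apply mul_right_cancel₀ hne
  linear_combination (Complex.exp (Complex.I * ((⟪ζ, D.simpleRoot j⟫ : ℝ) : ℂ)) -
    ((τ (D.simpleRoot j, 0) ^ 2 : ℝ) : ℂ)) * h' + CfunSq D τ ζ * h2

end Stp

/-- Positive roots not orthogonal to the highest short root. -/
def NN (D : RootSystemData V) : Finset V := D.pos.filter fun α => 0 < ⟪D.hshort, α⟫

lemma NN_flip (D : RootSystemData V) {α : V} (ha : α ∈ D.NN) : -(rf D.hshort α) ∈ D.NN := by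
  rw [NN, Finset.mem_filter] at ha ⊢
  have h1 : 0 < ⟪D.hshort, -(rf D.hshort α)⟫ := by
    rw [inner_neg_right, ← inner_rf_left, rf_self D.hshort_ne, inner_neg_left, neg_neg]; exact ha.2
  exact ⟨D.pos_of_hshort (D.neg_mem (D.rf_mem D.hshort_memR (D.pos_mem ha.1))) h1, h1⟩

lemma NN_flip_flip (D : RootSystemData V) (α : V) : -(rf D.hshort (-(rf D.hshort α))) = α := by
  rw [rf_neg, rf_rf D.hshort_ne, neg_neg]

lemma hshort_NN (D : RootSystemData V) : D.hshort ∈ D.NN := by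
  rw [NN, Finset.mem_filter]
  exact ⟨D.hshort_mem, inner_self_pos' D.hshort_ne⟩

lemma NN_card (D : RootSystemData V) : ∏ _α ∈ D.NN, (-1 : ℂ) = -1 := by
  rw [← Finset.mul_prod_erase _ _ D.hshort_NN]
  rw [Finset.prod_involution (fun α _ => -(rf D.hshort α))]
  · simp
  · intros; simp
  · intro α ha _ h
    rw [Finset.mem_erase] at ha
    have h2 : (2:ℝ) • α = ⟪α, coroot D.hshort⟫ • D.hshort := by
      unfold rf at h
      rw [neg_sub, sub_eq_iff_eq_add] at h
      rw [h, two_smul]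
    have h3 : α = (⟪α, coroot D.hshort⟫ / 2) • D.hshort := by
      rw [div_eq_inv_mul, mul_smul, ← h2, smul_smul]; norm_num
    have hp := (Finset.mem_filter.1 ha.2).1
    have hm := D.pos_mem hp
    rw [h3] at hm
    rcases D.reduced _ D.hshort_memR _ hm with h4 | h4
    · rw [h4, one_smul] at h3; exact ha.1 h3
    · rw [h4, neg_one_smul] at h3
      exact D.pos_not_both _ D.hshort_mem (h3 ▸ hp)
  · intro α ha
    rw [Finset.mem_erase] at ha ⊢
    refine ⟨fun h => ?_, D.NN_flip ha.2⟩
    have := D.NN_flip_flip α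
    rw [h, rf_self D.hshort_ne, neg_neg] at this
    exact ha.1 this.symm
  · intro α _; exact D.NN_flip_flip α

lemma prod_theta (D : RootSystemData V) (g : V → ℂ) :
    (∏ α ∈ D.pos, g (rf D.hshort α)) * ∏ α ∈ D.NN, g α =
      (∏ α ∈ D.pos, g α) * ∏ α ∈ D.NN, g (-α) := by
  rw [← Finset.prod_filter_mul_prod_filter_not D.pos (fun α => 0 < ⟪D.hshort, α⟫),
    ← Finset.prod_filter_mul_prod_filter_not D.pos (fun α => 0 < ⟪D.hshort, α⟫) g]
  have e1 : ∏ α ∈ D.pos.filter (fun α => ¬ 0 < ⟪D.hshort, α⟫), g (rf D.hshort α) =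
      ∏ α ∈ D.pos.filter (fun α => ¬ 0 < ⟪D.hshort, α⟫), g α := by
    apply Finset.prod_congr rfl
    intro α ha
    rw [Finset.mem_filter] at ha
    have h0 : ⟪D.hshort, α⟫ = 0 := le_antisymm (not_lt.1 ha.2) (D.hshort_inner_nonneg ha.1)
    have : ⟪α, coroot D.hshort⟫ = 0 := by rw [inner_coroot, real_inner_comm D.hshort α, h0, mul_zero]
    rw [rf, this, zero_smul, sub_zero]
  have e2 : ∏ α ∈ D.pos.filter (fun α => 0 < ⟪D.hshort, α⟫), g (rf D.hshort α) =
      ∏ α ∈ D.NN, g (-α) := by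
    apply Finset.prod_nbij' (fun α => -(rf D.hshort α)) (fun α => -(rf D.hshort α))
    · intro α ha; exact D.NN_flip ha
    · intro α ha; exact D.NN_flip ha
    · intro α _; exact D.NN_flip_flip α
    · intro α _; exact D.NN_flip_flip α
    · intro α _; rw [neg_neg]
  rw [e1, e2, NN]; ring

namespace Stp

variable {D : RootSystemData V} {c : ℝ} {τ : V × ℤ → ℝ} {μ ξ : V}

/-- The Bethe equation in the direction of the highest short root. -/
lemma bethe (S : D.Stp c τ μ ξ) {w : Equiv.Perm V} (hw : w ∈ D.W0) :
    Complex.exp (Complex.I * ((c * ⟪w ξ, D.hshort⟫ : ℝ) : ℂ)) *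
      (∏ α ∈ D.NN, Complex.exp (Complex.I * (mvfun (τ (α, 0) ^ 2) ⟪w ξ, α⟫ : ℂ))) *
      Complex.exp (Complex.I * (mvfun (τ (D.hshort, 0) ^ 2) ⟪w ξ, D.hshort⟫ : ℂ)) = 1 := by
  have h1 := Gmap_W0 c S.ok hw ξ
  rw [S.crit] at h1
  have hR : (w⁻¹ : Equiv.Perm V) D.hshort ∈ D.R0 := W0_mem (W0_inv hw) D.hshort_memR
  obtain ⟨k, hk⟩ : ∃ k : ℤ, ⟪D.rhoVee + μ, (w⁻¹ : Equiv.Perm V) D.hshort⟫ = k := by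
    obtain ⟨a, ha⟩ := D.rhoVee_mem _ hR
    obtain ⟨b, hb⟩ := S.hμ.1 _ hR
    exact ⟨a + b, by rw [inner_add_left, ha, hb]; push_cast; rfl⟩
  have h2 : ⟪D.Gmap c (fun α => τ (α, (0:ℤ)) ^ 2) (w ξ), D.hshort⟫ = 2 * Real.pi * k := by
    rw [h1, W0_inner' hw, inner_smul_left, hk]; simp
  have h3 : ⟪D.Gmap c (fun α => τ (α, (0:ℤ)) ^ 2) (w ξ), D.hshort⟫ =
      c * ⟪w ξ, D.hshort⟫ + (∑ α ∈ D.NN, mvfun (τ (α, 0) ^ 2) ⟪w ξ, α⟫) +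
        mvfun (τ (D.hshort, 0) ^ 2) ⟪w ξ, D.hshort⟫ := by
    rw [Gmap, inner_add_left, inner_smul_left, sum_inner, add_assoc]
    congr 1
    have : ∑ α ∈ D.pos, ⟪mvfun (τ (α, 0) ^ 2) ⟪w ξ, α⟫ • coroot α, D.hshort⟫ =
        ∑ α ∈ D.NN, ⟪mvfun (τ (α, 0) ^ 2) ⟪w ξ, α⟫ • coroot α, D.hshort⟫ := by
      symm
      apply Finset.sum_subset (Finset.filter_subset _ _)
      intro α ha hn
      have h0 : ⟪D.hshort, α⟫ = 0 := by
        have : ¬ 0 < ⟪D.hshort, α⟫ := fun h => hn (Finset.mem_filter.2 ⟨ha, h⟩)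
        exact le_antisymm (not_lt.1 this) (D.hshort_inner_nonneg ha)
      rw [inner_smul_left, coroot_inner, real_inner_comm D.hshort α, h0]; simp
    rw [this, ← Finset.add_sum_erase _ _ D.hshort_NN, ← Finset.add_sum_erase _ (fun α => mvfun (τ (α, 0) ^ 2) ⟪w ξ, α⟫) D.hshort_NN]
    have h4 : ∑ α ∈ D.NN.erase D.hshort, ⟪mvfun (τ (α, 0) ^ 2) ⟪w ξ, α⟫ • coroot α, D.hshort⟫ =
        ∑ α ∈ D.NN.erase D.hshort, mvfun (τ (α, 0) ^ 2) ⟪w ξ, α⟫ := by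
      apply Finset.sum_congr rfl
      intro α ha
      rw [Finset.mem_erase] at ha
      have hp := Finset.mem_filter.1 ha.2
      have hRa := D.pos_mem hp.1
      obtain ⟨m, hm, hm'⟩ := D.short_cartan (D.hshort_short α hRa) D.hshort_memR hRa
      have hpos : 0 < ⟪D.hshort, coroot α⟫ := by
        rw [inner_coroot]
        have := inner_self_pos' (D.ne_zero _ hRa)
        have := hp.2
        positivity
      have hm1 : m = 1 := by
        rw [hm] at hpos
        have : 0 < m := by exact_mod_cast hpos
        rcases hm' with h | h | h
        · omega
        · exact absurd h.2 ha.1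
        · omega
      rw [inner_smul_left, real_inner_comm D.hshort (coroot α), hm, hm1]; simp
    rw [h4, inner_smul_left, real_inner_comm D.hshort (coroot D.hshort), inner_coroot_self D.hshort_ne]
    simp only [conj_trivial]; ring
  rw [← Complex.exp_sum, ← Complex.exp_add, ← Complex.exp_add, Complex.exp_eq_one_iff]
  refine ⟨k, ?_⟩
  rw [h2] at h3
  rw [← Finset.mul_sum, ← mul_add, ← mul_add, ← Complex.ofReal_sum, ← Complex.ofReal_add,
    ← Complex.ofReal_add, ← h3]
  push_cast; ring

lemma C_theta (S : D.Stp c τ μ ξ) {w : Equiv.Perm V} (hw : w ∈ D.W0) :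
    CfunSq D τ (rf D.hshort (w ξ)) * Complex.exp (Complex.I * ((c * ⟪w ξ, -D.hshort⟫ : ℝ) : ℂ)) *
      (Complex.exp (Complex.I * ((⟪w ξ, -D.hshort⟫ : ℝ) : ℂ)) - ((τ (-D.hshort, 1) ^ 2 : ℝ) : ℂ))
    = -(CfunSq D τ (w ξ) * (1 - ((τ (-D.hshort, 1) ^ 2 : ℝ) : ℂ) *
        Complex.exp (Complex.I * ((⟪w ξ, -D.hshort⟫ : ℝ) : ℂ)))) := by
  have hb := S.bethe hw
  have hR := D.hshort_memR
  rw [D.tau_neg S.hinv hR]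
  set ζ := w ξ
  set g : V → ℂ := fun α => cf (τ (α, 0) ^ 2) ⟪ζ, α⟫ with hg
  have h' := D.prod_theta g
  have e1 : CfunSq D τ (rf D.hshort ζ) = ∏ α ∈ D.pos, g (rf D.hshort α) := by
    apply Finset.prod_congr rfl
    intro α ha
    have : τ (rf D.hshort α, 0) = τ (α, 0) := D.tau_W0 S.hinv (D.rfPerm_mem hR) (D.pos_mem ha) 0
    rw [hg]; dsimp only
    rw [this, ← inner_rf_left]; rfl
  have e2 : CfunSq D τ ζ = ∏ α ∈ D.pos, g α := rfl
  rw [← e1, ← e2] at h'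
  have e3 : ∀ α ∈ D.NN, g (-α) = cf (τ (α, 0) ^ 2) (-⟪ζ, α⟫) := by
    intro α ha
    rw [hg]; dsimp only; rw [inner_neg_right, D.tau_neg S.hinv (D.pos_mem (Finset.mem_filter.1 ha).1)]
  have e4 : ∏ α ∈ D.NN, g α = -(∏ α ∈ D.NN, Complex.exp (Complex.I * (mvfun (τ (α, 0) ^ 2) ⟪ζ, α⟫ : ℂ)))
      * ∏ α ∈ D.NN, g (-α) := by
    rw [← neg_one_mul, ← D.NN_card, ← Finset.prod_mul_distrib, ← Finset.prod_mul_distrib]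
    apply Finset.prod_congr rfl
    intro α ha
    have hRa := D.pos_mem (Finset.mem_filter.1 ha).1
    rw [e3 α ha, neg_one_mul]
    exact cf_mv (S.ok.lo _ hRa) (S.ok.hi _ hRa) _
  have hne : ∏ α ∈ D.NN, g (-α) ≠ 0 := by
    apply Finset.prod_ne_zero_iff.2
    intro α ha
    have hRa := D.neg_mem (D.pos_mem (Finset.mem_filter.1 ha).1)
    exact cf_ne (S.ok.lo _ hRa) (S.ok.hi _ hRa) (S.reg hw hRa)
  rw [e4] at h'
  set E := ∏ α ∈ D.NN, Complex.exp (Complex.I * (mvfun (τ (α, 0) ^ 2) ⟪ζ, α⟫ : ℂ))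
  have h2 : -(CfunSq D τ (rf D.hshort ζ) * E) = CfunSq D τ ζ := by
    apply mul_right_cancel₀ hne
    linear_combination h'
  have hm := mvfun_exp (S.ok.lo _ hR) (S.ok.hi _ hR) ⟪ζ, D.hshort⟫
  set X := Complex.exp (Complex.I * (mvfun (τ (D.hshort, 0) ^ 2) ⟪ζ, D.hshort⟫ : ℂ))
  have hu : Complex.exp (Complex.I * ((⟪ζ, -D.hshort⟫ : ℝ) : ℂ)) =
      Complex.exp (-(Complex.I * ((⟪ζ, D.hshort⟫ : ℝ) : ℂ))) := by
    rw [inner_neg_right]; push_cast; rw [mul_neg]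
  have huU : Complex.exp (-(Complex.I * ((⟪ζ, D.hshort⟫ : ℝ) : ℂ))) * Complex.exp (Complex.I * ((⟪ζ, D.hshort⟫ : ℝ) : ℂ)) = 1 := by
    rw [← Complex.exp_add]; simp
  have hv : Complex.exp (Complex.I * ((c * ⟪ζ, -D.hshort⟫ : ℝ) : ℂ)) *
      Complex.exp (Complex.I * ((c * ⟪ζ, D.hshort⟫ : ℝ) : ℂ)) = 1 := by
    rw [← Complex.exp_add, inner_neg_right]; push_cast; ring_nf; simp
  rw [hu]
  set u := Complex.exp (-(Complex.I * ((⟪ζ, D.hshort⟫ : ℝ) : ℂ)))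
  set U := Complex.exp (Complex.I * ((⟪ζ, D.hshort⟫ : ℝ) : ℂ))
  set v := Complex.exp (Complex.I * ((c * ⟪ζ, -D.hshort⟫ : ℝ) : ℂ))
  set v' := Complex.exp (Complex.I * ((c * ⟪ζ, D.hshort⟫ : ℝ) : ℂ))
  set C' := CfunSq D τ (rf D.hshort ζ)
  have hEX : E * X = v := by linear_combination v * hb - E * X * hv
  rw [← hEX, ← h2]
  have h9 : X * (u - ((τ (D.hshort, 0) ^ 2 : ℝ) : ℂ)) = 1 - ((τ (D.hshort, 0) ^ 2 : ℝ) : ℂ) * u := by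
    linear_combination u * hm - (1 - ((τ (D.hshort, 0) ^ 2 : ℝ) : ℂ) * u) * (1 - huU) + X * ((τ (D.hshort, 0) ^ 2 : ℝ) : ℂ) * huU
  linear_combination C' * E * h9

end Stp

/-- The reflection relation, generic form. -/
lemma rel_generic {D : RootSystemData V} {τ : V × ℤ → ℝ} {W0fin : Finset (Equiv.Perm V)}
    (hW : ∀ w : Equiv.Perm V, w ∈ W0fin ↔ w ∈ D.W0) {ξ α : V} (ha : α ∈ D.R0) (q : ℝ) (t : ℂ)
    (hR : ∀ w ∈ D.W0, CfunSq D τ (rf α (w ξ)) * Complex.exp (Complex.I * ((q * ⟪w ξ, α⟫ : ℝ) : ℂ)) *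
      (Complex.exp (Complex.I * ((⟪w ξ, α⟫ : ℝ) : ℂ)) - t)
      = -(CfunSq D τ (w ξ) * (1 - t * Complex.exp (Complex.I * ((⟪w ξ, α⟫ : ℝ) : ℂ)))))
    (hne : ∀ w ∈ D.W0, Complex.exp (Complex.I * ((⟪w ξ, α⟫ : ℝ) : ℂ)) - t ≠ 0)
    (x : V) (n : ℕ) (hx : ⟪x, coroot α⟫ + q = -((n:ℝ) + 1)) :
    PhiFun D τ W0fin ξ x = t * PhiFun D τ W0fin ξ (x + ((n:ℝ) + 1) • α) +
      (t - 1) * ∑ k ∈ Finset.range n, PhiFun D τ W0fin ξ (x + ((k:ℝ) + 1) • α) := by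
  set h : Equiv.Perm V → V → ℂ := fun w y => CfunSq D τ (w ξ) * Complex.exp (Complex.I * (⟪w ξ, y⟫ : ℝ)) with hh
  set s := rfPerm α (D.ne_zero α ha) with hs
  have hsm : s ∈ D.W0 := D.rfPerm_mem ha
  have hss : s * s = 1 := by
    ext y; exact rf_rf (D.ne_zero α ha) y
  have hF : ∀ y, 2 * PhiFun D τ W0fin ξ y = ∑ w ∈ W0fin, (h w y + h (s * w) y) := by
    intro y
    have : ∑ w ∈ W0fin, h (s * w) y = ∑ w ∈ W0fin, h w y := by
      apply Finset.sum_nbij' (fun w => s * w) (fun w => s * w)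
      · intro w hw; rw [hW] at hw ⊢; exact D.W0.mul_mem hsm hw
      · intro w hw; rw [hW] at hw ⊢; exact D.W0.mul_mem hsm hw
      · intro w _; rw [← mul_assoc, hss, one_mul]
      · intro w _; rw [← mul_assoc, hss, one_mul]
      · intro w _; rfl
    rw [Finset.sum_add_distrib, this, two_mul]; rfl
  have key : ∀ w ∈ D.W0, ∀ κ : ℝ, h w (x + κ • α) + h (s * w) (x + κ • α) =
      Complex.exp (Complex.I * (⟪w ξ, x⟫ : ℝ)) * (CfunSq D τ (w ξ) * Complex.exp (κ * (Complex.I * (⟪w ξ, α⟫ : ℝ)))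
       + (CfunSq D τ (rf α (w ξ)) * Complex.exp (Complex.I * ((q * ⟪w ξ, α⟫ : ℝ) : ℂ))) *
        Complex.exp (((n:ℝ) + 1 - κ : ℝ) * (Complex.I * (⟪w ξ, α⟫ : ℝ)))) := by
    intro w hw κ
    have e1 : h (s * w) (x + κ • α) = CfunSq D τ (rf α (w ξ)) * Complex.exp (Complex.I * (⟪rf α (w ξ), x + κ • α⟫ : ℝ)) := rfl
    have e2 : ⟪rf α (w ξ), x + κ • α⟫ = ⟪w ξ, x⟫ + q * ⟪w ξ, α⟫ + ((n:ℝ) + 1 - κ) * ⟪w ξ, α⟫ := by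
      rw [inner_rf_left, rf_add, rf_smul, rf_self (D.ne_zero α ha), rf]
      have : ⟪x, coroot α⟫ = -((n:ℝ) + 1) - q := by linarith
      rw [this, inner_add_right, inner_sub_right, inner_smul_right, inner_smul_right, inner_neg_right]
      ring
    have e3 : h w (x + κ • α) = CfunSq D τ (w ξ) * Complex.exp (Complex.I * (⟪w ξ, x⟫ + κ * ⟪w ξ, α⟫ : ℝ)) := by
      rw [hh]; dsimp only; rw [inner_add_right, inner_smul_right]
    rw [e1, e2, e3]
    push_cast
    rw [mul_add, mul_add, mul_add, Complex.exp_add, Complex.exp_add, Complex.exp_add]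
    ring_nf
  have e : ∀ (z : ℂ) (k : ℕ), Complex.exp ((k:ℝ) * z) = Complex.exp z ^ k := by
    intro z k; rw [← Complex.exp_nat_mul]; push_cast; rfl
  apply mul_left_cancel₀ (two_ne_zero (α := ℂ))
  have : 2 * (t * PhiFun D τ W0fin ξ (x + ((n:ℝ) + 1) • α) +
      (t - 1) * ∑ k ∈ Finset.range n, PhiFun D τ W0fin ξ (x + ((k:ℝ) + 1) • α)) =
      t * (2 * PhiFun D τ W0fin ξ (x + ((n:ℝ) + 1) • α)) +
      (t - 1) * ∑ k ∈ Finset.range n, 2 * PhiFun D τ W0fin ξ (x + ((k:ℝ) + 1) • α) := by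
    rw [← Finset.mul_sum]; ring
  rw [this]
  simp only [hF]
  rw [Finset.sum_comm, Finset.mul_sum, Finset.mul_sum, ← Finset.sum_add_distrib]
  apply Finset.sum_congr rfl
  intro w hw
  rw [hW] at hw
  have hT := tele (Complex.exp (Complex.I * ((⟪w ξ, α⟫ : ℝ) : ℂ))) (CfunSq D τ (w ξ))
    (CfunSq D τ (rf α (w ξ)) * Complex.exp (Complex.I * ((q * ⟪w ξ, α⟫ : ℝ) : ℂ))) t n (hne w hw) (hR w hw)
  have k0 := key w hw 0
  rw [zero_smul, add_zero] at k0
  rw [k0, key w hw]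
  have k2 : ∀ k ∈ Finset.range n, h w (x + ((k:ℝ) + 1) • α) + h (s * w) (x + ((k:ℝ) + 1) • α) =
     Complex.exp (Complex.I * (⟪w ξ, x⟫ : ℝ)) * (CfunSq D τ (w ξ) * Complex.exp (Complex.I * ((⟪w ξ, α⟫ : ℝ) : ℂ)) ^ (k+1) +
      (CfunSq D τ (rf α (w ξ)) * Complex.exp (Complex.I * ((q * ⟪w ξ, α⟫ : ℝ) : ℂ))) *
        Complex.exp (Complex.I * ((⟪w ξ, α⟫ : ℝ) : ℂ)) ^ (n - k)) := by
    intro k hk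
    have hk' : k ≤ n := (Finset.mem_range.1 hk).le
    rw [key w hw]
    have e5 : ((n:ℝ) + 1 - ((k:ℝ) + 1) : ℝ) = ((n - k : ℕ) : ℝ) := by rw [Nat.cast_sub hk']; ring
    have e6 : ((k:ℝ) + 1 : ℝ) = ((k + 1 : ℕ) : ℝ) := by push_cast; rfl
    rw [e5, e6, e, e]
  rw [Finset.sum_congr rfl k2, ← Finset.mul_sum]
  have e7 : ((n:ℝ) + 1 : ℝ) = ((n + 1 : ℕ) : ℝ) := by push_cast; rfl
  have e8 : ((n:ℝ) + 1 - ((n:ℝ) + 1) : ℝ) = ((0 : ℕ) : ℝ) := by push_cast; ring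
  rw [e8, sub_zero, e7, e, e]
  have e9 : Complex.exp (((0:ℝ) : ℂ) * (Complex.I * ((⟪w ξ, α⟫ : ℝ) : ℂ))) = 1 := by simp
  rw [e9, pow_zero, mul_one, mul_one]
  linear_combination Complex.exp (Complex.I * (⟪w ξ, x⟫ : ℝ)) * hT

/-- The reflection relation for the periodic Macdonald spherical functions. -/
lemma Stp.rel {D : RootSystemData V} {c : ℝ} {τ : V × ℤ → ℝ} {μ ξ : V} (S : D.Stp c τ μ ξ)
    {W0fin : Finset (Equiv.Perm V)} (hW : ∀ w : Equiv.Perm V, w ∈ W0fin ↔ w ∈ D.W0)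
    (j : Fin (D.n + 1)) (x : V) (n : ℕ) (hx : aval c (D.aSimple j) x = -((n:ℝ) + 1)) :
    PhiFun D τ W0fin ξ x = ((τ (D.aSimple j) ^ 2 : ℝ) : ℂ) * PhiFun D τ W0fin ξ (x + ((n:ℝ) + 1) • (D.aSimple j).1) +
      (((τ (D.aSimple j) ^ 2 : ℝ) : ℂ) - 1) *
        ∑ k ∈ Finset.range n, PhiFun D τ W0fin ξ (x + ((k:ℝ) + 1) • (D.aSimple j).1) := by
  have hp := S.hpos (D.aSimple j) (D.aSimple_mem j)
  have hlt : τ (D.aSimple j) ^ 2 < 1 := by nlinarith [hp.1, hp.2]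
  have hgt : 0 < τ (D.aSimple j) ^ 2 := by have := hp.1; positivity
  refine rel_generic hW (D.aSimple_mem j) ((D.aSimple j).2 * c) _ ?_ (fun w _ => exp_ne_t hgt hlt _) x n hx
  intro w hw
  refine Fin.cases ?_ (fun i => ?_) j
  · rw [aSimple_zero]
    have := S.C_theta hw
    dsimp only
    rw [rf_neg_left, Int.cast_one, one_mul]
    exact this
  · rw [aSimple_succ]
    have := S.C_simple hw i
    dsimp only
    simp only [Int.cast_zero, zero_mul, Complex.ofReal_zero, mul_zero, Complex.exp_zero, mul_one]
    exact this

end RootSystemData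

namespace RootSystemData

variable {V : Type*} [NormedAddCommGroup V] [InnerProductSpace ℝ V]
variable {D : RootSystemData V}

/-! ### e-weights -/

section etau

variable {τ : V × ℤ → ℝ} (hpos : ∀ a : V × ℤ, D.IsAffRoot a → 0 < τ a ∧ τ a < 1)

lemma etau_pos (hpos : ∀ a : V × ℤ, D.IsAffRoot a → 0 < τ a ∧ τ a < 1) (η : V) : 0 < D.etau τ η :=
  Finset.prod_pos fun α ha => zpow_pos (hpos (α, 0) (D.pos_mem ha)).1 _

lemma etau_zero : D.etau τ 0 = 1 := by
  unfold etau; simp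

lemma etau_add (hpos : ∀ a : V × ℤ, D.IsAffRoot a → 0 < τ a ∧ τ a < 1) {x y : V}
    (hx : x ∈ D.weightLattice) (hy : y ∈ D.weightLattice) :
    D.etau τ (x + y) = D.etau τ x * D.etau τ y := by
  unfold etau
  rw [← Finset.prod_mul_distrib]
  apply Finset.prod_congr rfl
  intro α ha
  have hR := D.pos_mem ha
  obtain ⟨k, hk⟩ := hx α hR
  obtain ⟨l, hl⟩ := hy α hR
  rw [inner_add_left, hk, hl, ← Int.cast_add, Int.floor_intCast, Int.floor_intCast, Int.floor_intCast,
    zpow_add₀ (hpos (α, 0) hR).1.ne']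

lemma etau_refl {c : ℝ} (hpos : ∀ a : V × ℤ, D.IsAffRoot a → 0 < τ a ∧ τ a < 1) (hinv : D.TauInv c τ)
    {x : V} (hx : x ∈ D.weightLattice) (j : Fin D.n) (m : ℤ) (hm : ⟪x, coroot (D.simpleRoot j)⟫ = m) :
    D.etau τ x = τ (D.simpleRoot j, 0) ^ (2 * m) * D.etau τ (rf (D.simpleRoot j) x) := by
  set g : V → ℝ := fun α => τ (α, 0) ^ ⌊⟪x, coroot α⟫⌋ with hg
  have hR := D.simple_mem j
  have h := D.sum_pos_simple (M := Additive ℝ) (fun α => Additive.ofMul (g α)) j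
  have h' : (∏ α ∈ D.pos, g (rf (D.simpleRoot j) α)) * g (D.simpleRoot j) =
    (∏ α ∈ D.pos, g α) * g (-D.simpleRoot j) := h
  have e1 : D.etau τ (rf (D.simpleRoot j) x) = ∏ α ∈ D.pos, g (rf (D.simpleRoot j) α) := by
    apply Finset.prod_congr rfl
    intro α ha
    have : τ (rf (D.simpleRoot j) α, 0) = τ (α, 0) := D.tau_W0 hinv (D.rfPerm_mem hR) (D.pos_mem ha) 0
    rw [hg]; dsimp only
    rw [this, coroot_rf (D.simple_ne j), ← inner_rf_left]
  have e2 : D.etau τ x = ∏ α ∈ D.pos, g α := rfl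
  rw [← e1, ← e2] at h'
  have hp := (hpos (D.simpleRoot j, 0) hR).1
  have e3 : g (D.simpleRoot j) = τ (D.simpleRoot j, 0) ^ m := by
    rw [hg]; dsimp only; rw [hm, Int.floor_intCast]
  have e4 : g (-D.simpleRoot j) = τ (D.simpleRoot j, 0) ^ (-m) := by
    rw [hg]; dsimp only
    rw [D.tau_neg hinv hR, coroot_neg, inner_neg_right, hm, ← Int.cast_neg, Int.floor_intCast]
  rw [e3, e4] at h'
  have h5 : τ (D.simpleRoot j, 0) ^ (-m) ≠ 0 := (zpow_pos hp _).ne'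
  apply mul_right_cancel₀ h5
  rw [← h', mul_right_comm, ← zpow_add₀ hp.ne', mul_comm]
  congr 2; ring

/-- The weight `E(ν, r) = e(ν) h^r`. -/
def EE (D : RootSystemData V) (τ : V × ℤ → ℝ) (b : V × ℤ) : ℝ := D.etau τ b.1 * D.hvee τ ^ b.2

lemma hvee_pos (hpos : ∀ a : V × ℤ, D.IsAffRoot a → 0 < τ a ∧ τ a < 1) : 0 < D.hvee τ := by
  unfold hvee tauZero
  have := (hpos (-D.hshort, 1) (D.neg_mem D.hshort_memR)).1
  have := etau_pos hpos D.hshort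
  positivity

lemma short_symm {ν : V} (h : ∃ w ∈ D.W0, w D.hshort = ν) (β : V) (hb : ∃ w ∈ D.W0, w D.hshort = β) :
    ⟪ν, coroot β⟫ = ⟪β, coroot ν⟫ := by
  obtain ⟨w, hw, rfl⟩ := h
  obtain ⟨u, hu, rfl⟩ := hb
  rw [inner_coroot, inner_coroot, W0_inner hw, W0_inner hu, real_inner_comm (u D.hshort) (w D.hshort)]

lemma EE_step {c : ℝ} (hpos : ∀ a : V × ℤ, D.IsAffRoot a → 0 < τ a ∧ τ a < 1) (hinv : D.TauInv c τ)
    {ν : V} (hν : ∃ w ∈ D.W0, w D.hshort = ν) (j : Fin (D.n + 1)) (r : ℤ)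
    (h1 : ⟪ν, coroot (D.aSimple j).1⟫ = 1) :
    D.EE τ (ν, r) = τ (D.aSimple j) ^ 2 * D.EE τ (ract (D.aSimple j) (ν, r)) := by
  have hP : ν ∈ D.weightLattice := by
    obtain ⟨w, hw, rfl⟩ := hν
    exact D.P_root (W0_mem hw D.hshort_memR)
  revert h1
  refine Fin.cases ?_ (fun i => ?_) j
  · rw [aSimple_zero]; dsimp only
    intro h1
    unfold ract EE
    dsimp only
    have h2 : ⟪-D.hshort, coroot ν⟫ = 1 := by
      rw [inner_neg_left, short_symm (ν := D.hshort) ⟨1, D.W0.one_mem, rfl⟩ ν hν, ← inner_neg_right, ← coroot_neg]; exact h1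
    have h3 : rf (-D.hshort) ν = ν + D.hshort := by
      rw [rf, h1, one_smul, sub_neg_eq_add]
    have hh := hvee_pos hpos
    rw [h2, h3, Int.floor_one, one_mul, etau_add hpos hP (D.P_root D.hshort_memR), zpow_sub_one₀ hh.ne']
    have e : D.hvee τ = τ (-D.hshort, 1) ^ 2 * D.etau τ D.hshort := rfl
    have : D.hvee τ * (D.hvee τ)⁻¹ = 1 := mul_inv_cancel₀ hh.ne'
    calc _ = D.etau τ ν * D.hvee τ ^ r * (D.hvee τ * (D.hvee τ)⁻¹) := by rw [this, mul_one]
      _ = D.etau τ ν * D.hvee τ ^ r * ((τ (-D.hshort, 1) ^ 2 * D.etau τ D.hshort) * (D.hvee τ)⁻¹) := by rw [← e]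
      _ = _ := by ring
  · rw [aSimple_succ]; dsimp only
    intro h1
    unfold ract EE
    dsimp only
    rw [etau_refl hpos hinv hP i 1 (by rw [h1]; simp), mul_zero, sub_zero]
    norm_cast
    ring

lemma tau_short {c : ℝ} (hinv : D.TauInv c τ) {ν : V} (hν : ∃ w ∈ D.W0, w D.hshort = ν) (r : ℤ) :
    τ (ν, r) = D.tauZero τ := by
  obtain ⟨w, hw, rfl⟩ := hν
  rw [D.tau_W0 hinv hw D.hshort_memR, D.tau_shift hinv D.hshort_memR, tauZero, D.tau_neg hinv D.hshort_memR]

lemma EE_simple {c : ℝ} (hpos : ∀ a : V × ℤ, D.IsAffRoot a → 0 < τ a ∧ τ a < 1) (hinv : D.TauInv c τ)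
    (j : Fin (D.n + 1)) (hj : ∃ w ∈ D.W0, w D.hshort = (D.aSimple j).1) :
    D.EE τ (D.aSimple j) = D.tauZero τ ^ 2 := by
  revert hj
  refine Fin.cases ?_ (fun i => ?_) j
  · intro _
    rw [aSimple_zero, EE]; dsimp only
    have h := etau_add hpos (D.P_root (D.neg_mem D.hshort_memR)) (D.P_root D.hshort_memR)
    rw [neg_add_cancel, etau_zero] at h
    rw [zpow_one, hvee]
    linear_combination (-(D.tauZero τ ^ 2)) * h
  · rw [aSimple_succ]
    intro hj
    have hR := D.simple_mem i
    have h := etau_add hpos (D.P_root (D.neg_mem hR)) (D.P_root hR)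
    rw [neg_add_cancel, etau_zero] at h
    have h2 := etau_refl hpos hinv (D.P_root hR) i 2 (by rw [inner_coroot_self (D.simple_ne i)]; norm_num)
    rw [rf_self (D.simple_ne i)] at h2
    have h3 := tau_short hinv hj 0
    have hp := (hpos (D.simpleRoot i, 0) hR).1
    rw [EE, zpow_zero, mul_one, ← h3]
    dsimp only at h3 hj ⊢
    have hq := etau_pos hpos (D.simpleRoot i)
    have h4 : D.etau τ (D.simpleRoot i) ^ 2 = (τ (D.simpleRoot i, 0) ^ 2) ^ 2 := by
      have e : τ (D.simpleRoot i, 0) ^ ((2:ℤ) * 2) = (τ (D.simpleRoot i, 0) ^ 2) ^ 2 := by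
        rw [← pow_mul]; norm_cast
      rw [e] at h2
      rw [sq, ← mul_one ((τ (D.simpleRoot i, 0) ^ 2) ^ 2), h]
      nth_rewrite 1 [h2]
      ring
    exact (pow_left_inj₀ hq.le (by positivity) two_ne_zero).1 h4

end etau

/-! ### behaviour along the chain to the alcove -/

lemma sAff_fix {c : ℝ} {a : V × ℤ} {x : V} (h : aval c a x = 0) : sAff c a x = x := by
  rw [sAff, h, zero_smul, sub_zero]

section chain
variable {c : ℝ} {wmin : V → Equiv.Perm V}

lemma NS_step_mem (hc : 0 < c) {j : Fin (D.n + 1)} {x : V} (hj : aval c (D.aSimple j) x < 0)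
    {b : V × ℤ} (hb : b ∈ D.NS c (sAff c (D.aSimple j) x)) :
    ract (D.aSimple j) b ∈ D.NS c x ∧ ract (D.aSimple j) b ≠ D.aSimple j ∧
      aval c (ract (D.aSimple j) b) x = aval c b (sAff c (D.aSimple j) x) ∧
      ∀ y, aval c (ract (D.aSimple j) b) y = aval c b (sAff c (D.aSimple j) y) := by
  have hm : ∀ y, aval c (ract (D.aSimple j) b) y = aval c b (sAff c (D.aSimple j) y) :=
    fun y => D.aval_ract c (D.aSimple_mem j) hb.1.1 y
  refine ⟨?_, ?_, hm x, hm⟩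
  · rw [D.NS_step hc hj]; exact Set.mem_insert_of_mem _ ⟨b, hb, rfl⟩
  · intro h
    exact D.NS_step_notMem hc j (sAff c (D.aSimple j) x) ⟨b, hb, h⟩

lemma aSimple_NS {j : Fin (D.n + 1)} {x : V} (hj : aval c (D.aSimple j) x < 0) :
    D.aSimple j ∈ D.NS c x := ⟨D.aSimple_pos j, hj⟩

lemma wmin_fix (hc : 0 < c) (hw : D.IsWmin c wmin) (lam : V) :
    ∀ x, (∀ b ∈ D.NS c x, aval c b lam = 0) → wmin x lam = lam := by
  apply D.wind hc (Q := fun x => (∀ b ∈ D.NS c x, aval c b lam = 0) → wmin x lam = lam)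
  · intro x hx _
    rw [D.wmin_alcove hc hw hx]; rfl
  · intro x j hj ih h
    have h0 := sAff_fix (h _ (aSimple_NS hj))
    rw [D.wmin_step hc hw hj]
    show wmin (sAff c (D.aSimple j) x) (sAff c (D.aSimple j) lam) = lam
    rw [h0]
    apply ih
    intro b hb
    obtain ⟨h1, _, _, h3⟩ := NS_step_mem hc hj hb
    rw [← h _ h1, h3, h0]

lemma wmin_step_apply (hc : 0 < c) (hw : D.IsWmin c wmin) {x : V} {j : Fin (D.n + 1)}
    (hj : aval c (D.aSimple j) x < 0) : wmin x x = wmin (sAff c (D.aSimple j) x) (sAff c (D.aSimple j) x) := by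
  rw [D.wmin_step hc hw hj]; rfl

variable {τ : V × ℤ → ℝ} {μ ξ : V}

lemma Stp.rel1 (S : D.Stp c τ μ ξ)
    {W0fin : Finset (Equiv.Perm V)} (hW : ∀ w : Equiv.Perm V, w ∈ W0fin ↔ w ∈ D.W0)
    (j : Fin (D.n + 1)) (x : V) (hx : aval c (D.aSimple j) x = -1) :
    PhiFun D τ W0fin ξ x = ((τ (D.aSimple j) ^ 2 : ℝ) : ℂ) * PhiFun D τ W0fin ξ (sAff c (D.aSimple j) x) := by
  have := S.rel hW j x 0 (by rw [hx]; simp)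
  rw [this, sAff, hx, Finset.range_zero, Finset.sum_empty, mul_zero, add_zero]
  congr 2
  push_cast; module

lemma Stp.rel2 (S : D.Stp c τ μ ξ)
    {W0fin : Finset (Equiv.Perm V)} (hW : ∀ w : Equiv.Perm V, w ∈ W0fin ↔ w ∈ D.W0)
    (j : Fin (D.n + 1)) (x : V) (hx : aval c (D.aSimple j) x = -2) :
    PhiFun D τ W0fin ξ x = ((τ (D.aSimple j) ^ 2 : ℝ) : ℂ) * PhiFun D τ W0fin ξ (sAff c (D.aSimple j) x)
      + (((τ (D.aSimple j) ^ 2 : ℝ) : ℂ) - 1) * PhiFun D τ W0fin ξ (x + (D.aSimple j).1) := by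
  have := S.rel hW j x 1 (by rw [hx]; norm_num)
  rw [this, sAff, hx, Finset.sum_range_one]
  congr 3
  · push_cast; module
  · push_cast; module

lemma Stp.claim1 (S : D.Stp c τ μ ξ)
    {W0fin : Finset (Equiv.Perm V)} (hW : ∀ w : Equiv.Perm V, w ∈ W0fin ↔ w ∈ D.W0)
    (hw : D.IsWmin c wmin) :
    ∀ x, (∀ b ∈ D.NS c x, aval c b x = -1) →
      PhiFun D τ W0fin ξ x = ((D.TT c τ x ^ 2 : ℝ) : ℂ) * PhiFun D τ W0fin ξ (wmin x x) := by
  apply D.wind S.hc (Q := fun x => (∀ b ∈ D.NS c x, aval c b x = -1) →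
      PhiFun D τ W0fin ξ x = ((D.TT c τ x ^ 2 : ℝ) : ℂ) * PhiFun D τ W0fin ξ (wmin x x))
  · intro x hx _
    rw [D.wmin_alcove S.hc hw hx, D.TT_alcove hx]; simp
  · intro x j hj ih h
    rw [wmin_step_apply S.hc hw hj, D.TT_step S.hc S.hinv hj, S.rel1 hW j x (h _ (aSimple_NS hj)), ih]
    · push_cast; ring
    · intro b hb
      obtain ⟨h1, _, h2, _⟩ := NS_step_mem S.hc hj hb
      rw [← h2, h _ h1]

end chain

/-! ### the local structure near a weight -/

/-- Weights of (quasi-)minuscule type. -/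
structure Good (D : RootSystemData V) (ν : V) : Prop where
  mem : ν ∈ D.weightLattice
  small : ∀ β ∈ D.R0, |⟪ν, coroot β⟫| ≤ 1 ∨ β = ν ∨ β = -ν
  short : ν ∈ D.R0 → ∃ w ∈ D.W0, w D.hshort = ν

lemma aval_int {cz : ℤ} {x : V} (hx : x ∈ D.weightLattice) {b : V × ℤ} (hb : b.1 ∈ D.R0) :
    ∃ k : ℤ, aval (cz : ℝ) b x = k := by
  obtain ⟨k, hk⟩ := hx _ hb
  exact ⟨k + b.2 * cz, by rw [aval, hk]; push_cast; ring⟩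

section loc
variable {cz : ℤ} {lam ν : V}

lemma loc (hlam : lam ∈ Pc D (cz : ℝ)) (hν : D.Good ν) {b : V × ℤ}
    (hb : b ∈ D.NS (cz : ℝ) (lam - ν)) :
    (aval cz b lam = 0 ∧ aval cz b (lam - ν) = -1 ∧ ⟪ν, coroot b.1⟫ = 1) ∨
    (b.1 = ν ∧ aval cz b lam = 0 ∧ aval cz b (lam - ν) = -2) ∨
    (b.1 = ν ∧ aval cz b lam = 1 ∧ aval cz b (lam - ν) = -1) := by
  have hR := hb.1.1
  have e : aval cz b (lam - ν) = aval cz b lam - ⟪ν, coroot b.1⟫ := by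
    simp only [aval, inner_sub_left]; ring
  have h0 := hlam.2 b hb.1
  have hlt : aval cz b (lam - ν) < 0 := hb.2
  obtain ⟨k, hk⟩ := aval_int (cz := cz) hlam.1 hR
  obtain ⟨l, hl⟩ := hν.mem _ hR
  rw [e, hl, hk] at hlt ⊢
  rw [hk] at h0
  have h0' : 0 ≤ k := by exact_mod_cast h0
  have hlt' : k - l < 0 := by exact_mod_cast hlt
  rcases hν.small _ hR with h | h | h
  · rw [hl] at h
    have : |l| ≤ 1 := by exact_mod_cast h
    have := (abs_le.1 this).2
    left
    have hk0 : k = 0 := by omega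
    have hl1 : l = 1 := by omega
    rw [hk0, hl1]; norm_num
  · have h2 : l = 2 := by
      rw [← h, inner_coroot_self (D.ne_zero _ hR)] at hl
      exact_mod_cast hl.symm
    right
    have : k = 0 ∨ k = 1 := by omega
    rcases this with h3 | h3
    · left; rw [h3, h2]; exact ⟨h, by norm_num, by norm_num⟩
    · right; rw [h3, h2]; exact ⟨h, by norm_num, by norm_num⟩
  · have h2 : l = -2 := by
      have hn : ν = -b.1 := by rw [h, neg_neg]
      rw [hn, inner_neg_left, inner_coroot_self (D.ne_zero _ hR)] at hl
      exact_mod_cast hl.symm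
    omega

lemma aval_same (hcz : 1 < cz) {x : V} {r s k l : ℤ} (h1 : aval (cz:ℝ) (ν, r) x = k)
    (h2 : aval (cz:ℝ) (ν, s) x = l) (hkl : |k - l| ≤ 1) : r = s ∧ k = l := by
  simp only [aval] at h1 h2
  have h3 : ((r - s) * cz : ℝ) = k - l := by linarith
  have h4 : (r - s) * cz = k - l := by exact_mod_cast h3
  have h5 : r - s = 0 := by
    by_contra h
    have : 1 ≤ |r - s| := Int.one_le_abs h
    rw [← h4, abs_mul, abs_of_pos (by omega : 0 < cz)] at hkl
    nlinarith
  rw [h5, zero_mul] at h4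
  omega

lemma Good_rf (hν : D.Good ν) {α : V} (ha : α ∈ D.R0) : D.Good (rf α ν) := by
  have hs := D.rfPerm_mem ha
  have hz := D.ne_zero _ ha
  refine ⟨D.P_W0 hs hν.mem, ?_, ?_⟩
  · intro β hb
    have hb' := D.rf_mem ha hb
    rcases hν.small _ hb' with h | h | h
    · left; rw [inner_rf_left, ← coroot_rf hz]; exact h
    · right; left; rw [← h, rf_rf hz]
    · right; right; rw [← rf_neg, ← h, rf_rf hz]
  · intro h
    have h2 := D.rf_mem ha h
    rw [rf_rf hz] at h2
    obtain ⟨w, hw, h3⟩ := hν.short h2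
    exact ⟨_, D.W0.mul_mem hs hw, by rw [← h3]; rfl⟩

variable {wmin : V → Equiv.Perm V} {τ : V × ℤ → ℝ} {μ ξ : V}

lemma Stp.claim2 (hcz : 1 < cz) (S : D.Stp cz τ μ ξ)
    {W0fin : Finset (Equiv.Perm V)} (hW : ∀ w : Equiv.Perm V, w ∈ W0fin ↔ w ∈ D.W0)
    (hw : D.IsWmin cz wmin) (hlam : lam ∈ Pc D (cz : ℝ)) :
    ∀ x, ∀ ν r, D.Good ν → x = lam - ν → D.IsAffPos (ν, r) → aval (cz:ℝ) (ν, r) lam = 0 →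
      PhiFun D τ W0fin ξ x = ((D.TT cz τ x ^ 2 : ℝ) : ℂ) * PhiFun D τ W0fin ξ (wmin x x) +
        (((1 - (D.tauZero τ)⁻¹ ^ 2) * D.EE τ (ν, r) : ℝ) : ℂ) * PhiFun D τ W0fin ξ lam := by
  have hc := S.hc
  apply D.wind hc (Q := fun x => ∀ ν r, D.Good ν → x = lam - ν → D.IsAffPos (ν, r) →
    aval (cz:ℝ) (ν, r) lam = 0 →
      PhiFun D τ W0fin ξ x = ((D.TT cz τ x ^ 2 : ℝ) : ℂ) * PhiFun D τ W0fin ξ (wmin x x) +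
        (((1 - (D.tauZero τ)⁻¹ ^ 2) * D.EE τ (ν, r) : ℝ) : ℂ) * PhiFun D τ W0fin ξ lam)
  · intro x hx ν r hν hxe hp h0
    exfalso
    have h := hx _ hp
    have hR : ν ∈ D.R0 := hp.1
    rw [hxe] at h
    have : aval (cz:ℝ) (ν, r) (lam - ν) = aval (cz:ℝ) (ν, r) lam - 2 := by
      simp only [aval, inner_sub_left, inner_coroot_self (D.ne_zero _ hR)]; ring
    rw [this, h0] at h
    norm_num at h
  · intro x j hj ih ν r hν hxe hp h0
    have hR : ν ∈ D.R0 := hp.1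
    have hsh := hν.short hR
    have hN : D.aSimple j ∈ D.NS cz (lam - ν) := hxe ▸ aSimple_NS hj
    have hτ0 : 0 < D.tauZero τ := (S.hpos (-D.hshort, 1) (D.neg_mem D.hshort_memR)).1
    rw [wmin_step_apply hc hw hj, D.TT_step hc S.hinv hj]
    rcases loc hlam hν hN with ⟨h1, h2, h3⟩ | ⟨h1, h2, h3⟩ | ⟨h1, h2, h3⟩
    · rw [← hxe] at h2
      rw [S.rel1 hW j x h2]
      have hs : sAff cz (D.aSimple j) x = lam - rf (D.aSimple j).1 ν := by
        rw [sAff, h2, rf, h3, hxe]; module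
      have hne : (ν, r) ≠ D.aSimple j := by
        intro h
        rw [← h] at h3
        dsimp only at h3
        rw [inner_coroot_self (D.ne_zero _ hR)] at h3
        norm_num at h3
      have hp' : D.IsAffPos (ract (D.aSimple j) (ν, r)) := D.simple_perm hp hne
      have h0' : aval (cz:ℝ) (ract (D.aSimple j) (ν, r)) lam = 0 := by
        rw [D.aval_ract cz (D.aSimple_mem j) hR, sAff_fix h1, h0]
      have := ih (ract (D.aSimple j) (ν, r)).1 (ract (D.aSimple j) (ν, r)).2
        (Good_rf hν (D.aSimple_mem j)) hs hp' h0'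
      rw [this, EE_step S.hpos S.hinv hsh j r h3]
      push_cast
      ring
    · rw [← hxe] at h3
      rw [S.rel2 hW j x h3]
      have hb0 : (ν, r) = D.aSimple j := by
        have h4 : aval (cz:ℝ) (ν, (D.aSimple j).2) lam = ((0:ℤ):ℝ) := by
          rw [← h1, Int.cast_zero]; exact h2
        have := aval_same (k := 0) (l := 0) hcz (by rw [h0]; simp) h4 (by simp)
        rw [this.1, ← h1]
      have hxl : x + (D.aSimple j).1 = lam := by rw [h1, hxe]; abel
      have hall : ∀ b ∈ D.NS cz (sAff cz (D.aSimple j) x), aval cz b (sAff cz (D.aSimple j) x) = -1 := by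
        intro b hb
        obtain ⟨g1, g2, g3, g4⟩ := NS_step_mem hc hj hb
        rw [← g3]
        have g1' := g1
        rw [hxe] at g1'
        rcases loc hlam hν g1' with h | h | h
        · rw [hxe]; exact h.2.1
        · exfalso
          apply g2
          have h4 : aval (cz:ℝ) (ν, (ract (D.aSimple j) b).2) lam = ((0:ℤ):ℝ) := by
            rw [← h.1, Int.cast_zero]; exact h.2.1
          have := aval_same (k := 0) (l := 0) hcz (by rw [h0]; simp) h4 (by simp)
          exact (Prod.ext h.1 this.1.symm : ract (D.aSimple j) b = (ν, r)).trans hb0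
        · rw [hxe]; exact h.2.2
      rw [S.claim1 hW hw _ hall, hxl, hb0, EE_simple S.hpos S.hinv j (h1 ▸ hsh)]
      have ht : τ (D.aSimple j) = D.tauZero τ := by rw [← hb0]; exact tau_short S.hinv hsh r
      rw [ht]
      have : (1 - (D.tauZero τ)⁻¹ ^ 2) * D.tauZero τ ^ 2 = D.tauZero τ ^ 2 - 1 := by
        field_simp
      rw [this]
      push_cast; ring
    · exfalso
      have h4 : aval (cz:ℝ) (ν, (D.aSimple j).2) lam = ((1:ℤ):ℝ) := by
        rw [← h1, Int.cast_one]; exact h2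
      have := aval_same (k := 0) (l := 1) hcz (by rw [h0]; simp) h4 (by simp)
      omega

/-- The local formula for each summand. -/
lemma Stp.summand (hcz : 1 < cz) (S : D.Stp cz τ μ ξ)
    {W0fin : Finset (Equiv.Perm V)} (hW : ∀ w : Equiv.Perm V, w ∈ W0fin ↔ w ∈ D.W0)
    (hw : D.IsWmin cz wmin) (hlam : lam ∈ Pc D (cz : ℝ)) (hν : D.Good ν) :
    (wmin (lam - ν) (lam - ν) = lam ∨ wmin (lam - ν) lam = lam) ∧
    PhiFun D τ W0fin ξ (lam - ν) =
      ((D.tauw cz τ (wmin (lam - ν)) ^ 2 : ℝ) : ℂ) * PhiFun D τ W0fin ξ (wmin (lam - ν) (lam - ν)) +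
        (((1 - (D.tauZero τ)⁻¹ ^ 2) * (if wmin (lam - ν) lam = lam then D.ccoef cz τ wmin lam ν else 0) : ℝ) : ℂ)
          * PhiFun D τ W0fin ξ lam := by
  have hc := S.hc
  rw [D.tauw_wmin hc hw]
  have hth : D.theta cz wmin (lam - ν) = {b : V × ℤ | b ∈ D.NS cz (lam - ν) ∧ aval cz b (lam - ν) = -2}.ncard := by
    rw [theta, D.RW_wmin hc hw]
  by_cases hA : ∃ r, D.IsAffPos (ν, r) ∧ aval (cz:ℝ) (ν, r) lam = 1
  · obtain ⟨r, hp, h1⟩ := hA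
    have hR : ν ∈ D.R0 := hp.1
    have hs : lam - ν = sAff cz (ν, r) lam := by rw [sAff, h1, one_smul]
    have hplus : wmin (lam - ν) (lam - ν) = lam := by
      obtain ⟨w1, w2, _⟩ := hw (lam - ν)
      have hm : wmin (lam - ν) * D.sPerm cz (a := (ν, r)) hR ∈ D.WR cz := (D.WR cz).mul_mem w1 (D.sPerm_mem cz hR)
      have e : (wmin (lam - ν) * D.sPerm cz (a := (ν, r)) hR) lam = wmin (lam - ν) (lam - ν) := by
        rw [hs]; rfl
      rw [← e]
      exact D.alcove_unique hc hw hm hlam.2 (by rw [e]; exact w2)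
    have hno : ∀ b ∈ D.NS cz (lam - ν), aval (cz:ℝ) b (lam - ν) = -1 := by
      intro b hb
      rcases loc hlam hν hb with h | h | h
      · exact h.2.1
      · exfalso
        have h4 : aval (cz:ℝ) (ν, b.2) lam = ((0:ℤ):ℝ) := by
          rw [← h.1, Int.cast_zero]; exact h.2.1
        have := aval_same (k := 1) (l := 0) hcz (by rw [h1]; simp) h4 (by simp)
        omega
      · exact h.2.2
    have hth0 : D.theta cz wmin (lam - ν) = 0 := by
      rw [hth]
      convert Set.ncard_empty (V × ℤ)
      ext b
      simp only [Set.mem_ofPred_eq, Set.mem_empty_iff_false, iff_false, not_and]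
      intro hb h2
      rw [hno b hb] at h2; norm_num at h2
    refine ⟨Or.inl hplus, ?_⟩
    have hcc : D.ccoef cz τ wmin lam ν = 0 := by rw [ccoef, hth0]; simp
    rw [hcc, S.claim1 hW hw _ hno]
    simp
  · have hfix : wmin (lam - ν) lam = lam := by
      apply wmin_fix hc hw
      intro b hb
      rcases loc hlam hν hb with h | h | h
      · exact h.1
      · exact h.2.1
      · exfalso; exact hA ⟨b.2, by rw [← h.1]; exact hb.1, by rw [← h.1]; exact h.2.1⟩
    refine ⟨Or.inr hfix, ?_⟩
    rw [if_pos hfix]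
    by_cases hB : ∃ r, D.IsAffPos (ν, r) ∧ aval (cz:ℝ) (ν, r) lam = 0
    · obtain ⟨r, hp, h0⟩ := hB
      have hR : ν ∈ D.R0 := hp.1
      rw [S.claim2 hcz hW hw hlam _ ν r hν rfl hp h0]
      congr 4
      have hth1 : D.theta cz wmin (lam - ν) = 1 := by
        rw [hth, Set.ncard_eq_one]
        refine ⟨(ν, r), ?_⟩
        ext b
        simp only [Set.mem_ofPred_eq, Set.mem_singleton_iff]
        constructor
        · rintro ⟨hb, h2⟩
          rcases loc hlam hν hb with h | h | h
          · rw [h.2.1] at h2; norm_num at h2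
          · have h4 : aval (cz:ℝ) (ν, b.2) lam = ((0:ℤ):ℝ) := by
              rw [← h.1, Int.cast_zero]; exact h.2.1
            have := aval_same (k := 0) (l := 0) hcz (by rw [h0]; simp) h4 (by simp)
            exact Prod.ext h.1 this.1.symm
          · rw [h.2.2] at h2; norm_num at h2
        · rintro rfl
          have : aval (cz:ℝ) (ν, r) (lam - ν) = -2 := by
            have : aval (cz:ℝ) (ν, r) (lam - ν) = aval (cz:ℝ) (ν, r) lam - 2 := by
              simp only [aval, inner_sub_left, inner_coroot_self (D.ne_zero _ hR)]; ring
            rw [this, h0]; norm_num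
          exact ⟨⟨hp, by rw [this]; norm_num⟩, this⟩
      have hr : -sgnZ ⟪lam, coroot ν⟫ = r := by
        have h0' : ⟪lam, coroot ν⟫ = -(r * cz : ℝ) := by
          simp only [aval] at h0; linarith
        have hr0 : 0 ≤ r := by
          rcases hp.2 with h | h
          · dsimp only at h; omega
          · have := h.1; dsimp only at this; omega
        have hr1 : r ≤ 1 := by
          have := hlam.2 (ν, 1) ⟨hR, Or.inl le_rfl⟩
          simp only [aval, Int.cast_one, one_mul] at this
          rw [h0'] at this
          have h6 : (r:ℝ) ≤ 1 := by nlinarith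
          exact_mod_cast h6
        have : r = 0 ∨ r = 1 := by omega
        rcases this with h | h
        · rw [h0', h]; simp [sgnZ]
        · rw [h0', h]
          have h1 : ¬ (0:ℝ) < -(((1:ℤ):ℝ) * cz) := by push_cast; linarith
          have h2 : -(((1:ℤ):ℝ) * cz) < 0 := by push_cast; linarith
          rw [sgnZ, if_neg h1, if_pos h2]; norm_num
      rw [ccoef, hth1, hr, EE]; simp
    · have hno : ∀ b ∈ D.NS cz (lam - ν), aval (cz:ℝ) b (lam - ν) = -1 := by
        intro b hb
        rcases loc hlam hν hb with h | h | h
        · exact h.2.1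
        · exfalso; exact hB ⟨b.2, by rw [← h.1]; exact hb.1, by rw [← h.1]; exact h.2.1⟩
        · exact h.2.2
      have hth0 : D.theta cz wmin (lam - ν) = 0 := by
        rw [hth]
        convert Set.ncard_empty (V × ℤ)
        ext b
        simp only [Set.mem_ofPred_eq, Set.mem_empty_iff_false, iff_false, not_and]
        intro hb h2
        rw [hno b hb] at h2; norm_num at h2
      have hcc : D.ccoef cz τ wmin lam ν = 0 := by rw [ccoef, hth0]; simp
      rw [hcc, S.claim1 hW hw _ hno]
      simp

end loc

end RootSystemData


namespace RootSystemData

variable {V : Type*} [NormedAddCommGroup V] [InnerProductSpace ℝ V]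
variable {D : RootSystemData V}

/-! ### assembling the eigenvalue equation -/

lemma W0_norm {w : Equiv.Perm V} (hw : w ∈ D.W0) (x : V) : ‖w x‖ = ‖x‖ := by
  have h := W0_inner hw x x
  rw [real_inner_self_eq_norm_sq, real_inner_self_eq_norm_sq] at h
  exact (sq_eq_sq₀ (norm_nonneg _) (norm_nonneg _)).1 h

lemma Good_min {ω : V} (h : D.IsMinuscule ω) {w : Equiv.Perm V} (hw : w ∈ D.W0) : D.Good (w ω) := by
  obtain ⟨h1, h2, h3, h4⟩ := h
  have key : ∀ β ∈ D.R0, |⟪ω, coroot β⟫| ≤ 1 := by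
    intro β hb
    rcases D.pos_or_neg β hb with h | h
    · exact abs_le.2 ⟨by linarith [h2 β h], h4 β h⟩
    · have a := h2 _ h
      have b := h4 _ h
      rw [coroot_neg, inner_neg_right] at a b
      exact abs_le.2 ⟨by linarith, by linarith⟩
  have key2 : ∀ β ∈ D.R0, |⟪w ω, coroot β⟫| ≤ 1 := by
    intro β hb
    rw [W0_inner' hw, ← W0_coroot (W0_inv hw)]
    exact key _ (W0_mem (W0_inv hw) hb)
  refine ⟨D.P_W0 hw h1, fun β hb => Or.inl (key2 β hb), fun hR => ?_⟩
  have := key2 _ hR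
  rw [inner_coroot_self (D.ne_zero _ hR)] at this
  norm_num at this

lemma Good_short {w : Equiv.Perm V} (hw : w ∈ D.W0) : D.Good (w D.hshort) := by
  have hR := W0_mem hw D.hshort_memR
  refine ⟨D.P_root hR, fun β hb => ?_, fun _ => ⟨w, hw, rfl⟩⟩
  obtain ⟨k, hk, h⟩ := D.short_cartan (by rw [W0_norm hw]; exact D.hshort_short β hb) hR hb
  rcases h with h | h | h
  · left
    rw [hk, abs_le]
    constructor
    · exact_mod_cast h.1
    · exact_mod_cast h.2
  · exact Or.inr (Or.inl h.2)
  · exact Or.inr (Or.inr h.2)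

lemma orb_sum {ω ξ : V} {τ : V × ℤ → ℝ} {orb : Finset V} (ho : ∀ ν : V, ν ∈ orb ↔ ∃ w ∈ D.W0, w ω = ν)
    {W0fin : Finset (Equiv.Perm V)} (hW : ∀ w : Equiv.Perm V, w ∈ W0fin ↔ w ∈ D.W0) (lam : V) :
    ∑ ν ∈ orb, PhiFun D τ W0fin ξ (lam - ν) =
      (∑ ν ∈ orb, Complex.exp (-(Complex.I * (⟪ν, ξ⟫ : ℝ)))) * PhiFun D τ W0fin ξ lam := by
  unfold PhiFun
  rw [Finset.sum_comm, Finset.mul_sum]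
  apply Finset.sum_congr rfl
  intro w hw
  rw [hW] at hw
  have h1 : ∑ ν ∈ orb, Complex.exp (-(Complex.I * (⟪ν, ξ⟫ : ℝ))) =
      ∑ ν ∈ orb, Complex.exp (-(Complex.I * (⟪w ξ, ν⟫ : ℝ))) := by
    refine Finset.sum_bij' (fun ν _ => w ν) (fun ν _ => (w⁻¹ : Equiv.Perm V) ν) ?_ ?_ ?_ ?_ ?_
    · intro ν hν
      rw [ho] at hν ⊢
      obtain ⟨u, hu, rfl⟩ := hν
      exact ⟨w * u, D.W0.mul_mem hw hu, rfl⟩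
    · intro ν hν
      rw [ho] at hν ⊢
      obtain ⟨u, hu, rfl⟩ := hν
      exact ⟨w⁻¹ * u, D.W0.mul_mem (W0_inv hw) hu, rfl⟩
    · intro ν _; exact w.symm_apply_apply ν
    · intro ν _; exact w.apply_symm_apply ν
    · intro ν _
      rw [W0_inner hw, real_inner_comm ν ξ]
  rw [h1, Finset.sum_mul]
  apply Finset.sum_congr rfl
  intro ν _
  have : Complex.exp (Complex.I * (⟪w ξ, lam - ν⟫ : ℝ)) =
      Complex.exp (-(Complex.I * (⟪w ξ, ν⟫ : ℝ))) * Complex.exp (Complex.I * (⟪w ξ, lam⟫ : ℝ)) := by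
    rw [← Complex.exp_add, inner_sub_right]
    congr 1
    push_cast; ring
  rw [this]; ring

lemma WR_diff {c : ℝ} {w : Equiv.Perm V} (hw : w ∈ D.WR c) {lam : V} (hl : w lam = lam) :
    ∃ u ∈ D.W0, ∀ ν, w (lam - ν) = lam - u ν := by
  obtain ⟨u, hu, η, _, h⟩ := D.WR_decomp c hw
  refine ⟨u, hu, fun ν => ?_⟩
  have h1 := h lam
  rw [hl] at h1
  rw [h, W0_sub hu]
  conv_rhs => rw [h1]
  abel

lemma partB {cz : ℤ} (hcz : 1 < cz) {τ : V × ℤ → ℝ} {μ ξ : V} (S : D.Stp (cz : ℝ) τ μ ξ)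
    {W0fin : Finset (Equiv.Perm V)} (hW : ∀ w : Equiv.Perm V, w ∈ W0fin ↔ w ∈ D.W0)
    {wmin : V → Equiv.Perm V} (hw : D.IsWmin (cz : ℝ) wmin)
    {ω : V} (hω : D.IsMinuscule ω ∨ D.IsQuasiMinuscule ω)
    {orb : Finset V} (ho : ∀ ν : V, ν ∈ orb ↔ ∃ w ∈ D.W0, w ω = ν)
    {lam : V} (hlam : lam ∈ Pc D (cz : ℝ)) {Orb : V → Finset V}
    (hO : ∀ ν μ' : V, μ' ∈ Orb ν ↔ ∃ w ∈ D.WR (cz : ℝ), w lam = lam ∧ w (lam - ν) = μ') :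
    (((∑ ν ∈ orb.filter fun ν => (wmin (lam - ν)) (lam - ν) = lam,
              D.tauw (cz : ℝ) τ (wmin (lam - ν)) ^ 2)
            + (1 - (D.tauZero τ)⁻¹ ^ 2) *
              ∑ ν ∈ orb.filter fun ν => (wmin (lam - ν)) lam = lam,
                D.ccoef (cz : ℝ) τ wmin lam ν : ℝ) : ℂ)
            * PhiFun D τ W0fin ξ lam
          + ∑ ν ∈ orb.filter fun ν => lam - ν ∈ Pc D (cz : ℝ),
              ((∑ μ' ∈ Orb ν, D.tauw (cz : ℝ) τ (wmin μ') ^ 2 : ℝ) : ℂ)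
                * PhiFun D τ W0fin ξ (lam - ν)
          = (∑ ν ∈ orb, Complex.exp (-(Complex.I * (⟪ν, ξ⟫ : ℝ))))
              * PhiFun D τ W0fin ξ lam := by
  have hc : (0:ℝ) < cz := S.hc
  have hgood : ∀ ν ∈ orb, D.Good ν := by
    intro ν hν
    obtain ⟨w, hw, rfl⟩ := (ho ν).1 hν
    rcases hω with h | h
    · exact Good_min h hw
    · have h' : ω = D.hshort := h
      rw [h']; exact Good_short hw
  have hne : ∀ ν ∈ orb, ν ≠ 0 := by
    intro ν hν h0
    obtain ⟨w, hw, rfl⟩ := (ho ν).1 hν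
    have : ω = 0 := by
      apply w.injective; rw [h0, W0_zero hw]
    rcases hω with h | h
    · exact h.2.2.1 this
    · have h' : ω = D.hshort := h
      exact D.ne_zero _ D.hshort_memR (h'.symm.trans this)
  have horb : ∀ ν ∈ orb, ∀ u ∈ D.W0, u ν ∈ orb := by
    intro ν hν u hu
    rw [ho] at hν ⊢
    obtain ⟨w, hw, rfl⟩ := hν
    exact ⟨u * w, D.W0.mul_mem hu hw, rfl⟩
  rw [← orb_sum ho hW lam]
  have e1 : ∑ ν ∈ orb, PhiFun D τ W0fin ξ (lam - ν) = ∑ ν ∈ orb,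
      (((D.tauw (cz:ℝ) τ (wmin (lam - ν)) ^ 2 : ℝ) : ℂ) * PhiFun D τ W0fin ξ (wmin (lam - ν) (lam - ν)) +
      (((1 - (D.tauZero τ)⁻¹ ^ 2) *
        (if wmin (lam - ν) lam = lam then D.ccoef (cz:ℝ) τ wmin lam ν else 0) : ℝ) : ℂ) *
        PhiFun D τ W0fin ξ lam) := by
    apply Finset.sum_congr rfl
    intro ν hν
    exact (S.summand hcz hW hw hlam (hgood ν hν)).2
  rw [e1, Finset.sum_add_distrib, ← Finset.sum_mul, ← Complex.ofReal_sum, ← Finset.mul_sum,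
    ← Finset.sum_filter]
  rw [← Finset.sum_filter_add_sum_filter_not orb (fun ν => wmin (lam - ν) (lam - ν) = lam)
    (fun ν => ((D.tauw (cz:ℝ) τ (wmin (lam - ν)) ^ 2 : ℝ) : ℂ) *
      PhiFun D τ W0fin ξ (wmin (lam - ν) (lam - ν)))]
  have e2 : ∑ ν ∈ orb.filter (fun ν => wmin (lam - ν) (lam - ν) = lam),
      ((D.tauw (cz:ℝ) τ (wmin (lam - ν)) ^ 2 : ℝ) : ℂ) * PhiFun D τ W0fin ξ (wmin (lam - ν) (lam - ν))
      = ((∑ ν ∈ orb.filter (fun ν => wmin (lam - ν) (lam - ν) = lam),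
          D.tauw (cz:ℝ) τ (wmin (lam - ν)) ^ 2 : ℝ) : ℂ) * PhiFun D τ W0fin ξ lam := by
    rw [Complex.ofReal_sum, Finset.sum_mul]
    apply Finset.sum_congr rfl
    intro ν hν
    rw [(Finset.mem_filter.1 hν).2]
  have e3 : ∑ ν ∈ orb.filter (fun ν => ¬ wmin (lam - ν) (lam - ν) = lam),
      ((D.tauw (cz:ℝ) τ (wmin (lam - ν)) ^ 2 : ℝ) : ℂ) * PhiFun D τ W0fin ξ (wmin (lam - ν) (lam - ν))
      = ∑ ν ∈ orb.filter fun ν => lam - ν ∈ Pc D (cz : ℝ),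
              ((∑ μ' ∈ Orb ν, D.tauw (cz : ℝ) τ (wmin μ') ^ 2 : ℝ) : ℂ)
                * PhiFun D τ W0fin ξ (lam - ν) := by
    have e4 : ∀ ν, ((∑ μ' ∈ Orb ν, D.tauw (cz : ℝ) τ (wmin μ') ^ 2 : ℝ) : ℂ)
                * PhiFun D τ W0fin ξ (lam - ν) =
        ∑ μ' ∈ Orb ν, ((D.tauw (cz : ℝ) τ (wmin μ') ^ 2 : ℝ) : ℂ) * PhiFun D τ W0fin ξ (lam - ν) := by
      intro ν; rw [Complex.ofReal_sum, Finset.sum_mul]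
    simp_rw [e4]
    rw [Finset.sum_sigma']
    refine Finset.sum_bij' (fun ν _ => (⟨lam - wmin (lam - ν) (lam - ν), lam - ν⟩ : (_ : V) × V))
      (fun p _ => lam - p.2) ?_ ?_ ?_ ?_ ?_
    · intro ν hν
      obtain ⟨h1, h2⟩ := Finset.mem_filter.1 hν
      have hfix := (S.summand hcz hW hw hlam (hgood ν h1)).1.resolve_left h2
      obtain ⟨u, hu, hu2⟩ := WR_diff (hw (lam - ν)).1 hfix
      have h3 := hu2 ν
      have h4 : lam - wmin (lam - ν) (lam - ν) = u ν := by rw [h3]; abel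
      simp only [Finset.mem_sigma, Finset.mem_filter]
      refine ⟨⟨h4 ▸ horb ν h1 u hu, ?_⟩, ?_⟩
      · rw [sub_sub_cancel]
        exact ⟨D.WR_P (hw (lam - ν)).1 (D.P_sub hlam.1 (hgood ν h1).mem), (hw (lam - ν)).2.1⟩
      · rw [hO]
        refine ⟨(wmin (lam - ν))⁻¹, (D.WR _).inv_mem (hw (lam - ν)).1, ?_, ?_⟩
        · exact (Equiv.symm_apply_eq _).2 hfix.symm
        · rw [sub_sub_cancel]
          exact (wmin (lam - ν)).symm_apply_apply _
    · rintro ⟨ν', μ'⟩ h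
      simp only [Finset.mem_sigma, Finset.mem_filter] at h ⊢
      obtain ⟨⟨h1, h2⟩, h3⟩ := h
      obtain ⟨w, hwR, hl, h4⟩ := (hO _ _).1 h3
      obtain ⟨u, hu, hu2⟩ := WR_diff hwR hl
      rw [hu2] at h4
      refine ⟨?_, ?_⟩
      · rw [← h4, sub_sub_cancel]; exact horb _ h1 u hu
      · rw [sub_sub_cancel]
        intro h5
        have h6 : (wmin μ' * w) (lam - ν') = lam := by
          rw [Equiv.Perm.mul_apply, hu2, h4, h5]
        have h7 := D.alcove_unique hc hw ((D.WR _).mul_mem (hw μ').1 hwR) h2.2 (h6.symm ▸ hlam.2)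
        rw [h6] at h7
        apply hne _ h1
        have : lam - ν' = lam := h7.symm
        exact sub_eq_self.1 this
    · intro ν _; simp
    · rintro ⟨ν', μ'⟩ h
      simp only [Finset.mem_sigma, Finset.mem_filter] at h
      obtain ⟨⟨h1, h2⟩, h3⟩ := h
      obtain ⟨w, hwR, hl, h4⟩ := (hO _ _).1 h3
      have h6 : (wmin μ' * w) (lam - ν') = wmin μ' μ' := by
        rw [Equiv.Perm.mul_apply, h4]
      have h7 := D.alcove_unique hc hw ((D.WR _).mul_mem (hw μ').1 hwR) h2.2 (h6.symm ▸ (hw μ').2.1)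
      rw [h6] at h7
      simp [h7]
    · intro ν _
      simp
  rw [e2, e3]
  push_cast
  ring

end RootSystemData


section dedekind
variable {V : Type*} [NormedAddCommGroup V] [InnerProductSpace ℝ V]

/-- The character of a lattice attached to a vector. -/
def latChar (L : AddSubgroup V) (z : V) : Multiplicative L →* ℂ where
  toFun x := Complex.exp (Complex.I * (⟪z, ((Multiplicative.toAdd x : L) : V)⟫ : ℝ))
  map_one' := by simp
  map_mul' x y := by
    rw [← Complex.exp_add, toAdd_mul, AddSubgroup.coe_add, inner_add_right]
    congr 1
    push_cast; ring

lemma latChar_eq {L : AddSubgroup V} {z z' : V} (h : latChar L z = latChar L z') (x : V) (hx : x ∈ L) :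
    Complex.exp (Complex.I * (⟪z, x⟫ : ℝ)) = Complex.exp (Complex.I * (⟪z', x⟫ : ℝ)) :=
  DFunLike.congr_fun h (Multiplicative.ofAdd (⟨x, hx⟩ : L))

lemma latChar_int {L : AddSubgroup V} {z z' : V} (h : latChar L z = latChar L z') (x : V) (hx : x ∈ L) :
    ∃ k : ℤ, ⟪z - z', x⟫ = k * (2 * Real.pi) := by
  obtain ⟨k, hk⟩ := Complex.exp_eq_exp_iff_exists_int.1 (latChar_eq h x hx)
  refine ⟨k, ?_⟩
  have h1 : (Complex.I * ((⟪z - z', x⟫ : ℝ) : ℂ)) = Complex.I * ((k * (2 * Real.pi) : ℝ) : ℂ) := by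
    rw [inner_sub_left, Complex.ofReal_sub, mul_sub, hk]
    push_cast; ring
  exact_mod_cast mul_left_cancel₀ Complex.I_ne_zero h1

lemma dedekind {ι : Type*} (s : Finset ι) (L : AddSubgroup V) (z : ι → V) (a : ι → ℂ)
    (h : ∀ x ∈ L, ∑ i ∈ s, a i * Complex.exp (Complex.I * (⟪z i, x⟫ : ℝ)) = 0) (i0 : ι) (h0 : i0 ∈ s) :
    ∑ i ∈ s.filter (fun i => latChar L (z i) = latChar L (z i0)), a i = 0 := by
  have hli := linearIndependent_iff'.1 (linearIndependent_monoidHom (Multiplicative L) ℂ)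
    (s.image fun i => latChar L (z i))
    (fun f => ∑ i ∈ s.filter (fun i => latChar L (z i) = f), a i) ?_ (latChar L (z i0))
    (Finset.mem_image_of_mem _ h0)
  · exact hli
  · funext x
    rw [Finset.sum_apply]
    simp only [Pi.smul_apply, smul_eq_mul, Pi.zero_apply]
    have h1 := h ((Multiplicative.toAdd x : L) : V) (Multiplicative.toAdd x : L).2
    rw [← h1]
    rw [← Finset.sum_fiberwise_of_maps_to (s := s) (t := s.image fun i => latChar L (z i))
      (g := fun i => latChar L (z i)) (fun i hi => Finset.mem_image_of_mem _ hi)]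
    apply Finset.sum_congr rfl
    intro f _
    rw [Finset.sum_mul]
    apply Finset.sum_congr rfl
    intro i hi
    rw [← (Finset.mem_filter.1 hi).2]
    rfl

lemma finite_box {n : ℕ} (v : Fin n → V) (hv : ∀ x y : V, (∀ j, ⟪x, v j⟫ = ⟪y, v j⟫) → x = y)
    (N : ℤ) : {x : V | ∀ j, (∃ k : ℤ, ⟪x, v j⟫ = k) ∧ 0 ≤ ⟪x, v j⟫ ∧ ⟪x, v j⟫ ≤ N}.Finite := by
  apply Set.Finite.of_finite_image (f := fun x => fun j => ⌊⟪x, v j⟫⌋)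
  · apply (Set.finite_Icc (fun _ : Fin n => (0:ℤ)) (fun _ : Fin n => N)).subset
    rintro _ ⟨x, hx, rfl⟩
    refine ⟨fun j => ?_, fun j => ?_⟩
    · exact Int.floor_nonneg.2 (hx j).2.1
    · have := (Int.floor_le ⟪x, v j⟫).trans (hx j).2.2
      exact_mod_cast this
  · intro x hx y hy h
    apply hv
    intro j
    obtain ⟨k, hk⟩ := (hx j).1
    obtain ⟨l, hl⟩ := (hy j).1
    have := congrFun h j
    simp only [hk, hl, Int.floor_intCast] at this
    rw [hk, hl, this]

end dedekind

namespace RootSystemData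

variable {V : Type*} [NormedAddCommGroup V] [InnerProductSpace ℝ V]
variable {D : RootSystemData V}

/-- The weight lattice as a subgroup. -/
def PA (D : RootSystemData V) : AddSubgroup V where
  carrier := D.weightLattice
  zero_mem' := fun α _ => ⟨0, by simp⟩
  add_mem' := fun hx hy => D.P_add hx hy
  neg_mem' := fun {x} hx α ha => by
    obtain ⟨k, hk⟩ := hx α ha
    exact ⟨-k, by rw [inner_neg_left, hk]; push_cast; rfl⟩

/-- The coweight lattice as a subgroup. -/
def PvA (D : RootSystemData V) : AddSubgroup V where
  carrier := D.coweightLattice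
  zero_mem' := fun α _ => ⟨0, by simp⟩
  add_mem' := fun {x y} hx hy α ha => by
    obtain ⟨k, hk⟩ := hx α ha
    obtain ⟨l, hl⟩ := hy α ha
    exact ⟨k + l, by rw [inner_add_left, hk, hl]; push_cast; rfl⟩
  neg_mem' := fun {x} hx α ha => by
    obtain ⟨k, hk⟩ := hx α ha
    exact ⟨-k, by rw [inner_neg_left, hk]; push_cast; rfl⟩

lemma Pc_finite (cz : ℤ) : (Pc D (cz : ℝ)).Finite := by
  apply (finite_box (fun j => coroot (D.simpleRoot j)) (fun x y h => D.ext_simpleCoroot h) cz).subset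
  rintro x ⟨hx, hr⟩ j
  have hR := D.simple_mem j
  refine ⟨hx _ hR, ?_, ?_⟩
  · have := hr (D.simpleRoot j, 0) ⟨hR, Or.inr ⟨rfl, D.simpleRoot_mem j⟩⟩
    simpa [aval] using this
  · have := hr (-D.simpleRoot j, 1) ⟨D.neg_mem hR, Or.inl le_rfl⟩
    simp only [aval, coroot_neg, inner_neg_right, Int.cast_one, one_mul] at this
    linarith

lemma PcVee_finite (cz : ℤ) : (PcVee D (cz : ℝ)).Finite := by
  apply (finite_box D.simpleRoot (fun x y h => D.ext_simple h) cz).subset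
  rintro x ⟨hx, hr⟩ j
  exact ⟨hx _ (D.simple_mem j), hr _ (D.simpleRoot_mem j)⟩

lemma closer {c : ℝ} {a : V × ℤ} (ha : a.1 ≠ 0) {x p : V} {k : ℝ} (hk : 0 < k) (hk2 : k ≤ -aval c a x)
    (hp : 0 < aval c a p) : ‖x + k • a.1 - p‖ < ‖x - p‖ := by
  have h1 : aval c a x - aval c a p = 2 / ⟪a.1, a.1⟫ * ⟪x - p, a.1⟫ := by
    rw [← inner_coroot, inner_sub_left]; simp only [aval]; ring
  have hK := inner_self_pos' ha
  have h2 : ⟪x - p, a.1⟫ = ⟪a.1, a.1⟫ / 2 * (aval c a x - aval c a p) := by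
    rw [h1]; field_simp
  apply lt_of_pow_lt_pow_left₀ 2 (norm_nonneg _)
  have e : x + k • a.1 - p = (x - p) + k • a.1 := by abel
  rw [e, ← real_inner_self_eq_norm_sq, ← real_inner_self_eq_norm_sq, inner_add_add_self, inner_smul_left,
    inner_smul_right, inner_smul_left, inner_smul_right, real_inner_comm (x - p) a.1, h2]
  simp only [conj_trivial]
  have : 0 < k * ⟪a.1, a.1⟫ * (aval c a p - aval c a x - k) := by
    apply mul_pos (mul_pos hk hK); linarith
  nlinarith

section indep
variable {cz : ℤ} {τ : V × ℤ → ℝ} {xi : V → V} {W0fin : Finset (Equiv.Perm V)}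

lemma extend_zero (hcz : 1 < cz) (hW : ∀ w : Equiv.Perm V, w ∈ W0fin ↔ w ∈ D.W0)
    (hS : ∀ μ ∈ PcVee D (cz : ℝ), D.Stp (cz : ℝ) τ μ (xi μ))
    (s : Finset (PcVee D (cz : ℝ))) (g : PcVee D (cz : ℝ) → ℂ)
    (h : ∀ x ∈ Pc D (cz : ℝ), ∑ μ ∈ s, g μ * PhiFun D τ W0fin (xi μ.1) x = 0) :
    ∀ x ∈ D.weightLattice, ∑ μ ∈ s, g μ * PhiFun D τ W0fin (xi μ.1) x = 0 := by
  have hc : (0:ℝ) < cz := by exact_mod_cast (by omega : 0 < cz)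
  apply dist_induct (D.bp cz) (D.P_ball _)
    (Q := fun x => ∑ μ ∈ s, g μ * PhiFun D τ W0fin (xi μ.1) x = 0)
  intro x hx ih
  by_cases hA : x ∈ D.alcove cz
  · exact h x ⟨hx, hA⟩
  obtain ⟨j, hj⟩ := D.exists_simple_neg hc hA
  obtain ⟨m, hm⟩ := aval_int (cz := cz) hx (D.aSimple_mem j)
  have hm0 : m < 0 := by rw [hm] at hj; exact_mod_cast hj
  obtain ⟨n, hn⟩ : ∃ n : ℕ, m = -((n:ℤ) + 1) := ⟨(-m - 1).toNat, by omega⟩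
  have hxn : aval (cz:ℝ) (D.aSimple j) x = -((n:ℝ) + 1) := by rw [hm, hn]; push_cast; ring
  have hp := ((D.affpos_iff hc _).1 (D.aSimple_pos j)).2
  have hy : ∀ k : ℕ, k ≤ n → ∑ μ ∈ s, g μ * PhiFun D τ W0fin (xi μ.1) (x + ((k:ℝ) + 1) • (D.aSimple j).1) = 0 := by
    intro k hk
    apply ih
    · have := D.P_add hx (D.P_zsmul ((k:ℤ) + 1) (D.P_root (D.aSimple_mem j)))
      convert this using 2
      push_cast; rfl
    · apply closer (D.ne_zero _ (D.aSimple_mem j)) (by positivity) _ hp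
      rw [hxn, neg_neg]
      have : (k:ℝ) ≤ n := by exact_mod_cast hk
      linarith
  have e : ∀ μ ∈ s, g μ * PhiFun D τ W0fin (xi μ.1) x =
      ((τ (D.aSimple j) ^ 2 : ℝ) : ℂ) * (g μ * PhiFun D τ W0fin (xi μ.1) (x + ((n:ℝ) + 1) • (D.aSimple j).1)) +
      (((τ (D.aSimple j) ^ 2 : ℝ) : ℂ) - 1) *
        ∑ k ∈ Finset.range n, g μ * PhiFun D τ W0fin (xi μ.1) (x + ((k:ℝ) + 1) • (D.aSimple j).1) := by
    intro μ _
    rw [(hS μ.1 μ.2).rel hW j x n hxn, ← Finset.mul_sum]; ring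
  rw [Finset.sum_congr rfl e, Finset.sum_add_distrib, ← Finset.mul_sum, ← Finset.mul_sum,
    Finset.sum_comm, hy n le_rfl]
  rw [Finset.sum_eq_zero (fun k hk => hy k (Finset.mem_range.1 hk).le)]
  simp

lemma W0_one_of_pos {c : ℝ} (hc : 0 < c) {wmin : V → Equiv.Perm V} (hw : D.IsWmin c wmin)
    {u : Equiv.Perm V} (hu : u ∈ D.W0) (h : ∀ α ∈ D.pos, u α ∈ D.pos) : u = 1 := by
  apply D.eq_one_of_RW hc hw (D.W0_le_WR c hu)
  rw [D.RW_eq hc (D.W0_le_WR c hu), D.NS_empty]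
  intro a ha
  have e : aval c a ((u⁻¹ : Equiv.Perm V) (D.bp c)) = aval c (u a.1, a.2) (D.bp c) := by
    simp only [aval]
    rw [W0_inner' (W0_inv hu), inv_inv, W0_coroot hu]
  rw [e]
  apply D.bp_alcove hc
  exact ⟨W0_mem hu ha.1, ha.2.imp id (fun h' => ⟨h'.1, h _ h'.2⟩)⟩

lemma xi_bound {c : ℝ} {μ ξ : V} (S : D.Stp c τ μ ξ) {α : V} (ha : α ∈ D.R0) :
    |⟪ξ, α⟫| < 2 * Real.pi ∧ (α ∈ D.pos ↔ 0 < ⟪ξ, α⟫) := by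
  have hl : ∀ {β}, β ∈ D.pos → 0 < ⟪ξ, β⟫ := fun hb => D.xi_lower S.hc S.ok S.hμ S.crit hb
  have hu : ∀ {β}, β ∈ D.pos → ⟪ξ, β⟫ < 2 * Real.pi := fun hb => D.xi_upper S.hc S.ok S.hμ S.crit hb
  rcases D.pos_or_neg α ha with h | h
  · exact ⟨by rw [abs_of_pos (hl h)]; exact hu h, fun _ => hl h, fun _ => h⟩
  · have h1 := hl h
    have h2 := hu h
    rw [inner_neg_right] at h1 h2
    refine ⟨abs_lt.2 ⟨by linarith, by linarith⟩, fun h' => absurd h (D.pos_not_both _ h'), fun h' => by linarith⟩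

lemma xi_distinct {c : ℝ} {wmin : V → Equiv.Perm V} (hw : D.IsWmin c wmin) {μ ξ μ' ξ' : V}
    (S : D.Stp c τ μ ξ) (S' : D.Stp c τ μ' ξ') {u : Equiv.Perm V} (hu : u ∈ D.W0)
    (h : latChar D.PA (u ξ') = latChar D.PA ξ) : u = 1 ∧ μ' = μ := by
  have hpi := Real.pi_pos
  have hη : (2 * Real.pi)⁻¹ • (u ξ' - ξ) ∈ D.Qv := by
    apply D.Qv_of_dual
    intro x hx
    obtain ⟨k, hk⟩ := latChar_int h x hx
    refine ⟨k, ?_⟩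
    rw [inner_smul_left, hk]
    simp only [conj_trivial]
    field_simp
  have h0 := D.Qv_small hη (by
    intro α ha
    have h1 := (abs_lt.1 (xi_bound S ha).1)
    have h2 := (abs_lt.1 (xi_bound S' (W0_mem (W0_inv hu) ha)).1)
    rw [inner_smul_left, inner_sub_left, W0_inner' hu]
    simp only [conj_trivial]
    rw [inv_mul_lt_iff₀ (by positivity)]
    linarith)
  have h1 : u ξ' = ξ := by
    rcases smul_eq_zero.1 h0 with h | h
    · exact absurd h (by positivity)
    · exact sub_eq_zero.1 h
  have hu1 : u = 1 := by
    apply W0_one_of_pos S.hc hw hu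
    intro α ha
    have hR := D.pos_mem ha
    rw [(xi_bound S (W0_mem hu hR)).2, ← h1, W0_inner hu]
    exact (xi_bound S' hR).2.1 ha
  refine ⟨hu1, ?_⟩
  rw [hu1] at h1
  have h2 : ξ' = ξ := h1
  have e1 := S.crit
  have e2 := S'.crit
  rw [h2, e1] at e2
  have := smul_right_injective V (by positivity : (2 * Real.pi) ≠ 0) e2
  exact (add_left_cancel this).symm

lemma indepPhi (hcz : 1 < cz) {wmin : V → Equiv.Perm V} (hw : D.IsWmin (cz:ℝ) wmin)
    (hW : ∀ w : Equiv.Perm V, w ∈ W0fin ↔ w ∈ D.W0)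
    (hS : ∀ μ ∈ PcVee D (cz : ℝ), D.Stp (cz : ℝ) τ μ (xi μ)) :
    LinearIndependent ℂ
        (fun (μ : PcVee D (cz : ℝ)) (lam : Pc D (cz : ℝ)) =>
          PhiFun D τ W0fin (xi μ.1) lam.1) := by
  rw [linearIndependent_iff']
  intro s g hg μ0 hμ0
  have h1 := extend_zero hcz hW hS s g (by
    intro x hx
    have := congrFun hg ⟨x, hx⟩
    rw [Finset.sum_apply] at this
    simpa using this)
  have h2 := dedekind (s ×ˢ W0fin) D.PA (fun p => p.2 (xi p.1.1)) (fun p => g p.1 * CfunSq D τ (p.2 (xi p.1.1)))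
    (by
      intro x hx
      rw [← h1 x hx, Finset.sum_product]
      apply Finset.sum_congr rfl
      intro μ _
      rw [PhiFun, Finset.mul_sum]
      apply Finset.sum_congr rfl
      intro w _
      ring) (μ0, 1) (Finset.mem_product.2 ⟨hμ0, (hW 1).2 D.W0.one_mem⟩)
  have h3 : (s ×ˢ W0fin).filter (fun p => latChar D.PA (p.2 (xi p.1.1)) =
      latChar D.PA ((1 : Equiv.Perm V) (xi μ0.1))) = {(μ0, 1)} := by
    ext ⟨μ, u⟩
    simp only [Finset.mem_filter, Finset.mem_product, Finset.mem_singleton, Prod.mk.injEq]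
    constructor
    · rintro ⟨⟨_, hu⟩, h⟩
      have := xi_distinct hw (hS μ0.1 μ0.2) (hS μ.1 μ.2) ((hW u).1 hu) h
      exact ⟨Subtype.ext this.2, this.1⟩
    · rintro ⟨rfl, rfl⟩
      exact ⟨⟨hμ0, (hW 1).2 D.W0.one_mem⟩, rfl⟩
  dsimp only at h2
  rw [h3, Finset.sum_singleton] at h2
  exact (mul_eq_zero.1 h2).resolve_right ((hS μ0.1 μ0.2).C_ne D.W0.one_mem)

/-- Orbit sums on the dual side. -/
def msum (W0fin : Finset (Equiv.Perm V)) (c : ℝ) (lam κ : V) : ℂ :=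
  ∑ w ∈ W0fin, Complex.exp (Complex.I * (⟪(2 * Real.pi / c) • w lam, κ⟫ : ℝ))

lemma msum_step (hcz : 1 < cz) (hW : ∀ w : Equiv.Perm V, w ∈ W0fin ↔ w ∈ D.W0) {lam : V}
    (hl : lam ∈ D.weightLattice) {α : V} (ha : α ∈ D.R0) (m : ℤ) (κ : V) :
    msum W0fin cz lam (rf α κ + ((m * cz : ℤ) : ℝ) • coroot α) = msum W0fin cz lam κ := by
  have hc : (0:ℝ) < cz := by exact_mod_cast (by omega : 0 < cz)
  have hα := D.ne_zero α ha
  unfold msum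
  refine Finset.sum_bij' (fun w _ => rfPerm α hα * w) (fun w _ => rfPerm α hα * w) ?_ ?_ ?_ ?_ ?_
  · intro w hw
    rw [hW] at hw ⊢
    exact D.W0.mul_mem (D.rfPerm_mem ha) hw
  · intro w hw
    rw [hW] at hw ⊢
    exact D.W0.mul_mem (D.rfPerm_mem ha) hw
  · intro w _
    ext x
    exact rf_rf hα _
  · intro w _
    ext x
    exact rf_rf hα _
  · intro w hw
    obtain ⟨k, hk⟩ := D.P_W0 ((hW w).1 hw) hl α ha
    have e : (rfPerm α hα * w) lam = rf α (w lam) := rfl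
    rw [e, Complex.exp_eq_exp_iff_exists_int]
    refine ⟨k * m, ?_⟩
    rw [inner_smul_left, inner_smul_left, inner_add_right, inner_smul_right, hk, inner_rf_left]
    simp only [conj_trivial]
    have hc' : (cz : ℂ) ≠ 0 := by exact_mod_cast hc.ne'
    push_cast
    field_simp

lemma msum_extend (hcz : 1 < cz) (hW : ∀ w : Equiv.Perm V, w ∈ W0fin ↔ w ∈ D.W0)
    (s : Finset (Pc D (cz : ℝ))) (g : Pc D (cz : ℝ) → ℂ)
    (h : ∀ x ∈ PcVee D (cz : ℝ), ∑ l ∈ s, g l * msum W0fin cz l.1 x = 0) :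
    ∀ x ∈ D.coweightLattice, ∑ l ∈ s, g l * msum W0fin cz l.1 x = 0 := by
  have hc : (0:ℝ) < cz := by exact_mod_cast (by omega : 0 < cz)
  apply dist_induct (D.bp cz) (D.Pv_ball _)
    (Q := fun x => ∑ l ∈ s, g l * msum W0fin cz l.1 x = 0)
  intro x hx ih
  by_cases hA : x ∈ PcVee D (cz : ℝ)
  · exact h x hA
  have key : ∀ α ∈ D.pos, ∀ m : ℤ, 0 < (⟪x, α⟫ - m * cz) * (m * cz - ⟪D.bp cz, α⟫) →
      ∑ l ∈ s, g l * msum W0fin cz l.1 x = 0 := by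
    intro α ha m hm
    have hR := D.pos_mem ha
    have hα := D.ne_zero α hR
    have e : ∀ l ∈ s, g l * msum W0fin cz l.1 x =
        g l * msum W0fin cz l.1 (rf α x + ((m * cz : ℤ) : ℝ) • coroot α) := by
      intro l _
      rw [msum_step hcz hW l.2.1 hR]
    rw [Finset.sum_congr rfl e]
    have e2 : rf α x + ((m * cz : ℤ) : ℝ) • coroot α = x - (⟪x, α⟫ - m * cz) • coroot α := by
      rw [rf_eq']; push_cast; module
    apply ih
    · rw [e2]
      obtain ⟨k, hk⟩ := hx α hR
      intro β hb
      obtain ⟨q, hq⟩ := hx β hb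
      obtain ⟨r, hr⟩ := D.coroot_Pv hR β hb
      exact ⟨q - (k - m * cz) * r, by
        rw [inner_sub_left, inner_smul_left, hq, hr, hk]; simp⟩
    · rw [e2]
      apply lt_of_pow_lt_pow_left₀ 2 (norm_nonneg _)
      set t := ⟪x, α⟫ - m * cz with ht
      have hK := inner_self_pos' hα
      have e3 : x - t • coroot α - D.bp cz = (x - D.bp cz) - t • coroot α := by abel
      have h5 : ⟪coroot α, coroot α⟫ = 4 / ⟪α, α⟫ := by
        rw [inner_coroot, real_inner_comm α (coroot α), inner_coroot]; field_simp; norm_num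
      have h6 : ⟪x - D.bp cz, coroot α⟫ = 2 / ⟪α, α⟫ * (⟪x, α⟫ - ⟪D.bp cz, α⟫) := by
        rw [inner_coroot, inner_sub_left]
      rw [e3, ← real_inner_self_eq_norm_sq, ← real_inner_self_eq_norm_sq, inner_sub_sub_self, inner_smul_left,
        inner_smul_right, inner_smul_left, inner_smul_right, real_inner_comm (x - D.bp cz) (coroot α), h5, h6]
      simp only [conj_trivial]
      have h7 : 0 < (4 / ⟪α, α⟫) * (t * (m * cz - ⟪D.bp cz, α⟫)) := by positivity
      have h8 : ⟪x, α⟫ = t + m * cz := by rw [ht]; ring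
      rw [h8]
      have h9 : 4 / ⟪α, α⟫ = 2 * (2 / ⟪α, α⟫) := by ring
      rw [h9] at h7 ⊢
      nlinarith
  have hbp : ∀ α ∈ D.pos, 0 < ⟪D.bp cz, α⟫ ∧ ⟪D.bp cz, α⟫ < cz := by
    intro α ha
    have hR := D.pos_mem ha
    refine ⟨?_, (abs_lt.1 (D.bp_bound hc hR).2).2⟩
    have h1 := (D.bp_pos hc hR).1 ha
    rw [inner_coroot] at h1
    have hK := inner_self_pos' (D.ne_zero α hR)
    exact (mul_pos_iff_of_pos_left (by positivity)).1 h1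
  have : ∃ α ∈ D.pos, ⟪x, α⟫ < 0 ∨ (cz:ℝ) < ⟪x, α⟫ := by
    by_contra! h
    exact hA ⟨hx, h⟩
  obtain ⟨α, ha, h1 | h1⟩ := this
  · apply key α ha 0
    have := (hbp α ha).1
    push_cast
    nlinarith
  · apply key α ha 1
    have := (hbp α ha).2
    push_cast
    apply mul_pos <;> linarith

lemma indepM (hcz : 1 < cz) {wmin : V → Equiv.Perm V} (hw : D.IsWmin (cz:ℝ) wmin)
    (hW : ∀ w : Equiv.Perm V, w ∈ W0fin ↔ w ∈ D.W0) :
    LinearIndependent ℂ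
        (fun (lam : Pc D (cz : ℝ)) (κ : PcVee D (cz : ℝ)) => msum W0fin cz lam.1 κ.1) := by
  have hc : (0:ℝ) < cz := by exact_mod_cast (by omega : 0 < cz)
  have hpi := Real.pi_pos
  rw [linearIndependent_iff']
  intro s g hg l0 hl0
  have h1 := msum_extend hcz hW s g (by
    intro x hx
    have := congrFun hg ⟨x, hx⟩
    rw [Finset.sum_apply] at this
    simpa using this)
  have h2 := dedekind (s ×ˢ W0fin) D.PvA (fun p => (2 * Real.pi / (cz:ℝ)) • p.2 p.1.1) (fun p => g p.1)
    (by
      intro x hx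
      rw [← h1 x hx, Finset.sum_product]
      apply Finset.sum_congr rfl
      intro μ _
      rw [msum, Finset.mul_sum]) (l0, 1) (Finset.mem_product.2 ⟨hl0, (hW 1).2 D.W0.one_mem⟩)
  dsimp only at h2
  rw [Finset.sum_congr rfl (g := fun _ => g l0), Finset.sum_const, nsmul_eq_mul] at h2
  · refine (mul_eq_zero.1 h2).resolve_left ?_
    refine Nat.cast_ne_zero.2 ?_
    exact Finset.card_ne_zero_of_mem (a := (l0, 1)) (Finset.mem_filter.2
      ⟨Finset.mem_product.2 ⟨hl0, (hW 1).2 D.W0.one_mem⟩, rfl⟩)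
  · rintro ⟨l, w⟩ hp
    simp only [Finset.mem_filter, Finset.mem_product] at hp
    obtain ⟨⟨_, hwf⟩, h⟩ := hp
    have hwW := (hW w).1 hwf
    have hη : (cz:ℝ)⁻¹ • (l0.1 - w l.1) ∈ D.Qr := by
      apply D.Qr_of_dual
      intro x hx
      obtain ⟨k, hk⟩ := latChar_int h x hx
      refine ⟨-k, ?_⟩
      have e : (1 : Equiv.Perm V) l0.1 = l0.1 := rfl
      rw [e, ← smul_sub, inner_smul_left] at hk
      simp only [conj_trivial] at hk
      have e2 : l0.1 - w l.1 = -(w l.1 - l0.1) := by abel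
      rw [e2, inner_smul_left, inner_neg_left]
      simp only [conj_trivial]
      push_cast
      field_simp at hk ⊢
      linarith
    obtain ⟨u, hu, hu2⟩ := D.WR_of (cz:ℝ) hwW hη
    have h3 : u l.1 = l0.1 := by
      rw [hu2, smul_smul, mul_inv_cancel₀ hc.ne', one_smul]; abel
    have h4 := D.alcove_unique hc hw hu l.2.2 (h3.symm ▸ l0.2.2)
    have h5 : l = l0 := Subtype.ext (h4.symm.trans h3)
    show g l = g l0
    rw [h5]

lemma partA (hcz : 1 < cz) {wmin : V → Equiv.Perm V} (hw : D.IsWmin (cz:ℝ) wmin)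
    (hW : ∀ w : Equiv.Perm V, w ∈ W0fin ↔ w ∈ D.W0)
    (hS : ∀ μ ∈ PcVee D (cz : ℝ), D.Stp (cz : ℝ) τ μ (xi μ)) :
    LinearIndependent ℂ
        (fun (μ : PcVee D (cz : ℝ)) (lam : Pc D (cz : ℝ)) =>
          PhiFun D τ W0fin (xi μ.1) lam.1) ∧
      Submodule.span ℂ (Set.range
        (fun (μ : PcVee D (cz : ℝ)) (lam : Pc D (cz : ℝ)) =>
          PhiFun D τ W0fin (xi μ.1) lam.1)) = ⊤ ∧
      Nat.card (PcVee D (cz : ℝ)) = Nat.card (Pc D (cz : ℝ)) := by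
  haveI : Fintype (Pc D (cz:ℝ)) := (Pc_finite cz).fintype
  haveI : Fintype (PcVee D (cz:ℝ)) := (PcVee_finite cz).fintype
  have h1 := indepPhi hcz hw hW hS
  have h2 := indepM (D := D) hcz hw hW
  have c1 := h1.fintype_card_le_finrank
  have c2 := h2.fintype_card_le_finrank
  rw [Module.finrank_fintype_fun_eq_card] at c1 c2
  have hcard := le_antisymm c1 c2
  refine ⟨h1, ?_, by rw [Nat.card_eq_fintype_card, Nat.card_eq_fintype_card, hcard]⟩
  exact h1.span_eq_top_of_card_eq_finrank' (by rw [Module.finrank_fintype_fun_eq_card, hcard])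

end indep

end RootSystemData


open RootSystemData in
/-- (a) the periodic Macdonald spherical functions `Φ_{ξ_μ}`,
`μ ∈ P_c^{∨,+}`, form a basis of the space of functions `P_c⁺ → ℂ` (in particular
`#P_c^{∨,+} = #P_c⁺`), and (b) they are joint eigenfunctions of the discrete Laplacians
`L_ω` (`ω` (quasi-)minuscule) with eigenvalues `m_ω(e^{-iξ_μ})`. -/
theorem statement15 {V : Type*} [NormedAddCommGroup V] [InnerProductSpace ℝ V]
    (D : RootSystemData V) (cz : ℤ) (hc : 1 < cz)
    (τ : V × ℤ → ℝ) (hτpos : ∀ a : V × ℤ, D.IsAffRoot a → 0 < τ a ∧ τ a < 1)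
    (hτinv : ∀ w ∈ D.Wext (cz : ℝ), ∀ a b : V × ℤ, D.IsAffRoot a → D.IsAffRoot b →
      mapsRoot (cz : ℝ) w a b → τ a = τ b)
    (wmin : V → Equiv.Perm V) (hwmin : D.IsWmin (cz : ℝ) wmin)
    (W0fin : Finset (Equiv.Perm V)) (hW0fin : ∀ w : Equiv.Perm V, w ∈ W0fin ↔ w ∈ D.W0)
    (xi : V → V)
    (hxi : ∀ μ ∈ PcVee D (cz : ℝ), ∀ ζ : V,
      D.morse (cz : ℝ) (fun α => τ (α, (0 : ℤ)) ^ 2) μ (xi μ)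
        ≤ D.morse (cz : ℝ) (fun α => τ (α, (0 : ℤ)) ^ 2) μ ζ) :
    -- (a) basis of the space of functions P_c⁺ → ℂ
    (LinearIndependent ℂ
        (fun (μ : PcVee D (cz : ℝ)) (lam : Pc D (cz : ℝ)) =>
          PhiFun D τ W0fin (xi μ.1) lam.1) ∧
      Submodule.span ℂ (Set.range
        (fun (μ : PcVee D (cz : ℝ)) (lam : Pc D (cz : ℝ)) =>
          PhiFun D τ W0fin (xi μ.1) lam.1)) = ⊤ ∧
      Nat.card (PcVee D (cz : ℝ)) = Nat.card (Pc D (cz : ℝ))) ∧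
    -- (b) joint eigenfunctions of the Laplacians L_ω
    (∀ ω : V, D.IsMinuscule ω ∨ D.IsQuasiMinuscule ω →
      ∀ orb : Finset V, (∀ ν : V, ν ∈ orb ↔ ∃ w ∈ D.W0, w ω = ν) →
      ∀ μ ∈ PcVee D (cz : ℝ), ∀ lam ∈ Pc D (cz : ℝ),
      ∀ Orb : V → Finset V,
        (∀ ν μ' : V, μ' ∈ Orb ν ↔ ∃ w ∈ D.WR (cz : ℝ), w lam = lam ∧ w (lam - ν) = μ') →
        (((∑ ν ∈ orb.filter fun ν => (wmin (lam - ν)) (lam - ν) = lam,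
              D.tauw (cz : ℝ) τ (wmin (lam - ν)) ^ 2)
            + (1 - (D.tauZero τ)⁻¹ ^ 2) *
              ∑ ν ∈ orb.filter fun ν => (wmin (lam - ν)) lam = lam,
                D.ccoef (cz : ℝ) τ wmin lam ν : ℝ) : ℂ)
            * PhiFun D τ W0fin (xi μ) lam
          + ∑ ν ∈ orb.filter fun ν => lam - ν ∈ Pc D (cz : ℝ),
              ((∑ μ' ∈ Orb ν, D.tauw (cz : ℝ) τ (wmin μ') ^ 2 : ℝ) : ℂ)
                * PhiFun D τ W0fin (xi μ) (lam - ν)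
          = (∑ ν ∈ orb, Complex.exp (-(Complex.I * (⟪ν, xi μ⟫ : ℝ))))
              * PhiFun D τ W0fin (xi μ) lam) := by
  have hcr : (0:ℝ) < cz := by exact_mod_cast (by omega : 0 < cz)
  have hS : ∀ μ ∈ PcVee D (cz : ℝ), D.Stp (cz : ℝ) τ μ (xi μ) := fun μ hμ =>
    ⟨hcr, hτpos, hτinv, hμ, D.critical (RootSystemData.TOk_of hτpos hτinv) (hxi μ hμ)⟩
  refine ⟨RootSystemData.partA hc hwmin hW0fin hS, ?_⟩
  intro ω hω orb ho μ hμ lam hlam Orb hO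
  exact RootSystemData.partB hc (hS μ hμ) hW0fin hwmin hω ho hlam hO
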